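/- For each d ∈ {4, 5, 6, 7} there exist a properly convex domain Ω ⊆ ℝP^d and a discrete subgroup Γ of SL^±_{d+1}(ℝ) preserving Ω and acting properly discontinuously and cocompactly on Ω, such that: Γ is strongly irreducible (so Ω is indecomposable and divisible); Ω is not strictly convex; ∂Ω is not C¹ (some boundary point lies in two distinct supporting hyperplanes); Ω contains a properly embedded (d−2)-simplex; and Ω contains no properly embedded (d−1)-simplex. -/

import Mathlib

open Matrix

noncomputable section

/-- `ℝ^{d+1}`. -/
abbrev Vec (d : ℕ) := Fin (d + 1) → ℝ

/-- The real projective space `ℝP^d`. -/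
abbrev RP (d : ℕ) := Projectivization ℝ (Vec d)

instance (d : ℕ) : TopologicalSpace (RP d) :=
  inferInstanceAs (TopologicalSpace (Quotient (projectivizationSetoid ℝ (Vec d))))

/-- The projective transformation of `ℝP^d` induced by an invertible matrix. -/
def projMap {d : ℕ} (g : GL (Fin (d + 1)) ℝ) : RP d → RP d :=
  Projectivization.map (Matrix.mulVecLin (g : Matrix (Fin (d + 1)) (Fin (d + 1)) ℝ))
    (by
      intro x y hxy
      have hdet : IsUnit (g : Matrix (Fin (d + 1)) (Fin (d + 1)) ℝ).det :=
        (Matrix.isUnit_iff_isUnit_det _).mp g.isUnit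
      have h := congrArg
        (Matrix.mulVec ((g : Matrix (Fin (d + 1)) (Fin (d + 1)) ℝ))⁻¹) hxy
      simpa [Matrix.mulVecLin_apply, Matrix.mulVec_mulVec,
        Matrix.nonsing_inv_mul _ hdet] using h)

/-- A sharp convex open cone in `ℝ^{d+1}`: nonempty, open, convex, stable under positive
scalars, containing no affine line. -/
def IsProperCone {d : ℕ} (C : Set (Vec d)) : Prop :=
  C.Nonempty ∧ IsOpen C ∧ Convex ℝ C ∧
    (∀ x ∈ C, ∀ t : ℝ, 0 < t → t • x ∈ C) ∧
    ¬ ∃ x v : Vec d, v ≠ 0 ∧ ∀ t : ℝ, x + t • v ∈ C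

/-- The projectivization of a cone: a subset of `ℝP^d`. -/
def projOfCone {d : ℕ} (C : Set (Vec d)) : Set (RP d) :=
  {P | ∃ (v : Vec d) (hv : v ≠ 0), v ∈ C ∧ P = Projectivization.mk ℝ v hv}

/-- `Ω` is a properly convex domain if it is the projectivization of a sharp convex open
cone. -/
def IsProperlyConvexDomain {d : ℕ} (Ω : Set (RP d)) : Prop :=
  ∃ C : Set (Vec d), IsProperCone C ∧ Ω = projOfCone C

/-- Membership in `SL^±_{d+1}(ℝ)`: determinant `±1`. -/
def detPM1 {d : ℕ} (g : GL (Fin (d + 1)) ℝ) : Prop :=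
  (g : Matrix (Fin (d + 1)) (Fin (d + 1)) ℝ).det = 1 ∨
  (g : Matrix (Fin (d + 1)) (Fin (d + 1)) ℝ).det = -1

/-- `Γ` preserves `Ω` (projectively). -/
def PreservesDomain {d : ℕ} (Γ : Subgroup (GL (Fin (d + 1)) ℝ)) (Ω : Set (RP d)) : Prop :=
  ∀ γ ∈ Γ, projMap γ '' Ω = Ω

/-- The action of `Γ` on `Ω` is properly discontinuous. -/
def ProperlyDiscontinuousOn {d : ℕ} (Γ : Subgroup (GL (Fin (d + 1)) ℝ))
    (Ω : Set (RP d)) : Prop :=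
  ∀ K : Set (RP d), K ⊆ Ω → IsCompact K →
    {γ : Γ | (projMap (γ : GL (Fin (d + 1)) ℝ) '' K ∩ K).Nonempty}.Finite

/-- The action of `Γ` on `Ω` is cocompact: `Ω/Γ` is compact. -/
def CocompactOn {d : ℕ} (Γ : Subgroup (GL (Fin (d + 1)) ℝ)) (Ω : Set (RP d)) : Prop :=
  ∃ K : Set (RP d), IsCompact K ∧ K ⊆ Ω ∧
    (⋃ γ ∈ Γ, projMap γ '' K) = Ω

/-- `Ω` is divided by `Γ`: `Γ` consists of determinant-`±1` matrices, is discrete,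
preserves `Ω`, and acts properly discontinuously and cocompactly on `Ω`. -/
def Divides {d : ℕ} (Γ : Subgroup (GL (Fin (d + 1)) ℝ)) (Ω : Set (RP d)) : Prop :=
  (∀ γ ∈ Γ, detPM1 γ) ∧ DiscreteTopology Γ ∧ PreservesDomain Γ Ω ∧
    ProperlyDiscontinuousOn Γ Ω ∧ CocompactOn Γ Ω

/-- `Ω` is strictly convex: its boundary contains no nondegenerate projective line
segment. -/
def IsStrictlyConvexDomain {d : ℕ} (Ω : Set (RP d)) : Prop :=
  ∀ v w : Vec d, LinearIndependent ℝ ![v, w] →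
    ¬ ∀ t ∈ Set.Icc (0 : ℝ) 1, ∀ h : t • v + (1 - t) • w ≠ 0,
        Projectivization.mk ℝ (t • v + (1 - t) • w) h ∈ frontier Ω

/-- Every finite-index subgroup of `Γ` acts irreducibly on `ℝ^{d+1}`. -/
def StronglyIrreducible {d : ℕ} (Γ : Subgroup (GL (Fin (d + 1)) ℝ)) : Prop :=
  ∀ Δ : Subgroup (GL (Fin (d + 1)) ℝ), Δ ≤ Γ → (Δ.subgroupOf Γ).FiniteIndex →
    ∀ W : Submodule ℝ (Vec d),
      (∀ γ ∈ Δ, ∀ x ∈ W,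
        Matrix.mulVec ((γ : GL (Fin (d + 1)) ℝ) : Matrix (Fin (d + 1)) (Fin (d + 1)) ℝ) x ∈ W) →
      W = ⊥ ∨ W = ⊤

/-- The `k`-simplex spanned by `v : Fin (k+1) → ℝ^{d+1}` in `ℝP^d`. -/
def simplexSet {d k : ℕ} (v : Fin (k + 1) → Vec d) : Set (RP d) :=
  {P | ∃ t : Fin (k + 1) → ℝ, (∀ i, 0 ≤ t i) ∧ t ≠ 0 ∧
    ∃ h : (∑ i, t i • v i) ≠ 0, P = Projectivization.mk ℝ (∑ i, t i • v i) h}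

/-- The relative interior of the `k`-simplex spanned by `v`. -/
def simplexInterior {d k : ℕ} (v : Fin (k + 1) → Vec d) : Set (RP d) :=
  {P | ∃ t : Fin (k + 1) → ℝ, (∀ i, 0 < t i) ∧
    ∃ h : (∑ i, t i • v i) ≠ 0, P = Projectivization.mk ℝ (∑ i, t i • v i) h}

/-- A properly embedded `k`-simplex in `Ω`: relative interior inside `Ω` and boundary
inside `∂Ω`. -/
def ProperlyEmbeddedSimplex {d k : ℕ} (Ω : Set (RP d)) (v : Fin (k + 1) → Vec d) : Prop :=
  LinearIndependent ℝ v ∧ simplexInterior v ⊆ Ω ∧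
    simplexSet v \ simplexInterior v ⊆ frontier Ω

/-- `φ` cuts out a supporting hyperplane of `Ω` at `x`. -/
def IsSupportingAt {d : ℕ} (Ω : Set (RP d)) (φ : Module.Dual ℝ (Vec d)) (x : RP d) : Prop :=
  φ ≠ 0 ∧ φ x.rep = 0 ∧ ∀ P ∈ Ω, φ (Projectivization.rep P) ≠ 0

end

/-- Linear reflections `x ↦ x - α i x • v i` whose Cartan matrix is of Coxeter type with all
labels in `{2, 3, ∞}`, together with a point in the open chamber. -/
structure ReflectionData (ι E : Type*) [AddCommGroup E] [Module ℝ E] where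
  α : ι → Module.Dual ℝ E
  v : ι → E
  two : ∀ i, α i (v i) = 2
  cartan : ∀ i j, i ≠ j → (α i (v j) = 0 ∧ α j (v i) = 0) ∨
    (α i (v j) < 0 ∧ α j (v i) < 0 ∧
      (α i (v j) * α j (v i) = 1 ∨ 4 ≤ α i (v j) * α j (v i)))
  x₀ : E
  pos : ∀ i, 0 < α i x₀

namespace ReflectionData

variable {ι E : Type*} [AddCommGroup E] [Module ℝ E] (R : ReflectionData ι E)

/-- The reflections. -/
noncomputable def s (i : ι) : E ≃ₗ[ℝ] E := Module.reflection (R.two i)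

lemma s_apply (i : ι) (x : E) : R.s i x = x - R.α i x • R.v i := by
  simp [s, Module.reflection_apply]

lemma s_mul_s (i : ι) : R.s i * R.s i = 1 := by
  ext x
  exact Module.involutive_reflection (R.two i) x

@[simp] lemma s_s (i : ι) (x : E) : R.s i (R.s i x) = x :=
  Module.involutive_reflection (R.two i) x

lemma s_inv (i : ι) : (R.s i)⁻¹ = R.s i := by
  rw [inv_eq_iff_mul_eq_one]; exact R.s_mul_s i

/-- The closed chamber. -/
def C : Set E := {x | ∀ i, 0 ≤ R.α i x}

/-- The reflection group. -/
def W : Subgroup (E ≃ₗ[ℝ] E) := Subgroup.closure (Set.range R.s)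

/-- The standard parabolic subgroup of a set of generators. -/
def WJ (J : Set ι) : Subgroup (E ≃ₗ[ℝ] E) := Subgroup.closure (R.s '' J)

lemma s_mem (i : ι) : R.s i ∈ R.W := Subgroup.subset_closure ⟨i, rfl⟩

lemma s_mem_WJ {J : Set ι} {i : ι} (h : i ∈ J) : R.s i ∈ R.WJ J :=
  Subgroup.subset_closure ⟨i, h, rfl⟩

lemma WJ_le (J : Set ι) : R.WJ J ≤ R.W :=
  Subgroup.closure_mono (Set.image_subset_range _ _)

lemma WJ_mono {J J' : Set ι} (h : J ⊆ J') : R.WJ J ≤ R.WJ J' :=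
  Subgroup.closure_mono (Set.image_mono h)

/-- The product of the reflections along a word. -/
noncomputable def wd (l : List ι) : E ≃ₗ[ℝ] E := (l.map R.s).prod

/-- Word length. -/
noncomputable def len (g : E ≃ₗ[ℝ] E) : ℕ := sInf {k | ∃ l : List ι, l.length = k ∧ R.wd l = g}

lemma exists_word {g : E ≃ₗ[ℝ] E} (hg : g ∈ R.W) : ∃ l, R.wd l = g := by
  induction hg using Subgroup.closure_induction with
  | mem x hx => obtain ⟨i, rfl⟩ := hx; exact ⟨[i], by simp [wd]⟩
  | one => exact ⟨[], rfl⟩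
  | mul x y _ _ hx hy =>
    obtain ⟨l, rfl⟩ := hx; obtain ⟨l', rfl⟩ := hy; exact ⟨l ++ l', by simp [wd]⟩
  | inv x _ hx =>
    obtain ⟨l, rfl⟩ := hx
    refine ⟨l.reverse, ?_⟩
    rw [wd, wd, List.prod_inv_reverse, List.map_reverse, List.map_map]
    congr 1

lemma exists_len {g : E ≃ₗ[ℝ] E} (hg : g ∈ R.W) :
    ∃ l : List ι, l.length = R.len g ∧ R.wd l = g := by
  obtain ⟨l, hl⟩ := R.exists_word hg
  exact Nat.sInf_mem (s := {k | ∃ l : List ι, l.length = k ∧ R.wd l = g}) ⟨_, l, rfl, hl⟩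

lemma len_wd_le (l : List ι) : R.len (R.wd l) ≤ l.length := Nat.sInf_le ⟨l, rfl, rfl⟩

lemma len_s_mul_le (i : ι) {g : E ≃ₗ[ℝ] E} (hg : g ∈ R.W) : R.len (R.s i * g) ≤ R.len g + 1 := by
  obtain ⟨l, h1, h2⟩ := R.exists_len hg
  have := R.len_wd_le (i :: l)
  simpa [wd, h1, ← h2] using this

lemma s_mul_s_mul (i : ι) (g : E ≃ₗ[ℝ] E) : R.s i * (R.s i * g) = g := by
  rw [← mul_assoc, s_mul_s, one_mul]

lemma len_le_s_mul (i : ι) {g : E ≃ₗ[ℝ] E} (hg : g ∈ R.W) : R.len g ≤ R.len (R.s i * g) + 1 := by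
  have := R.len_s_mul_le i (mul_mem (R.s_mem i) hg)
  rwa [s_mul_s_mul] at this

lemma exists_descent {g : E ≃ₗ[ℝ] E} (hg : g ∈ R.W) (h1 : g ≠ 1) :
    ∃ i, R.len (R.s i * g) < R.len g := by
  obtain ⟨l, hl, rfl⟩ := R.exists_len hg
  cases l with
  | nil => exact absurd rfl h1
  | cons i l =>
    refine ⟨i, ?_⟩
    have : R.s i * R.wd (i :: l) = R.wd l := by
      simp [wd, ← mul_assoc, s_mul_s]
    rw [this]
    have := R.len_wd_le l
    simp at hl
    omega

/-- Alternating words. -/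
noncomputable def alt (i j : ι) : ℕ → (E ≃ₗ[ℝ] E)
  | 0 => 1
  | k + 1 => alt i j k * R.s (if Even k then j else i)

lemma len_alt_mul_le (i j : ι) (k : ℕ) {h : E ≃ₗ[ℝ] E} (hh : h ∈ R.W) :
    R.len (R.alt i j k * h) ≤ k + R.len h := by
  induction k generalizing h with
  | zero => simp [alt]
  | succ k ih =>
    rw [alt, mul_assoc]
    have := ih (mul_mem (R.s_mem (if Even k then j else i)) hh)
    have := R.len_s_mul_le (if Even k then j else i) hh
    omega

lemma alt_infinite {i j : ι} (h1 : R.α i (R.v j) < 0) (h2 : R.α j (R.v i) < 0)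
    (h3 : 4 ≤ R.α i (R.v j) * R.α j (R.v i)) (k : ℕ) :
    ∃ p q : ℝ, 0 ≤ p ∧ 0 ≤ q ∧
      (if Even k then 2 * q ≤ - R.α i (R.v j) * p else 2 * p ≤ - R.α j (R.v i) * q) ∧
      ∀ x, R.α i (R.alt i j k x) = p * R.α i x + q * R.α j x := by
  induction k with
  | zero => exact ⟨1, 0, by simp, by simp, by simp; linarith, by simp [alt]⟩
  | succ k ih =>
    obtain ⟨p, q, hp, hq, hc, hx⟩ := ih
    set A := R.α i (R.v j)
    set B := R.α j (R.v i)
    by_cases hk : Even k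
    · have hk' : ¬ Even (k + 1) := by simpa [Nat.even_add_one] using hk
      simp only [hk, if_true] at hc
      refine ⟨p, -A * p - q, hp, by linarith, ?_, fun x => ?_⟩
      · rw [if_neg hk']
        nlinarith [mul_nonneg hp (sub_nonneg.2 h3), mul_nonneg (neg_nonneg.2 h2.le) (sub_nonneg.2 hc)]
      · simp only [alt, hk, if_true, LinearEquiv.mul_apply, hx]
        simp only [s_apply, map_sub, map_smul, smul_eq_mul, R.two]
        ring
    · have hk' : Even (k + 1) := by simpa [Nat.even_add_one] using hk
      simp only [hk, if_false] at hc
      refine ⟨-B * q - p, q, by linarith, hq, ?_, fun x => ?_⟩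
      · rw [if_pos hk']
        nlinarith [mul_nonneg hq (sub_nonneg.2 h3), mul_nonneg (neg_nonneg.2 h1.le) (sub_nonneg.2 hc)]
      · simp only [alt, hk, if_false, LinearEquiv.mul_apply, hx]
        simp only [s_apply, map_sub, map_smul, smul_eq_mul, R.two]
        ring

lemma comm_of_zero {i j : ι} (h1 : R.α i (R.v j) = 0) (h2 : R.α j (R.v i) = 0) :
    R.s j * R.s i = R.s i * R.s j := by
  ext x
  simp only [LinearEquiv.mul_apply, s_apply, map_sub, map_smul, h1, h2]
  module

lemma braid {i j : ι} (h : R.α i (R.v j) * R.α j (R.v i) = 1) :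
    R.s j * R.s i * R.s j = R.s i * R.s j * R.s i := by
  ext x
  simp only [LinearEquiv.mul_apply, s_apply, map_sub, map_smul, R.two]
  match_scalars
  all_goals first
    | ring1
    | linear_combination (-R.α j x) * h
    | linear_combination (R.α i x) * h

/-- Tits' lemma: the sign of a simple root on a chamber is determined by word length. -/
theorem tits {g : E ≃ₗ[ℝ] E} (hg : g ∈ R.W) {i : ι} (hi : R.len g ≤ R.len (R.s i * g))
    {x : E} (hx : x ∈ R.C) : 0 ≤ R.α i (g x) := by
  induction hn : R.len g using Nat.strong_induction_on generalizing g i with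
  | _ n ih =>
  by_cases h1 : g = 1
  · subst h1; exact hx i
  obtain ⟨j, hj⟩ := R.exists_descent hg h1
  have hij : i ≠ j := by rintro rfl; omega
  let S : ℕ → Prop := fun k => ∃ h ∈ R.W, g = R.alt i j k * h ∧ R.len h + k = R.len g
  have hS1 : S 1 := by
    refine ⟨R.s j * g, mul_mem (R.s_mem j) hg, ?_, ?_⟩
    · simp [alt, s_mul_s_mul]
    · have := R.len_le_s_mul j hg
      omega
  have hdown : ∀ k, S (k + 1) → S k := by
    rintro k ⟨h, hh, he, hl⟩
    refine ⟨R.s (if Even k then j else i) * h, mul_mem (R.s_mem _) hh, ?_, ?_⟩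
    · rw [he, alt, mul_assoc]
    · have a1 := R.len_s_mul_le (if Even k then j else i) hh
      have a2 := R.len_alt_mul_le i j k (mul_mem (R.s_mem (if Even k then j else i)) hh)
      rw [← mul_assoc, ← alt, ← he] at a2
      omega
  have hdown' : ∀ k m, S (k + m) → S k := by
    intro k m
    induction m with
    | zero => exact id
    | succ m ihm => exact fun h => ihm (hdown _ h)
  have hSle : ∀ k, S k → k ≤ R.len g := by
    rintro k ⟨h, -, -, hl⟩; omega
  classical
  obtain ⟨k, hk1, hSk, hmax⟩ : ∃ k, 1 ≤ k ∧ S k ∧ ¬ S (k + 1) := by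
    refine ⟨Nat.findGreatest S (R.len g), Nat.le_findGreatest (hSle 1 hS1) hS1,
      Nat.findGreatest_spec (hSle 1 hS1) hS1, fun h => ?_⟩
    have := Nat.le_findGreatest (hSle _ h) h
    omega
  have hSk' := hSk
  obtain ⟨h, hh, he, hl⟩ := hSk
  have hlt : R.len h < n := by omega
  have ha : R.len h ≤ R.len (R.s (if Even k then j else i) * h) := by
    by_contra! hc
    refine hmax ⟨R.s (if Even k then j else i) * h, mul_mem (R.s_mem _) hh, ?_, ?_⟩
    · rw [alt, mul_assoc, s_mul_s_mul, he]
    · have := R.len_le_s_mul (if Even k then j else i) hh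
      omega
  have hb : R.len h ≤ R.len (R.s (if Even k then i else j) * h) := by
    by_contra! hc
    obtain ⟨m, rfl⟩ : ∃ m, k = m + 1 := ⟨k - 1, by omega⟩
    have e : (if Even (m + 1) then i else j) = if Even m then j else i := by
      by_cases hm : Even m <;> simp [hm, Nat.even_add_one]
    rw [e] at hc
    have a2 := R.len_alt_mul_le i j m (mul_mem (R.s_mem (if Even m then j else i)) hh)
    rw [← mul_assoc, ← alt, ← he] at a2
    omega
  have hA := ih _ hlt hh ha rfl
  have hB := ih _ hlt hh hb rfl
  have hij' : 0 ≤ R.α i (h x) ∧ 0 ≤ R.α j (h x) := by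
    by_cases hk : Even k
    · simp only [hk, if_true] at hA hB; exact ⟨hB, hA⟩
    · simp only [hk, if_false] at hA hB; exact ⟨hA, hB⟩
  obtain ⟨p, q, hp, hq, hpq⟩ : ∃ p q : ℝ, 0 ≤ p ∧ 0 ≤ q ∧
      ∀ x, R.α i (R.alt i j k x) = p * R.α i x + q * R.α j x := by
    rcases R.cartan i j hij with ⟨c1, c2⟩ | ⟨c1, c2, c3 | c3⟩
    · have hk2 : k < 2 := by
        by_contra! hc
        obtain ⟨m, rfl⟩ := Nat.exists_eq_add_of_le hc
        obtain ⟨h', hh', he', hl'⟩ := hdown' 2 m hSk'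
        have : R.s i * g = R.s j * h' := by
          rw [he']
          simp only [alt, one_mul, Even.zero, if_true, Nat.not_even_one, if_false]
          rw [R.comm_of_zero c1 c2, mul_assoc, s_mul_s_mul]
        rw [this] at hi
        have := R.len_s_mul_le j hh'
        omega
      obtain rfl : k = 1 := by omega
      refine ⟨1, 0, by simp, by simp, fun x => ?_⟩
      simp [alt, s_apply, c1]
    · have hk2 : k < 3 := by
        by_contra! hc
        obtain ⟨m, rfl⟩ := Nat.exists_eq_add_of_le hc
        obtain ⟨h', hh', he', hl'⟩ := hdown' 3 m hSk'
        have : R.s i * g = R.s j * (R.s i * h') := by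
          rw [he']
          simp only [alt, one_mul, Even.zero, if_true, Nat.not_even_one, if_false, even_two]
          rw [R.braid c3]
          simp only [mul_assoc, s_mul_s_mul]
        rw [this] at hi
        have := R.len_s_mul_le i hh'
        have := R.len_s_mul_le j (mul_mem (R.s_mem i) hh')
        omega
      obtain rfl | rfl : k = 1 ∨ k = 2 := by omega
      · refine ⟨1, - R.α i (R.v j), by simp, by linarith, fun x => ?_⟩
        simp only [alt, one_mul, Even.zero, if_true, s_apply, map_sub, map_smul, smul_eq_mul]
        ring
      · refine ⟨0, - R.α i (R.v j), by simp, by linarith, fun x => ?_⟩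
        simp only [alt, one_mul, Even.zero, if_true, Nat.not_even_one, if_false, s_apply,
          map_sub, map_smul, smul_eq_mul, LinearEquiv.mul_apply, R.two]
        linear_combination (R.α i x) * c3
    · obtain ⟨p, q, hp, hq, -, hpq⟩ := R.alt_infinite c1 c2 c3 k
      exact ⟨p, q, hp, hq, hpq⟩
  rw [he, LinearEquiv.mul_apply, hpq]
  have := hij'.1
  have := hij'.2
  positivity

lemma nonpos_of_descent {g : E ≃ₗ[ℝ] E} (hg : g ∈ R.W) {i : ι}
    (hi : R.len (R.s i * g) ≤ R.len g) {x : E} (hx : x ∈ R.C) : R.α i (g x) ≤ 0 := by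
  have := R.tits (mul_mem (R.s_mem i) hg) (i := i) (by rwa [s_mul_s_mul]) hx
  rw [LinearEquiv.mul_apply, s_apply, map_sub, map_smul, smul_eq_mul, R.two] at this
  linarith

/-- The chamber is a strict fundamental domain. -/
theorem eq_of_mem_C {g : E ≃ₗ[ℝ] E} (hg : g ∈ R.W) {x : E} (hx : x ∈ R.C) (hy : g x ∈ R.C) :
    g x = x ∧ g ∈ R.WJ {i | R.α i x = 0} := by
  induction hn : R.len g using Nat.strong_induction_on generalizing g with
  | _ n ih =>
  by_cases h1 : g = 1
  · subst h1; exact ⟨rfl, one_mem _⟩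
  obtain ⟨i, hi⟩ := R.exists_descent hg h1
  have h0 : R.α i (g x) = 0 := le_antisymm (R.nonpos_of_descent hg hi.le hx) (hy i)
  have h2 : (R.s i * g) x = g x := by
    rw [LinearEquiv.mul_apply, s_apply, h0]; simp
  obtain ⟨h3, h4⟩ := ih _ (hn ▸ hi) (mul_mem (R.s_mem i) hg) (by rwa [h2]) rfl
  rw [h2] at h3
  refine ⟨h3, ?_⟩
  rw [h3] at h0
  have := mul_mem (R.s_mem_WJ (J := {i | R.α i x = 0}) (i := i) h0) h4
  rwa [s_mul_s_mul] at this

lemma WJ_fix {x : E} {g : E ≃ₗ[ℝ] E} (hg : g ∈ R.WJ {i | R.α i x = 0}) : g x = x := by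
  induction hg using Subgroup.closure_induction with
  | mem y hy =>
    obtain ⟨i, hi, rfl⟩ := hy
    rw [s_apply, show R.α i x = 0 from hi]; simp
  | one => rfl
  | mul a b _ _ ha hb => rw [LinearEquiv.mul_apply, hb, ha]
  | inv a _ ha =>
    conv_lhs => rw [← ha]
    exact a.symm_apply_apply x

lemma eq_one_of_x₀ {g : E ≃ₗ[ℝ] E} (hg : g ∈ R.W) (h : g R.x₀ ∈ R.C) : g = 1 := by
  have := (R.eq_of_mem_C hg (fun i => (R.pos i).le) h).2
  have e : {i | R.α i R.x₀ = 0} = ∅ := by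
    ext i; simpa using (R.pos i).ne'
  rw [e, WJ, Set.image_empty, Subgroup.closure_empty] at this
  exact Subgroup.mem_bot.1 this

end ReflectionData

section DividedCones

open Set Topology

/-- A sharp open convex cone divided by a discrete group of unimodular linear maps all of whose
finite-index subgroups are irreducible. -/
structure IsDividedCone {E : Type*} [NormedAddCommGroup E] [NormedSpace ℝ E]
    (K : Set E) (G : Subgroup (E ≃ₗ[ℝ] E)) : Prop where
  isOpen : IsOpen K
  convex : Convex ℝ K
  nonempty : K.Nonempty
  smul_mem : ∀ x ∈ K, ∀ t : ℝ, 0 < t → t • x ∈ K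
  sharp : ∀ x ∈ closure K, -x ∈ closure K → x = 0
  map_mem : ∀ g ∈ G, ∀ x ∈ K, g x ∈ K
  cocompact : ∃ Q : Set E, IsCompact Q ∧ Q ⊆ K ∧ ∀ x ∈ K, ∃ g ∈ G, ∃ c : ℝ, 0 < c ∧ c • g x ∈ Q
  virtIrr : ∀ U : Submodule ℝ E, (∀ g ∈ G, ∃ m : ℕ, 0 < m ∧ ∀ x ∈ U, (g ^ m) x ∈ U) →
    U = ⊥ ∨ U = ⊤
  locallyFinite : ∃ N : E → Set E,
    (∀ x ∈ K, IsOpen (N x) ∧ x ∈ N x ∧ ∀ y ∈ N x, ∀ t : ℝ, 0 < t → t • y ∈ N x) ∧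
    ∀ x ∈ K, ∀ y ∈ K, {g | g ∈ G ∧ ∃ u ∈ N x, g u ∈ N y}.Finite
  det : ∀ g ∈ G, LinearMap.det (g : E →ₗ[ℝ] E) = 1 ∨ LinearMap.det (g : E →ₗ[ℝ] E) = -1
  discrete : ∃ (x : E) (U : Set E), IsOpen U ∧ x ∈ U ∧ ∀ g ∈ G, g x ∈ U → g = 1

namespace ReflectionData

variable {ι E : Type*} [NormedAddCommGroup E] [NormedSpace ℝ E] (R : ReflectionData ι E)

/-- Stabilizers of nonzero points of the chamber are finite and fix a halfspace containing the
corresponding roots. -/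
def LocFin : Prop := ∀ x ∈ R.C, x ≠ 0 → ((R.WJ {i | R.α i x = 0} : Set (E ≃ₗ[ℝ] E))).Finite ∧
  ∃ f : Module.Dual ℝ E, ∀ j, R.α j x = 0 → 0 < f (R.v j)

/-- The Vinberg cone without the origin. -/
def K : Set E := {y | ∃ w ∈ R.W, ∃ x ∈ R.C, x ≠ 0 ∧ w x = y}

lemma map_mem_K {w : E ≃ₗ[ℝ] E} (hw : w ∈ R.W) {y : E} (hy : y ∈ R.K) : w y ∈ R.K := by
  obtain ⟨u, hu, x, hx, hx0, rfl⟩ := hy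
  exact ⟨w * u, mul_mem hw hu, x, hx, hx0, rfl⟩

lemma inv_apply_self (w : E ≃ₗ[ℝ] E) (y : E) : w⁻¹ (w y) = y := w.symm_apply_apply y

lemma apply_inv_self (w : E ≃ₗ[ℝ] E) (y : E) : w (w⁻¹ y) = y := w.apply_symm_apply y

lemma inv_apply_of_eq {w : E ≃ₗ[ℝ] E} {c y : E} (h : w c = y) : w⁻¹ y = c := by
  rw [← h, inv_apply_self]

lemma map_mem_K_iff {w : E ≃ₗ[ℝ] E} (hw : w ∈ R.W) {y : E} : w y ∈ R.K ↔ y ∈ R.K :=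
  ⟨fun h => by simpa [inv_apply_self] using R.map_mem_K (inv_mem hw) h, R.map_mem_K hw⟩

lemma zero_notMem_K : (0 : E) ∉ R.K := by
  rintro ⟨w, -, x, -, hx, h⟩
  exact hx ((LinearEquiv.map_eq_zero_iff w).1 h)

lemma smul_mem_C {x : E} (hx : x ∈ R.C) {t : ℝ} (ht : 0 ≤ t) : t • x ∈ R.C := fun i => by
  rw [map_smul, smul_eq_mul]; exact mul_nonneg ht (hx i)

lemma smul_mem_K {y : E} (hy : y ∈ R.K) {t : ℝ} (ht : 0 < t) : t • y ∈ R.K := by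
  obtain ⟨w, hw, x, hx, hx0, rfl⟩ := hy
  exact ⟨w, hw, t • x, R.smul_mem_C hx ht.le, smul_ne_zero ht.ne' hx0, map_smul _ _ _⟩

lemma mem_K_of_mem_C {x : E} (hx : x ∈ R.C) (h0 : x ≠ 0) : x ∈ R.K :=
  ⟨1, one_mem _, x, hx, h0, rfl⟩

lemma segment_mem [Finite ι] {w : E ≃ₗ[ℝ] E} (hw : w ∈ R.W) {x y : E} (hx : x ∈ R.C)
    (hy : y ∈ R.C) {t : ℝ} (h0 : 0 ≤ t) (h1 : t ≤ 1) :
    ∃ u ∈ R.W, ∃ c ∈ R.C, u c = (1 - t) • x + t • w y := by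
  induction hn : R.len w using Nat.strong_induction_on generalizing w x t with
  | _ n ih =>
  by_cases hI : ∃ i, R.α i (w y) < 0
  swap
  · push Not at hI
    refine ⟨1, one_mem _, (1 - t) • x + t • w y, fun i => ?_, rfl⟩
    have a1 := hx i
    have a2 := hI i
    rw [map_add, map_smul, map_smul, smul_eq_mul, smul_eq_mul]
    have : 0 ≤ 1 - t := by linarith
    positivity
  obtain ⟨i, hi, hmin⟩ := Set.exists_min_image {i | R.α i (w y) < 0}
    (fun i => R.α i x / (R.α i x - R.α i (w y))) (Set.toFinite _) hI
  set T := R.α i x / (R.α i x - R.α i (w y)) with hT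
  have hxi := hx i
  have hi' : R.α i (w y) < 0 := hi
  have hden : 0 < R.α i x - R.α i (w y) := by linarith
  have hT0 : 0 ≤ T := by positivity
  have hT1 : T < 1 := by rw [hT, div_lt_one hden]; linarith
  have hC : ∀ t, 0 ≤ t → t ≤ T → (1 - t) • x + t • w y ∈ R.C := by
    intro t ht0 ht k
    have a1 := hx k
    simp only [map_add, map_smul, smul_eq_mul]
    by_cases hk : R.α k (w y) < 0
    · have := hmin k hk
      have h2 : t ≤ R.α k x / (R.α k x - R.α k (w y)) := ht.trans this
      rw [le_div_iff₀ (by linarith)] at h2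
      linarith
    · push Not at hk
      have : 0 ≤ 1 - t := by linarith
      positivity
  by_cases htT : t ≤ T
  · exact ⟨1, one_mem _, _, hC t h0 htT, rfl⟩
  push Not at htT
  have hlt : R.len (R.s i * w) < n := by
    by_contra! hc
    have := R.tits hw (i := i) (by omega) hy
    linarith
  have hx' := hC T hT0 le_rfl
  have hT' : 0 < 1 - T := by linarith
  obtain ⟨u, hu, c, hc, he⟩ := ih _ hlt (mul_mem (R.s_mem i) hw) hx'
    (t := (t - T) / (1 - T)) (div_nonneg (by linarith) hT'.le)
    ((div_le_one hT').2 (by linarith)) rfl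
  refine ⟨R.s i * u, mul_mem (R.s_mem i) hu, c, hc, ?_⟩
  have hfix : R.s i ((1 - T) • x + T • w y) = (1 - T) • x + T • w y := by
    rw [s_apply]
    have : R.α i ((1 - T) • x + T • w y) = 0 := by
      simp only [map_add, map_smul, smul_eq_mul]
      rw [hT]; field_simp; ring
    rw [this]; simp
  rw [LinearEquiv.mul_apply, he, map_add, map_smul, map_smul, hfix, LinearEquiv.mul_apply, s_s]
  match_scalars
  · field_simp; ring
  · field_simp; ring

lemma combo_mem [Finite ι] {x y : E} (hx : x ∈ R.K) (hy : y ∈ R.K) {a b : ℝ} (ha : 0 ≤ a)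
    (hb : 0 ≤ b) (hab : a + b = 1) : a • x + b • y ∈ R.K ∨ a • x + b • y = 0 := by
  obtain ⟨w, hw, x, hx, -, rfl⟩ := hx
  obtain ⟨w', hw', y, hy, -, rfl⟩ := hy
  obtain ⟨u, hu, c, hc, he⟩ := R.segment_mem (mul_mem (inv_mem hw) hw') hx hy hb (by linarith)
  have key : a • w x + b • w' y = (w * u) c := by
    rw [LinearEquiv.mul_apply, he, map_add, map_smul, map_smul, LinearEquiv.mul_apply,
      apply_inv_self]
    congr 2; linarith
  rw [key]
  by_cases h0 : c = 0
  · right; rw [h0, map_zero]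
  · left; exact ⟨_, mul_mem hw hu, c, hc, h0, rfl⟩

/-- The star-shaped neighbourhood of a point of the chamber. -/
def N (x : E) : Set E :=
  {y | y ≠ 0 ∧ ∀ w ∈ R.WJ {i | R.α i x = 0}, ∀ i, R.α i x ≠ 0 → 0 < R.α i (w y)}

lemma mem_N {x : E} (hx : x ∈ R.C) (h0 : x ≠ 0) : x ∈ R.N x :=
  ⟨h0, fun w hw i hi => by rw [R.WJ_fix hw]; exact lt_of_le_of_ne (hx i) hi.symm⟩

lemma smul_mem_N {x y : E} (hy : y ∈ R.N x) {t : ℝ} (ht : 0 < t) : t • y ∈ R.N x :=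
  ⟨smul_ne_zero ht.ne' hy.1, fun w hw i hi => by
    rw [map_smul, map_smul, smul_eq_mul]; exact mul_pos ht (hy.2 w hw i hi)⟩

lemma map_mem_N {x y : E} (hy : y ∈ R.N x) {u : E ≃ₗ[ℝ] E}
    (hu : u ∈ R.WJ {i | R.α i x = 0}) : u y ∈ R.N x :=
  ⟨fun h => hy.1 ((LinearEquiv.map_eq_zero_iff u).1 h), fun w hw i hi =>
    hy.2 (w * u) (mul_mem hw hu) i hi⟩

variable {R}

lemma N_chamber (hR : R.LocFin) {x y : E} (hx : x ∈ R.C) (h0 : x ≠ 0) (hy : y ∈ R.N x) :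
    ∃ w ∈ R.WJ {i | R.α i x = 0}, w y ∈ R.C := by
  obtain ⟨hfin, f, hf⟩ := hR x hx h0
  obtain ⟨w, hw, hmax⟩ := Set.exists_max_image _ (fun w : E ≃ₗ[ℝ] E => f (w y)) hfin ⟨1, one_mem _⟩
  refine ⟨w, hw, fun i => ?_⟩
  by_cases hi : R.α i x = 0
  · have := hmax (R.s i * w) (mul_mem (R.s_mem_WJ (J := {i | R.α i x = 0}) hi) hw)
    simp only [LinearEquiv.mul_apply, s_apply, map_sub, map_smul, smul_eq_mul] at this
    have h2 := hf i hi
    by_contra! hc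
    nlinarith
  · exact (hy.2 w hw i hi).le

lemma N_subset_K (hR : R.LocFin) {x : E} (hx : x ∈ R.C) (h0 : x ≠ 0) : R.N x ⊆ R.K := by
  intro y hy
  obtain ⟨w, hw, hwy⟩ := N_chamber hR hx h0 hy
  rw [← R.map_mem_K_iff (R.WJ_le _ hw)]
  exact R.mem_K_of_mem_C hwy fun h => hy.1 ((LinearEquiv.map_eq_zero_iff w).1 h)

lemma isOpen_N [FiniteDimensional ℝ E] [Finite ι] (hR : R.LocFin) {x : E} (hx : x ∈ R.C)
    (h0 : x ≠ 0) : IsOpen (R.N x) := by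
  have e : R.N x = {0}ᶜ ∩ ⋂ w ∈ (R.WJ {i | R.α i x = 0} : Set (E ≃ₗ[ℝ] E)),
      ⋂ i ∈ {i | R.α i x ≠ 0}, {y | 0 < R.α i (w y)} := by
    ext y; simp [N]
  rw [e]
  refine isOpen_compl_singleton.inter ((hR x hx h0).1.isOpen_biInter fun w _ =>
    (Set.toFinite _).isOpen_biInter fun i _ => ?_)
  exact isOpen_lt continuous_const
    ((R.α i ∘ₗ (w : E →ₗ[ℝ] E)).continuous_of_finiteDimensional)

lemma finite_N (hR : R.LocFin) {x x' : E} (hx : x ∈ R.C) (h0 : x ≠ 0) (hx' : x' ∈ R.C)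
    (h0' : x' ≠ 0) : {g | g ∈ R.W ∧ ∃ y ∈ R.N x, g y ∈ R.N x'}.Finite := by
  have f1 := (hR x hx h0).1
  have f2 := (hR x' hx' h0').1
  refine ((f2.prod (f1.prod f1)).image fun p => p.1 * (p.2.1 * p.2.2)).subset ?_
  rintro g ⟨hg, y, hy, hgy⟩
  obtain ⟨w, hw, hwy⟩ := N_chamber hR hx h0 hy
  obtain ⟨w', hw', hwy'⟩ := N_chamber hR hx' h0' hgy
  have hcN := R.map_mem_N hy hw
  have key := (R.eq_of_mem_C (g := w' * g * w⁻¹) (x := w y)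
    (mul_mem (mul_mem (R.WJ_le _ hw') hg) (inv_mem (R.WJ_le _ hw))) hwy
    (by simpa [LinearEquiv.mul_apply, inv_apply_self] using hwy')).2
  have hsub : {i | R.α i (w y) = 0} ⊆ {i | R.α i x = 0} := fun i hi => by
    by_contra hne
    exact (hcN.2 1 (one_mem _) i hne).ne' hi
  refine ⟨(w'⁻¹, w' * g * w⁻¹, w), ⟨inv_mem hw', R.WJ_mono hsub key, hw⟩, ?_⟩
  simp only; group

lemma isOpen_K [FiniteDimensional ℝ E] [Finite ι] (hR : R.LocFin) : IsOpen R.K := by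
  rw [isOpen_iff_mem_nhds]
  rintro _ ⟨w, hw, x, hx, h0, rfl⟩
  have hc : Continuous (w⁻¹ : E ≃ₗ[ℝ] E) :=
    ((w⁻¹ : E ≃ₗ[ℝ] E) : E →ₗ[ℝ] E).continuous_of_finiteDimensional
  have : (w⁻¹ : E ≃ₗ[ℝ] E) ⁻¹' R.N x ∈ 𝓝 (w x) :=
    ((isOpen_N hR hx h0).preimage hc).mem_nhds (by
      simpa [inv_apply_self] using R.mem_N hx h0)
  filter_upwards [this] with y hy
  exact (R.map_mem_K_iff (inv_mem hw)).1 (N_subset_K hR hx h0 hy)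

lemma x₀_ne_zero [Nonempty ι] : R.x₀ ≠ 0 := fun h => by
  have := R.pos (Classical.arbitrary ι)
  simp [h] at this

lemma exists_notMem_K [FiniteDimensional ℝ E] [Finite ι] [Nonempty ι] (hR : R.LocFin)
    (hinf : (R.W : Set (E ≃ₗ[ℝ] E)).Infinite) : ∃ y, y ≠ 0 ∧ y ∉ R.K := by
  by_contra! hall
  apply hinf
  have hx₀ : R.x₀ ∈ R.C := fun i => (R.pos i).le
  have hK : ∀ y : Metric.sphere (0 : E) 1, ∃ p : (E ≃ₗ[ℝ] E) × E, p.1 ∈ R.W ∧ p.2 ∈ R.C ∧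
      p.2 ≠ 0 ∧ p.1 p.2 = y := by
    intro y
    have hy0 : (y : E) ≠ 0 := by
      intro h; have := y.2; simp [h] at this
    obtain ⟨w, hw, x, hx, h0, he⟩ := hall y hy0
    exact ⟨(w, x), hw, hx, h0, he⟩
  choose p hpW hpC hp0 hpe using hK
  have hc : ∀ w : E ≃ₗ[ℝ] E, Continuous w := fun w =>
    (w : E →ₗ[ℝ] E).continuous_of_finiteDimensional
  obtain ⟨S, hS⟩ := (isCompact_sphere (0 : E) 1).elim_finite_subcover
    (fun y => ((p y).1⁻¹ : E ≃ₗ[ℝ] E) ⁻¹' R.N (p y).2)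
    (fun y => (isOpen_N hR (hpC y) (hp0 y)).preimage (hc _)) (fun y hy => by
      refine Set.mem_iUnion.2 ⟨⟨y, hy⟩, ?_⟩
      have := R.mem_N (hpC ⟨y, hy⟩) (hp0 ⟨y, hy⟩)
      have e : (p ⟨y, hy⟩).1⁻¹ y = (p ⟨y, hy⟩).2 := inv_apply_of_eq (hpe ⟨y, hy⟩)
      rw [Set.mem_preimage, e]; exact this)
  refine (S.finite_toSet.biUnion fun y _ => (finite_N hR hx₀ x₀_ne_zero (hpC y) (hp0 y)).image
    fun g => (p y).1 * g).subset fun w hw => ?_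
  have hne : w R.x₀ ≠ 0 := fun h => x₀_ne_zero ((LinearEquiv.map_eq_zero_iff w).1 h)
  have hmem : ‖w R.x₀‖⁻¹ • w R.x₀ ∈ Metric.sphere (0 : E) 1 := by
    simp [norm_smul, hne]
  obtain ⟨y, hyS, hy⟩ := Set.mem_iUnion₂.1 (hS hmem)
  refine Set.mem_iUnion₂.2 ⟨y, hyS, (p y).1⁻¹ * w, ⟨mul_mem (inv_mem (hpW y)) hw, R.x₀,
    R.mem_N hx₀ x₀_ne_zero, ?_⟩, by simp⟩
  have := R.smul_mem_N hy (norm_pos_iff.2 hne)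
  simpa [map_smul, smul_smul, hne] using this

lemma convex_K [FiniteDimensional ℝ E] [Finite ι] [Nonempty ι] (hR : R.LocFin)
    (hinf : (R.W : Set (E ≃ₗ[ℝ] E)).Infinite) : Convex ℝ R.K := by
  intro x hx y hy a b ha hb hab
  rcases R.combo_mem hx hy ha hb hab with h | h
  · exact h
  exfalso
  have ha0 : a ≠ 0 := by
    rintro rfl
    rw [zero_add] at hab
    subst hab
    simp at h
    exact R.zero_notMem_K (h ▸ hy)
  have hb0 : b ≠ 0 := by
    rintro rfl
    rw [add_zero] at hab
    subst hab
    simp at h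
    exact R.zero_notMem_K (h ▸ hx)
  have hapos : 0 < a := lt_of_le_of_ne ha ha0.symm
  have hbpos : 0 < b := lt_of_le_of_ne hb hb0.symm
  have hneg : -x ∈ R.K := by
    have e : -x = (b / a) • y := by
      have : a • x = -(b • y) := eq_neg_of_add_eq_zero_left h
      have h2 : a⁻¹ • (a • x) = a⁻¹ • -(b • y) := by rw [this]
      rw [smul_smul, inv_mul_cancel₀ ha0, one_smul] at h2
      rw [h2]; module
    rw [e]; exact R.smul_mem_K hy (by positivity)
  obtain ⟨z, hz0, hz⟩ := exists_notMem_K hR hinf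
  have hcont : Filter.Tendsto (fun ε : ℝ => x + ε • z) (𝓝[>] 0) (𝓝 x) := by
    have : Continuous fun ε : ℝ => x + ε • z := by fun_prop
    simpa using (this.tendsto 0).mono_left nhdsWithin_le_nhds
  obtain ⟨ε, hε, hε0⟩ := ((hcont.eventually ((isOpen_K hR).mem_nhds hx)).and
    self_mem_nhdsWithin).exists
  have hε0' : 0 < ε := hε0
  rcases R.combo_mem hε hneg (a := 1/2) (b := 1/2) (by norm_num) (by norm_num) (by norm_num) with
    h3 | h3
  · apply hz
    have e : z = (2 / ε) • ((1 / 2 : ℝ) • (x + ε • z) + (1 / 2 : ℝ) • -x) := by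
      match_scalars
      · field_simp
      · field_simp; ring
    rw [e]; exact R.smul_mem_K h3 (by positivity)
  · have e : z = (2 / ε) • ((1 / 2 : ℝ) • (x + ε • z) + (1 / 2 : ℝ) • -x) := by
      match_scalars
      · field_simp
      · field_simp; ring
    rw [h3, smul_zero] at e
    exact hz0 e

lemma det_eq {g : E ≃ₗ[ℝ] E} (hg : g ∈ R.W) :
    LinearMap.det (g : E →ₗ[ℝ] E) = 1 ∨ LinearMap.det (g : E →ₗ[ℝ] E) = -1 := by
  have : LinearMap.det (g : E →ₗ[ℝ] E) * LinearMap.det (g : E →ₗ[ℝ] E) = 1 := by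
    induction hg using Subgroup.closure_induction with
    | mem x hx =>
      obtain ⟨i, rfl⟩ := hx
      rw [← LinearMap.det_comp]
      have : (R.s i : E →ₗ[ℝ] E) ∘ₗ (R.s i : E →ₗ[ℝ] E) = LinearMap.id := by ext x; simp
      rw [this, LinearMap.det_id]
    | one => simp
    | mul x y _ _ hx hy =>
      have e : ((x * y : E ≃ₗ[ℝ] E) : E →ₗ[ℝ] E) = (x : E →ₗ[ℝ] E) ∘ₗ (y : E →ₗ[ℝ] E) := rfl
      rw [e, LinearMap.det_comp]
      linear_combination hx * LinearMap.det (y : E →ₗ[ℝ] E) ^ 2 + hy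
    | inv x _ hx =>
      have e : (x : E →ₗ[ℝ] E) ∘ₗ ((x⁻¹ : E ≃ₗ[ℝ] E) : E →ₗ[ℝ] E) = LinearMap.id := by
        ext y; exact x.apply_symm_apply y
      have := congrArg LinearMap.det e
      rw [LinearMap.det_comp, LinearMap.det_id] at this
      generalize LinearMap.det (x : E →ₗ[ℝ] E) = a at *
      generalize LinearMap.det ((x⁻¹ : E ≃ₗ[ℝ] E) : E →ₗ[ℝ] E) = b at *
      have hab : b = a := by linear_combination (-b) * hx + a * this
      rw [hab]; exact hx
  exact mul_self_eq_one_iff.1 this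

lemma closure_K_smul {x : E} (hx : x ∈ closure R.K) {t : ℝ} (ht : 0 < t) : t • x ∈ closure R.K :=
  map_mem_closure (continuous_const_smul t) hx fun _ hy => R.smul_mem_K hy ht

theorem isDividedCone_K [FiniteDimensional ℝ E] [Finite ι] [Nonempty ι] (hR : R.LocFin)
    (hinf : (R.W : Set (E ≃ₗ[ℝ] E)).Infinite)
    (hirr : ∀ U : Submodule ℝ E, (∀ g ∈ R.W, ∃ m : ℕ, 0 < m ∧ ∀ x ∈ U, (g ^ m) x ∈ U) →
      U = ⊥ ∨ U = ⊤) : IsDividedCone R.K R.W := by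
  have hcont : ∀ w : E ≃ₗ[ℝ] E, Continuous w := fun w =>
    (w : E →ₗ[ℝ] E).continuous_of_finiteDimensional
  have hx₀ : R.x₀ ∈ R.C := fun i => (R.pos i).le
  have hx₀K := R.mem_K_of_mem_C hx₀ x₀_ne_zero
  have hadd : ∀ x ∈ R.K, ∀ y ∈ R.K, x + y ∈ R.K := fun x hx y hy => by
    have := R.smul_mem_K (convex_K hR hinf hx hy (a := 1/2) (b := 1/2) (by norm_num) (by norm_num)
      (by norm_num)) (t := 2) (by norm_num)
    simpa [smul_add, smul_smul] using this
  have hadd' : ∀ x ∈ closure R.K, ∀ y ∈ closure R.K, x + y ∈ closure R.K := fun x hx y hy =>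
    map_mem_closure₂ continuous_add hx hy hadd
  have h0 : (0 : E) ∈ closure R.K := by
    have : Filter.Tendsto (fun ε : ℝ => ε • R.x₀) (𝓝[>] 0) (𝓝 0) := by
      have : Continuous fun ε : ℝ => ε • R.x₀ := by fun_prop
      simpa using (this.tendsto 0).mono_left nhdsWithin_le_nhds
    refine mem_closure_of_tendsto this ?_
    filter_upwards [self_mem_nhdsWithin] with ε hε
    exact R.smul_mem_K hx₀K hε
  refine ⟨isOpen_K hR, convex_K hR hinf, ⟨_, hx₀K⟩, fun x hx t ht => R.smul_mem_K hx ht, ?_,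
    fun g hg x hx => R.map_mem_K hg hx, ?_, hirr, ?_, fun g hg => det_eq hg, ?_⟩
  · let L : Submodule ℝ E :=
      { carrier := {x | x ∈ closure R.K ∧ -x ∈ closure R.K}
        add_mem' := fun {x y} hx hy => ⟨hadd' x hx.1 y hy.1, by
          rw [neg_add]; exact hadd' _ hx.2 _ hy.2⟩
        zero_mem' := by simpa using h0
        smul_mem' := fun c x hx => by
          rcases lt_trichotomy c 0 with hc | rfl | hc
          · have e1 : c • x = (-c) • -x := by simp
            have e2 : -(c • x) = (-c) • x := by simp
            refine ⟨?_, ?_⟩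
            · rw [e1]; exact closure_K_smul hx.2 (by linarith)
            · rw [e2]; exact closure_K_smul hx.1 (by linarith)
          · simpa using h0
          · refine ⟨closure_K_smul hx.1 hc, ?_⟩
            rw [← smul_neg]; exact closure_K_smul hx.2 hc }
    have hmem : ∀ g ∈ R.W, ∀ x ∈ closure R.K, g x ∈ closure R.K := fun g hg x hx =>
      map_mem_closure (hcont g) hx fun y hy => R.map_mem_K hg hy
    have hL : L = ⊥ ∨ L = ⊤ := hirr L fun g hg => ⟨1, one_pos, fun x hx => by
      rw [pow_one]
      exact ⟨hmem g hg x hx.1, by rw [← map_neg]; exact hmem g hg _ hx.2⟩⟩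
    rcases hL with hL | hL
    · intro x hx hx'
      have : x ∈ L := ⟨hx, hx'⟩
      rw [hL] at this; exact this
    · exfalso
      have hcl : closure R.K = Set.univ := by
        refine Set.eq_univ_of_forall fun x => ?_
        have : x ∈ L := by rw [hL]; trivial
        exact this.1
      have := (convex_K hR hinf).interior_closure_eq_interior_of_nonempty_interior
        ⟨_, by rwa [(isOpen_K hR).interior_eq]⟩
      rw [hcl, interior_univ, (isOpen_K hR).interior_eq] at this
      exact R.zero_notMem_K (this ▸ Set.mem_univ _)
  · refine ⟨R.C ∩ Metric.sphere 0 1, ?_, ?_, ?_⟩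
    · refine (isCompact_sphere 0 1).inter_left ?_
      have e : R.C = ⋂ i, {x | 0 ≤ R.α i x} := by ext; simp [C]
      rw [e]
      exact isClosed_iInter fun i => isClosed_le continuous_const
        (R.α i).continuous_of_finiteDimensional
    · rintro x ⟨hx, hs⟩
      exact R.mem_K_of_mem_C hx (by rintro rfl; simp at hs)
    · rintro _ ⟨w, hw, x, hx, hne, rfl⟩
      refine ⟨w⁻¹, inv_mem hw, ‖x‖⁻¹, by positivity, ?_⟩
      rw [inv_apply_self]
      exact ⟨R.smul_mem_C hx (by positivity), by simp [norm_smul, hne]⟩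
  · have hK : ∀ y : E, ∃ p : (E ≃ₗ[ℝ] E) × E, y ∈ R.K → p.1 ∈ R.W ∧ p.2 ∈ R.C ∧ p.2 ≠ 0 ∧
        p.1 p.2 = y := by
      intro y
      by_cases hy : y ∈ R.K
      · obtain ⟨w, hw, x, hx, h0, he⟩ := hy
        exact ⟨(w, x), fun _ => ⟨hw, hx, h0, he⟩⟩
      · exact ⟨(1, 0), fun h => absurd h hy⟩
    choose p hp using hK
    refine ⟨fun y => ((p y).1⁻¹ : E ≃ₗ[ℝ] E) ⁻¹' R.N (p y).2, fun y hy => ?_, fun x hx y hy => ?_⟩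
    · obtain ⟨h1, h2, h3, h4⟩ := hp y hy
      refine ⟨(isOpen_N hR h2 h3).preimage (hcont _), ?_, fun z hz t ht => ?_⟩
      · have e : (p y).1⁻¹ y = (p y).2 := inv_apply_of_eq h4
        rw [Set.mem_preimage, e]; exact R.mem_N h2 h3
      · rw [Set.mem_preimage, map_smul]; exact R.smul_mem_N hz ht
    · obtain ⟨h1, h2, h3, h4⟩ := hp x hx
      obtain ⟨k1, k2, k3, k4⟩ := hp y hy
      refine ((finite_N hR h2 h3 k2 k3).image fun g => (p y).1 * g * (p x).1⁻¹).subset ?_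
      rintro g ⟨hg, u, hu, hgu⟩
      refine ⟨(p y).1⁻¹ * g * (p x).1, ⟨mul_mem (mul_mem (inv_mem k1) hg) h1, (p x).1⁻¹ u, hu, ?_⟩,
        by simp only; group⟩
      simpa [LinearEquiv.mul_apply, apply_inv_self] using hgu
  · refine ⟨R.x₀, R.N R.x₀, isOpen_N hR hx₀ x₀_ne_zero, R.mem_N hx₀ x₀_ne_zero, fun g hg h => ?_⟩
    refine R.eq_one_of_x₀ hg fun i => (h.2 1 (one_mem _) i (R.pos i).ne').le

end ReflectionData

section Transport

variable {E F : Type*} [NormedAddCommGroup E] [NormedSpace ℝ E] [NormedAddCommGroup F]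
  [NormedSpace ℝ F]

/-- Conjugation by a linear equivalence as a group homomorphism. -/
def conjHom (φ : E ≃ₗ[ℝ] F) : (E ≃ₗ[ℝ] E) →* (F ≃ₗ[ℝ] F) where
  toFun g := (φ.symm.trans g).trans φ
  map_one' := by ext x; simp
  map_mul' g h := by ext x; simp

lemma conjHom_apply (φ : E ≃ₗ[ℝ] F) (g : E ≃ₗ[ℝ] E) (x : E) : conjHom φ g (φ x) = φ (g x) := by
  simp [conjHom]

lemma closure_image_equiv [FiniteDimensional ℝ E] (φ : E ≃ₗ[ℝ] F) (K : Set E) :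
    closure (φ '' K) = φ '' closure K := by
  have := φ.toContinuousLinearEquiv.toHomeomorph.image_closure K
  exact this.symm

lemma isOpen_image_equiv [FiniteDimensional ℝ E] (φ : E ≃ₗ[ℝ] F) {K : Set E} (hK : IsOpen K) :
    IsOpen (φ '' K) :=
  φ.toContinuousLinearEquiv.toHomeomorph.isOpenMap K hK

lemma IsDividedCone.map [FiniteDimensional ℝ E] {K : Set E} {G : Subgroup (E ≃ₗ[ℝ] E)}
    (h : IsDividedCone K G) (φ : E ≃ₗ[ℝ] F) : IsDividedCone (φ '' K) (G.map (conjHom φ)) where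
  isOpen := isOpen_image_equiv φ h.isOpen
  convex := h.convex.linear_image (φ : E →ₗ[ℝ] F)
  nonempty := h.nonempty.image _
  smul_mem := by
    rintro _ ⟨x, hx, rfl⟩ t ht
    exact ⟨t • x, h.smul_mem x hx t ht, map_smul _ _ _⟩
  sharp := by
    rw [closure_image_equiv]
    rintro _ ⟨x, hx, rfl⟩ ⟨y, hy, he⟩
    rw [← map_neg] at he
    obtain rfl := φ.injective he
    rw [h.sharp x hx hy, map_zero]
  map_mem := by
    rintro _ ⟨g, hg, rfl⟩ _ ⟨x, hx, rfl⟩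
    rw [conjHom_apply]
    exact ⟨_, h.map_mem g hg x hx, rfl⟩
  cocompact := by
    obtain ⟨Q, hQ, hQK, hc⟩ := h.cocompact
    refine ⟨φ '' Q, hQ.image φ.toContinuousLinearEquiv.continuous, image_mono hQK, ?_⟩
    rintro _ ⟨x, hx, rfl⟩
    obtain ⟨g, hg, c, hc, hq⟩ := hc x hx
    refine ⟨_, ⟨g, hg, rfl⟩, c, hc, ?_⟩
    rw [conjHom_apply, ← map_smul]
    exact ⟨_, hq, rfl⟩
  virtIrr := by
    intro U hU
    have hc := h.virtIrr (U.comap (φ : E →ₗ[ℝ] F)) fun g hg => by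
      obtain ⟨m, hm, hm'⟩ := hU _ ⟨g, hg, rfl⟩
      refine ⟨m, hm, fun x hx => ?_⟩
      have := hm' (φ x) hx
      rw [← map_pow, conjHom_apply] at this
      exact this
    rcases hc with hc | hc
    · left
      rw [Submodule.eq_bot_iff] at hc ⊢
      intro x hx
      have := hc (φ.symm x) (by simpa using hx)
      simpa using this
    · right
      rw [Submodule.eq_top_iff'] at hc ⊢
      intro x
      have := hc (φ.symm x)
      simpa using this
  locallyFinite := by
    obtain ⟨N, hN, hf⟩ := h.locallyFinite
    refine ⟨fun x => φ '' N (φ.symm x), ?_, ?_⟩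
    · rintro _ ⟨x, hx, rfl⟩
      obtain ⟨h1, h2, h3⟩ := hN x hx
      simp only [φ.symm_apply_apply]
      refine ⟨isOpen_image_equiv φ h1, ⟨x, h2, rfl⟩, ?_⟩
      rintro _ ⟨y, hy, rfl⟩ t ht
      exact ⟨_, h3 y hy t ht, map_smul _ _ _⟩
    · rintro _ ⟨x, hx, rfl⟩ _ ⟨y, hy, rfl⟩
      simp only [φ.symm_apply_apply]
      refine ((hf x hx y hy).image (conjHom φ)).subset ?_
      rintro _ ⟨⟨g, hg, rfl⟩, _, ⟨u, hu, rfl⟩, hgu⟩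
      rw [conjHom_apply] at hgu
      exact ⟨g, ⟨hg, u, hu, by simpa using hgu⟩, rfl⟩
  det := by
    rintro _ ⟨g, hg, rfl⟩
    have : LinearMap.det ((conjHom φ g : F ≃ₗ[ℝ] F) : F →ₗ[ℝ] F) = LinearMap.det (g : E →ₗ[ℝ] E) :=
      LinearMap.det_conj (g : E →ₗ[ℝ] E) φ
    rw [this]
    exact h.det g hg
  discrete := by
    obtain ⟨x, U, hU, hx, h1⟩ := h.discrete
    refine ⟨φ x, φ '' U, isOpen_image_equiv φ hU, ⟨x, hx, rfl⟩, ?_⟩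
    rintro _ ⟨g, hg, rfl⟩ hgx
    rw [conjHom_apply] at hgx
    rw [h1 g hg (by simpa using hgx), map_one]

lemma IsDividedCone.zero_notMem {K : Set E} {G : Subgroup (E ≃ₗ[ℝ] E)} (h : IsDividedCone K G)
    [Nontrivial E] : (0 : E) ∉ K := by
  intro h0
  obtain ⟨z, hz⟩ := exists_ne (0 : E)
  have hc : Filter.Tendsto (fun ε : ℝ => ε • z) (𝓝[>] 0) (𝓝 0) := by
    have : Continuous fun ε : ℝ => ε • z := by fun_prop
    simpa using (this.tendsto 0).mono_left nhdsWithin_le_nhds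
  have hc' : Filter.Tendsto (fun ε : ℝ => -(ε • z)) (𝓝[>] 0) (𝓝 0) := by
    simpa using hc.neg
  obtain ⟨ε, ⟨h1, h2⟩, h3⟩ := (((hc.eventually (h.isOpen.mem_nhds h0)).and
    (hc'.eventually (h.isOpen.mem_nhds h0))).and self_mem_nhdsWithin).exists
  have := h.sharp _ (subset_closure h1) (subset_closure h2)
  rcases smul_eq_zero.1 this with h4 | h4
  · exact (ne_of_gt h3) h4
  · exact hz h4

lemma IsDividedCone.neg_notMem {K : Set E} {G : Subgroup (E ≃ₗ[ℝ] E)} (h : IsDividedCone K G)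
    [Nontrivial E] {x : E} (hx : x ∈ K) (hx' : -x ∈ closure K) : False := by
  have := h.sharp _ (subset_closure hx) hx'
  exact h.zero_notMem (this ▸ hx)

lemma IsDividedCone.smul_mem_closure {K : Set E} {G : Subgroup (E ≃ₗ[ℝ] E)}
    (h : IsDividedCone K G) {x : E} (hx : x ∈ closure K) {t : ℝ} (ht : 0 < t) :
    t • x ∈ closure K :=
  map_mem_closure (continuous_const_smul t) hx fun y hy => h.smul_mem y hy t ht

end Transport

section Projective

variable {d : ℕ}

lemma continuous_mk : Continuous fun v : {v : Vec d // v ≠ 0} => Projectivization.mk ℝ v.1 v.2 :=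
  continuous_quotient_mk'

lemma isOpen_iff_mk {U : Set (RP d)} :
    IsOpen U ↔ IsOpen {v : {v : Vec d // v ≠ 0} | Projectivization.mk ℝ v.1 v.2 ∈ U} := Iff.rfl

lemma isOpen_image_mk {S : Set (Vec d)} (hS : IsOpen S) :
    IsOpen {P : RP d | ∃ (v : Vec d) (hv : v ≠ 0), v ∈ S ∧ P = Projectivization.mk ℝ v hv} := by
  rw [isOpen_iff_mk]
  have e : {v : {v : Vec d // v ≠ 0} | Projectivization.mk ℝ v.1 v.2 ∈
      {P : RP d | ∃ (v : Vec d) (hv : v ≠ 0), v ∈ S ∧ P = Projectivization.mk ℝ v hv}} =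
      ⋃ c ∈ {c : ℝ | c ≠ 0}, {v : {v : Vec d // v ≠ 0} | c • v.1 ∈ S} := by
    ext ⟨v, hv⟩
    simp only [mem_ofPred_eq, mem_iUnion, exists_prop]
    constructor
    · rintro ⟨w, hw, hwS, he⟩
      obtain ⟨a, ha⟩ := (Projectivization.mk_eq_mk_iff' ℝ _ _ hw hv).1 he.symm
      refine ⟨a, ?_, ha ▸ hwS⟩
      rintro rfl
      simp at ha
      exact hw ha.symm
    · rintro ⟨c, hc, hS⟩
      refine ⟨c • v, smul_ne_zero hc hv, hS, ?_⟩
      rw [eq_comm, Projectivization.mk_eq_mk_iff']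
      exact ⟨c, rfl⟩
  rw [e]
  refine isOpen_biUnion fun c _ => hS.preimage (by fun_prop)

variable {K : Set (Vec d)} {G : Subgroup (Vec d ≃ₗ[ℝ] Vec d)} (h : IsDividedCone K G)
include h

lemma mk_mem_projOfCone {v : Vec d} (hv : v ≠ 0) :
    Projectivization.mk ℝ v hv ∈ projOfCone K ↔ v ∈ K ∨ -v ∈ K := by
  constructor
  · rintro ⟨w, hw, hwK, he⟩
    obtain ⟨a, ha⟩ := (Projectivization.mk_eq_mk_iff' ℝ _ _ hv hw).1 he
    rcases lt_trichotomy a 0 with h1 | h1 | h1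
    · right
      rw [← ha, ← neg_smul]
      exact h.smul_mem w hwK _ (by linarith)
    · subst h1; simp at ha; exact absurd ha.symm hv
    · left
      rw [← ha]
      exact h.smul_mem w hwK _ h1
  · rintro (h1 | h1)
    · exact ⟨v, hv, h1, rfl⟩
    · refine ⟨-v, neg_ne_zero.2 hv, h1, ?_⟩
      rw [Projectivization.mk_eq_mk_iff']
      exact ⟨-1, by simp⟩

lemma mk_mem_closure {v : Vec d} (hv : v ≠ 0) :
    Projectivization.mk ℝ v hv ∈ closure (projOfCone K) ↔ v ∈ closure K ∨ -v ∈ closure K := by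
  constructor
  · intro hm
    by_contra! hc
    have hS : IsOpen ((closure K)ᶜ ∩ {w | -w ∈ (closure K)ᶜ}) :=
      isClosed_closure.isOpen_compl.inter (isClosed_closure.isOpen_compl.preimage continuous_neg)
    obtain ⟨P, ⟨w, hw, ⟨hw1, hw2⟩, rfl⟩, hP⟩ := mem_closure_iff.1 hm _ (isOpen_image_mk hS)
      ⟨v, hv, ⟨hc.1, hc.2⟩, rfl⟩
    rcases (mk_mem_projOfCone h hw).1 hP with h1 | h1
    · exact hw1 (subset_closure h1)
    · exact hw2 (subset_closure h1)
  · have key : ∀ {w : Vec d} (hw : w ≠ 0), w ∈ closure K →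
        Projectivization.mk ℝ w hw ∈ closure (projOfCone K) := by
      intro w hw hwK
      have hcl : (⟨w, hw⟩ : {v : Vec d // v ≠ 0}) ∈ closure {v : {v : Vec d // v ≠ 0} | v.1 ∈ K} := by
        rw [mem_closure_iff]
        intro O hO hwO
        obtain ⟨O', hO', rfl⟩ := isOpen_induced_iff.1 hO
        obtain ⟨u, ⟨huO, hu0⟩, huK⟩ := mem_closure_iff.1 hwK (O' ∩ {0}ᶜ)
          (hO'.inter isOpen_compl_singleton) ⟨hwO, hw⟩
        exact ⟨⟨u, hu0⟩, huO, huK⟩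
      exact map_mem_closure continuous_mk hcl fun u hu => ⟨u.1, u.2, hu, rfl⟩
    rintro (h1 | h1)
    · exact key hv h1
    · have := key (neg_ne_zero.2 hv) h1
      rwa [(Projectivization.mk_eq_mk_iff' ℝ (-v) v (neg_ne_zero.2 hv) hv).2 ⟨-1, by simp⟩] at this

lemma isOpen_projOfCone : IsOpen (projOfCone K) := isOpen_image_mk h.isOpen

lemma mk_mem_frontier {v : Vec d} (hv : v ≠ 0) :
    Projectivization.mk ℝ v hv ∈ frontier (projOfCone K) ↔
      (v ∈ closure K ∨ -v ∈ closure K) ∧ ¬ (v ∈ K ∨ -v ∈ K) := by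
  rw [(isOpen_projOfCone h).frontier_eq, mem_sdiff, mk_mem_closure h, mk_mem_projOfCone h]

lemma mk_mem_frontier_of {v : Vec d} (hv : v ≠ 0) (h1 : v ∈ closure K) (h2 : v ∉ K) :
    Projectivization.mk ℝ v hv ∈ frontier (projOfCone K) := by
  refine (mk_mem_frontier h hv).2 ⟨Or.inl h1, ?_⟩
  rintro (h3 | h3)
  · exact h2 h3
  · exact hv (h.sharp _ h1 (subset_closure h3))

lemma isProperlyConvexDomain_projOfCone : IsProperlyConvexDomain (projOfCone K) := by
  refine ⟨K, ⟨h.nonempty, h.isOpen, h.convex, h.smul_mem, ?_⟩, rfl⟩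
  rintro ⟨x, v, hv, hl⟩
  have key : ∀ u : Vec d, (∀ t : ℝ, 0 < t → x + t • u ∈ K) → u ∈ closure K := by
    intro u hu
    have : Filter.Tendsto (fun ε : ℝ => ε • x + u) (𝓝[>] 0) (𝓝 u) := by
      have : Continuous fun ε : ℝ => ε • x + u := by fun_prop
      simpa using (this.tendsto 0).mono_left nhdsWithin_le_nhds
    refine mem_closure_of_tendsto this ?_
    filter_upwards [self_mem_nhdsWithin] with ε hε
    have hε' : 0 < ε := hε
    have := h.smul_mem _ (hu ε⁻¹ (by positivity)) ε hε'
    rwa [smul_add, smul_smul, mul_inv_cancel₀ hε'.ne', one_smul] at this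
  exact hv (h.sharp v (key v fun t _ => hl t) (key (-v) fun t _ => by
    simpa using hl (-t)))

end Projective

section MatrixGroup

variable {d : ℕ}

/-- The matrix of a linear automorphism. -/
def toGL : (Vec d ≃ₗ[ℝ] Vec d) ≃* GL (Fin (d + 1)) ℝ :=
  (LinearMap.GeneralLinearGroup.generalLinearEquiv ℝ (Vec d)).symm.trans
    Matrix.GeneralLinearGroup.toLin.symm

lemma mulVecLin_toGL (g : Vec d ≃ₗ[ℝ] Vec d) :
    Matrix.mulVecLin (toGL g : Matrix (Fin (d + 1)) (Fin (d + 1)) ℝ) = (g : Vec d →ₗ[ℝ] Vec d) := by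
  rw [← Matrix.GeneralLinearGroup.coe_toLin]
  simp only [toGL, MulEquiv.trans_apply, MulEquiv.apply_symm_apply]
  rfl

lemma mulVec_toGL (g : Vec d ≃ₗ[ℝ] Vec d) (x : Vec d) :
    Matrix.mulVec (toGL g : Matrix (Fin (d + 1)) (Fin (d + 1)) ℝ) x = g x := by
  rw [← Matrix.mulVecLin_apply, mulVecLin_toGL]; rfl

lemma det_toGL (g : Vec d ≃ₗ[ℝ] Vec d) :
    (toGL g : Matrix (Fin (d + 1)) (Fin (d + 1)) ℝ).det =
      LinearMap.det (g : Vec d →ₗ[ℝ] Vec d) := by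
  rw [← mulVecLin_toGL, ← Matrix.toLin'_apply', LinearMap.det_toLin']

lemma projMap_mk (g : Vec d ≃ₗ[ℝ] Vec d) (v : Vec d) (hv : v ≠ 0) :
    projMap (toGL g) (Projectivization.mk ℝ v hv) =
      Projectivization.mk ℝ (g v) ((LinearEquiv.map_ne_zero_iff g).2 hv) := by
  refine (Projectivization.map_mk _ _ v hv).trans ?_
  congr 1
  rw [mulVecLin_toGL]; rfl

variable {K : Set (Vec d)} {G : Subgroup (Vec d ≃ₗ[ℝ] Vec d)}

lemma projMap_image_subset (h : IsDividedCone K G) {g : Vec d ≃ₗ[ℝ] Vec d} (hg : g ∈ G) :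
    projMap (toGL g) '' projOfCone K ⊆ projOfCone K := by
  rintro _ ⟨_, ⟨v, hv, hvK, rfl⟩, rfl⟩
  rw [projMap_mk]
  exact ⟨_, _, h.map_mem g hg v hvK, rfl⟩

lemma projMap_image (h : IsDividedCone K G) {g : Vec d ≃ₗ[ℝ] Vec d} (hg : g ∈ G) :
    projMap (toGL g) '' projOfCone K = projOfCone K := by
  refine (projMap_image_subset h hg).antisymm ?_
  rintro _ ⟨v, hv, hvK, rfl⟩
  refine ⟨Projectivization.mk ℝ (g⁻¹ v) ((LinearEquiv.map_ne_zero_iff _).2 hv),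
    ⟨_, _, h.map_mem _ (inv_mem hg) v hvK, rfl⟩, ?_⟩
  rw [projMap_mk]
  congr 1
  exact g.apply_symm_apply v

theorem divides_projOfCone (h : IsDividedCone K G) :
    Divides (G.map (toGL (d := d)).toMonoidHom) (projOfCone K) := by
  refine ⟨?_, ?_, ?_, ?_, ?_⟩
  · rintro _ ⟨g, hg, rfl⟩
    have := h.det g hg
    rw [← det_toGL] at this
    exact this
  · obtain ⟨x, U, hU, hx, h1⟩ := h.discrete
    refine discreteTopology_of_isOpen_singleton_one ?_
    have e : ({1} : Set (G.map (toGL (d := d)).toMonoidHom)) =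
        {γ : G.map (toGL (d := d)).toMonoidHom | Matrix.mulVec
        ((γ : GL (Fin (d + 1)) ℝ) : Matrix (Fin (d + 1)) (Fin (d + 1)) ℝ) x ∈ U} := by
      ext ⟨γ, g, hg, rfl⟩
      simp only [mem_singleton_iff, mem_ofPred_eq]
      constructor
      · intro h2
        have h3 : toGL g = 1 := congrArg Subtype.val h2
        simp [h3, hx]
      · intro h2
        have h4 : Matrix.mulVec (toGL g : Matrix (Fin (d + 1)) (Fin (d + 1)) ℝ) x ∈ U := h2
        rw [mulVec_toGL] at h4
        have := h1 g hg h4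
        subst this
        ext1
        simp
    rw [e]
    refine hU.preimage ?_
    exact (Continuous.matrix_mulVec (Units.continuous_val.comp continuous_subtype_val)
      continuous_const)
  · rintro _ ⟨g, hg, rfl⟩
    exact projMap_image h hg
  · intro A hA hAc
    obtain ⟨N, hN, hf⟩ := h.locallyFinite
    have hcover : A ⊆ ⋃ x : K, {P : RP d | ∃ (v : Vec d) (hv : v ≠ 0), v ∈ N x ∩ K ∧
        P = Projectivization.mk ℝ v hv} := by
      intro P hP
      obtain ⟨v, hv, hvK, rfl⟩ := hA hP
      exact mem_iUnion.2 ⟨⟨v, hvK⟩, v, hv, ⟨(hN v hvK).2.1, hvK⟩, rfl⟩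
    obtain ⟨S, hS⟩ := hAc.elim_finite_subcover _
      (fun x : K => isOpen_image_mk ((hN x x.2).1.inter h.isOpen)) hcover
    have hfin : (⋃ x ∈ S, ⋃ y ∈ S, {g | g ∈ G ∧ ∃ u ∈ N (x : Vec d), g u ∈ N y}).Finite :=
      S.finite_toSet.biUnion fun x _ => S.finite_toSet.biUnion fun y _ => hf x x.2 y y.2
    refine Set.Finite.of_finite_image ((hfin.image toGL).subset ?_)
      (Subtype.val_injective.injOn (s := _))
    rintro _ ⟨⟨γ, g, hg, rfl⟩, hγ, rfl⟩
    obtain ⟨_, ⟨P, hPA, rfl⟩, hPA'⟩ := hγ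
    obtain ⟨x, hxS, v, hv, ⟨hvN, hvK⟩, rfl⟩ := mem_iUnion₂.1 (hS hPA)
    obtain ⟨y, hyS, w, hw, ⟨hwN, hwK⟩, he⟩ := mem_iUnion₂.1 (hS hPA')
    refine ⟨g, mem_iUnion₂.2 ⟨x, hxS, mem_iUnion₂.2 ⟨y, hyS, hg, v, hvN, ?_⟩⟩, rfl⟩
    have he' : Projectivization.mk ℝ (g v) ((LinearEquiv.map_ne_zero_iff g).2 hv) =
      Projectivization.mk ℝ w hw := by rw [← projMap_mk]; exact he
    obtain ⟨a, ha⟩ := (Projectivization.mk_eq_mk_iff' ℝ _ _ _ _).1 he'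
    rcases lt_trichotomy a 0 with h1 | h1 | h1
    · exfalso
      have h2 : -(g v) ∈ K := by
        rw [← ha, ← neg_smul]; exact h.smul_mem w hwK _ (by linarith)
      have h3 := h.sharp _ (subset_closure (h.map_mem g hg v hvK)) (subset_closure h2)
      exact hv ((LinearEquiv.map_eq_zero_iff g).1 h3)
    · subst h1
      rw [zero_smul] at ha
      exact absurd ((LinearEquiv.map_eq_zero_iff g).1 ha.symm) hv
    · rw [← ha]; exact (hN y y.2).2.2 w hwN a h1
  · obtain ⟨Q, hQ, hQK, hc⟩ := h.cocompact
    have hQ0 : ∀ q ∈ Q, q ≠ 0 := fun q hq h0 => h.zero_notMem (h0 ▸ hQK hq)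
    refine ⟨{P | ∃ (v : Vec d) (hv : v ≠ 0), v ∈ Q ∧ P = Projectivization.mk ℝ v hv}, ?_, ?_, ?_⟩
    · have : IsCompact {v : {v : Vec d // v ≠ 0} | v.1 ∈ Q} := by
        refine Topology.IsInducing.subtypeVal.isCompact_iff.2 ?_
        have e : Subtype.val '' {v : {v : Vec d // v ≠ 0} | v.1 ∈ Q} = Q := by
          ext v
          constructor
          · rintro ⟨a, ha, rfl⟩; exact ha
          · intro hv; exact ⟨⟨v, hQ0 v hv⟩, hv, rfl⟩
        exact (congrArg IsCompact e).mpr hQ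
      convert this.image continuous_mk
      ext P
      constructor
      · rintro ⟨v, hv, hvQ, rfl⟩; exact ⟨⟨v, hv⟩, hvQ, rfl⟩
      · rintro ⟨⟨v, hv⟩, hvQ, rfl⟩; exact ⟨v, hv, hvQ, rfl⟩
    · rintro _ ⟨v, hv, hvQ, rfl⟩
      exact ⟨v, hv, hQK hvQ, rfl⟩
    · refine Subset.antisymm (iUnion₂_subset ?_) ?_
      · rintro _ ⟨g, hg, rfl⟩
        refine (image_mono ?_).trans (projMap_image_subset h hg)
        rintro _ ⟨v, hv, hvQ, rfl⟩
        exact ⟨v, hv, hQK hvQ, rfl⟩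
      · rintro _ ⟨v, hv, hvK, rfl⟩
        obtain ⟨g, hg, c, hcp, hq⟩ := hc v hvK
        refine mem_iUnion₂.2 ⟨toGL g⁻¹, ⟨g⁻¹, inv_mem hg, rfl⟩,
          Projectivization.mk ℝ (c • g v) (hQ0 _ hq), ⟨_, _, hq, rfl⟩, ?_⟩
        rw [projMap_mk, Projectivization.mk_eq_mk_iff']
        refine ⟨c, ?_⟩
        rw [map_smul]
        congr 1
        exact (g.symm_apply_apply v).symm

theorem stronglyIrreducible_of (h : IsDividedCone K G) :
    StronglyIrreducible (G.map (toGL (d := d)).toMonoidHom) := by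
  intro Δ hΔ hfin U hU
  refine h.virtIrr U fun g hg => ?_
  obtain ⟨m, hm, -, hm'⟩ := Subgroup.exists_pow_mem_of_relIndex_ne_zero
    (H := Δ) (K := G.map (toGL (d := d)).toMonoidHom) hfin.index_ne_zero
    (a := toGL g) ⟨g, hg, rfl⟩
  refine ⟨m, hm, fun x hx => ?_⟩
  have := hU _ hm'.1 x hx
  rwa [← map_pow, mulVec_toGL] at this

end MatrixGroup

section ConeSimplex

variable {E F : Type*} [NormedAddCommGroup E] [NormedSpace ℝ E] [NormedAddCommGroup F]
  [NormedSpace ℝ F]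

/-- The simplicial cone on `v` has its relative interior in `K` and its relative boundary
outside `K`. -/
def IsConeSimplex {m : ℕ} (K : Set E) (v : Fin m → E) : Prop :=
  LinearIndependent ℝ v ∧ (∀ t : Fin m → ℝ, (∀ i, 0 < t i) → ∑ i, t i • v i ∈ K) ∧
    ∀ t : Fin m → ℝ, (∀ i, 0 ≤ t i) → (∃ i, t i = 0) → ∑ i, t i • v i ∉ K

lemma IsConeSimplex.mem_closure {m : ℕ} {K : Set E} {v : Fin m → E} (hv : IsConeSimplex K v)
    {t : Fin m → ℝ} (ht : ∀ i, 0 ≤ t i) : ∑ i, t i • v i ∈ closure K := by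
  have : Filter.Tendsto (fun ε : ℝ => ∑ i, (t i + ε) • v i) (𝓝[>] 0) (𝓝 (∑ i, t i • v i)) := by
    have : Continuous fun ε : ℝ => ∑ i, (t i + ε) • v i := by fun_prop
    simpa using (this.tendsto 0).mono_left nhdsWithin_le_nhds
  refine mem_closure_of_tendsto this ?_
  filter_upwards [self_mem_nhdsWithin] with ε hε
  exact hv.2.1 _ fun i => by have : 0 < ε := hε; have := ht i; positivity

lemma IsConeSimplex.map {m : ℕ} {K : Set E} {v : Fin m → E} (hv : IsConeSimplex K v)
    (φ : E ≃ₗ[ℝ] F) : IsConeSimplex (φ '' K) (fun i => φ (v i)) := by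
  have e : ∀ t : Fin m → ℝ, ∑ i, t i • φ (v i) = φ (∑ i, t i • v i) := fun t => by simp
  refine ⟨hv.1.map' (φ : E →ₗ[ℝ] F) (LinearEquiv.ker φ), fun t ht => ?_, fun t ht h0 => ?_⟩
  · rw [e]; exact ⟨_, hv.2.1 t ht, rfl⟩
  · rw [e]
    rintro ⟨x, hx, hxe⟩
    exact hv.2.2 t ht h0 (φ.injective hxe ▸ hx)

end ConeSimplex

variable {d : ℕ} {K : Set (Vec d)} {G : Subgroup (Vec d ≃ₗ[ℝ] Vec d)}

lemma IsConeSimplex.properlyEmbedded (h : IsDividedCone K G) {k : ℕ} {v : Fin (k + 1) → Vec d}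
    (hv : IsConeSimplex K v) : ProperlyEmbeddedSimplex (projOfCone K) v := by
  refine ⟨hv.1, ?_, ?_⟩
  · rintro _ ⟨t, ht, h0, rfl⟩
    exact ⟨_, h0, hv.2.1 t ht, rfl⟩
  · rintro _ ⟨⟨t, ht, -, h0, rfl⟩, hni⟩
    refine mk_mem_frontier_of h h0 (hv.mem_closure ht) (hv.2.2 t ht ?_)
    by_contra! hc
    exact hni ⟨t, fun i => lt_of_le_of_ne (ht i) (hc i).symm, h0, rfl⟩

lemma exists_isConeSimplex (h : IsDividedCone K G) {k : ℕ} {v : Fin (k + 1) → Vec d}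
    (hv : ProperlyEmbeddedSimplex (projOfCone K) v) : ∃ w : Fin (k + 1) → Vec d,
      IsConeSimplex K w := by
  obtain ⟨hli, hint, hbd⟩ := hv
  let T : Set (Fin (k + 1) → ℝ) := {t | ∀ i, 0 < t i}
  have hT : Convex ℝ T := by
    intro x hx y hy a b ha hb hab i
    have h1 := hx i
    have h2 := hy i
    simp only [Pi.add_apply, Pi.smul_apply, smul_eq_mul]
    rcases ha.eq_or_lt with rfl | ha
    · have : b = 1 := by linarith
      subst this; simpa using h2
    · positivity
  have hne : ∀ t : Fin (k + 1) → ℝ, t ≠ 0 → ∑ i, t i • v i ≠ 0 := fun t ht h0 =>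
    ht (funext fun i => Fintype.linearIndependent_iff.1 hli t h0 i)
  have hTne : ∀ t ∈ T, t ≠ 0 := fun t ht h0 => by
    have := ht 0; simp [h0] at this
  have hcont : Continuous fun t : Fin (k + 1) → ℝ => ∑ i, t i • v i := by fun_prop
  have hpm : (fun t : Fin (k + 1) → ℝ => ∑ i, t i • v i) '' T ⊆ K ∪ {x | -x ∈ K} := by
    rintro _ ⟨t, ht, rfl⟩
    exact (mk_mem_projOfCone h (hne t (hTne t ht))).1 (hint ⟨t, ht, hne t (hTne t ht), rfl⟩)
  have hdisj : Disjoint K {x | -x ∈ K} := by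
    rw [Set.disjoint_left]
    intro x hx hx'
    exact h.neg_notMem hx (subset_closure hx')
  have hconn := hT.isPreconnected.image _ hcont.continuousOn
  have hopen : IsOpen {x : Vec d | -x ∈ K} := h.isOpen.preimage continuous_neg
  have h1T : (fun _ => 1 : Fin (k + 1) → ℝ) ∈ T := fun i => one_pos
  have hbd' : ∀ t : Fin (k + 1) → ℝ, (∀ i, 0 ≤ t i) → (∃ i, t i = 0) →
      ∑ i, t i • v i ∉ K ∧ -∑ i, t i • v i ∉ K := by
    rintro t ht ⟨i, hi⟩
    by_cases h0 : t = 0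
    · subst h0; simpa using h.zero_notMem
    have := hbd ⟨⟨t, ht, h0, hne t h0, rfl⟩, ?_⟩
    · rw [mk_mem_frontier h] at this
      exact not_or.1 this.2
    · rintro ⟨t', ht', h0', he⟩
      obtain ⟨a, ha⟩ := (Projectivization.mk_eq_mk_iff' ℝ _ _ _ _).1 he
      have hz : ∑ i, (a * t' i - t i) • v i = 0 := by
        simp only [sub_smul, mul_smul, Finset.sum_sub_distrib, ← Finset.smul_sum]
        rw [ha, sub_self]
      have := Fintype.linearIndependent_iff.1 hli _ hz
      have h2 := this i
      rw [hi, sub_zero] at h2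
      rcases mul_eq_zero.1 h2 with h3 | h3
      · apply h0
        funext j
        have := this j
        rw [h3] at this
        simpa using this
      · exact (ht' i).ne' h3
  rcases hpm ⟨_, h1T, rfl⟩ with h1 | h1
  · have := hconn.subset_left_of_subset_union h.isOpen hopen hdisj hpm ⟨_, ⟨_, h1T, rfl⟩, h1⟩
    exact ⟨v, hli, fun t ht => this ⟨t, ht, rfl⟩, fun t ht h0 => (hbd' t ht h0).1⟩
  · have := hconn.subset_right_of_subset_union h.isOpen hopen hdisj hpm ⟨_, ⟨_, h1T, rfl⟩, h1⟩
    have e : ∀ t : Fin (k + 1) → ℝ, ∑ i, t i • -v i = -∑ i, t i • v i := fun t => by simp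
    refine ⟨fun i => -v i, ?_, fun t ht => ?_, fun t ht h0 => ?_⟩
    · exact hli.map' (-LinearMap.id) (by
        rw [LinearMap.ker_eq_bot]; exact neg_injective)
    · rw [e]; exact this ⟨t, ht, rfl⟩
    · rw [e]; exact (hbd' t ht h0).2

lemma not_isStrictlyConvexDomain (h : IsDividedCone K G) {u v : Vec d}
    (hli : LinearIndependent ℝ ![u, v])
    (huv : ∀ t ∈ Icc (0 : ℝ) 1, t • u + (1 - t) • v ∈ closure K \ K) :
    ¬ IsStrictlyConvexDomain (projOfCone K) := fun hs =>
  hs u v hli fun t ht h0 => mk_mem_frontier_of h h0 (huv t ht).1 (huv t ht).2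

lemma isSupportingAt (h : IsDividedCone K G) {x : Vec d} (hx : x ≠ 0) {ψ : Module.Dual ℝ (Vec d)}
    (h0 : ψ x = 0) (hψ : ∀ y ∈ K, 0 < ψ y) :
    IsSupportingAt (projOfCone K) ψ (Projectivization.mk ℝ x hx) := by
  refine ⟨?_, ?_, ?_⟩
  · rintro rfl
    obtain ⟨y, hy⟩ := h.nonempty
    simpa using hψ y hy
  · obtain ⟨a, ha⟩ := (Projectivization.mk_eq_mk_iff' ℝ _ _ (Projectivization.rep_nonzero _) hx).1
      (Projectivization.mk_rep (Projectivization.mk ℝ x hx))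
    rw [← ha, map_smul, h0, smul_zero]
  · intro P hP
    rw [← Projectivization.mk_rep P, mk_mem_projOfCone h] at hP
    rcases hP with hP | hP
    · exact (hψ _ hP).ne'
    · have := hψ _ hP
      rw [map_neg] at this
      linarith

/-- The projective statement follows from the corresponding properties of a divided cone. -/
theorem exists_domain_of_cone {E : Type*} [NormedAddCommGroup E] [NormedSpace ℝ E]
    [FiniteDimensional ℝ E] (φ : E ≃ₗ[ℝ] Vec d) {C : Set E} {H : Subgroup (E ≃ₗ[ℝ] E)}
    (h : IsDividedCone C H) {m : ℕ} (e : Fin (m + 1) → E) (he : IsConeSimplex C e)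
    (hm : 2 ≤ m) {x : E} (hx : x ∈ closure C \ C) (hx0 : x ≠ 0) {ψ₁ ψ₂ : Module.Dual ℝ E}
    (h1 : ψ₁ x = 0) (h2 : ψ₂ x = 0) (hp1 : ∀ y ∈ C, 0 < ψ₁ y) (hp2 : ∀ y ∈ C, 0 < ψ₂ y)
    (hne : LinearMap.ker ψ₁ ≠ LinearMap.ker ψ₂) {k : ℕ}
    (hno : ∀ v : Fin (k + 1) → E, ¬ IsConeSimplex C v) :
    ∃ (Ω : Set (RP d)) (Γ : Subgroup (GL (Fin (d + 1)) ℝ)),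
      IsProperlyConvexDomain Ω ∧ Divides Γ Ω ∧ StronglyIrreducible Γ ∧
      ¬ IsStrictlyConvexDomain Ω ∧
      (∃ x ∈ frontier Ω, ∃ φ ψ : Module.Dual ℝ (Vec d),
        IsSupportingAt Ω φ x ∧ IsSupportingAt Ω ψ x ∧
        LinearMap.ker φ ≠ LinearMap.ker ψ) ∧
      (∃ v : Fin (m + 1) → Vec d, ProperlyEmbeddedSimplex Ω v) ∧
      ¬ ∃ v : Fin (k + 1) → Vec d, ProperlyEmbeddedSimplex Ω v := by
  have h' := h.map φ
  have hφx : φ x ≠ 0 := (LinearEquiv.map_ne_zero_iff φ).2 hx0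
  have hs := he.map φ
  refine ⟨projOfCone (φ '' C), _, isProperlyConvexDomain_projOfCone h', divides_projOfCone h',
    stronglyIrreducible_of h', ?_, ?_, ⟨_, hs.properlyEmbedded h'⟩, ?_⟩
  · refine not_isStrictlyConvexDomain h' (u := φ (e 0)) (v := φ (e 1)) ?_ fun t ht => ?_
    · have h01 : (0 : Fin (m + 1)) ≠ 1 := by
        intro hc
        have := congrArg Fin.val hc
        simp [Nat.mod_eq_of_lt (show 1 < m + 1 by omega)] at this
      have := hs.1.comp ![(0 : Fin (m + 1)), 1] (by
        intro a b hab
        fin_cases a <;> fin_cases b <;> simp_all)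
      have e2 : ![φ (e 0), φ (e 1)] = (fun i => φ (e i)) ∘ ![(0 : Fin (m + 1)), 1] := by
        ext1 i; fin_cases i <;> rfl
      rw [e2]; exact this
    · have h01 : (1 : Fin (m + 1)) ≠ 0 := by
        intro hc
        have := congrArg Fin.val hc
        simp [Nat.mod_eq_of_lt (show 1 < m + 1 by omega)] at this
      let c : Fin (m + 1) → ℝ := fun i => if i = 0 then t else if i = 1 then 1 - t else 0
      have hc : ∑ i, c i • φ (e i) = t • φ (e 0) + (1 - t) • φ (e 1) := by
        rw [← Finset.sum_subset (Finset.subset_univ {0, 1}), Finset.sum_pair h01.symm]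
        · simp [c, h01]
        · intro i _ hi
          simp only [Finset.mem_insert, Finset.mem_singleton, not_or] at hi
          simp [c, hi.1, hi.2]
      have hc0 : ∀ i, 0 ≤ c i := fun i => by
        simp only [c]; split_ifs
        · exact ht.1
        · linarith [ht.2]
        · exact le_rfl
      rw [← hc]
      refine ⟨hs.mem_closure hc0, hs.2.2 c hc0 ⟨⟨2, by omega⟩, ?_⟩⟩
      have a1 : (⟨2, by omega⟩ : Fin (m + 1)) ≠ 0 := by simp [Fin.ext_iff]
      have a2 : (⟨2, by omega⟩ : Fin (m + 1)) ≠ 1 := by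
        simp [Fin.ext_iff, Nat.mod_eq_of_lt (show 1 < m + 1 by omega)]
      simp [c, a1, a2]
  · refine ⟨Projectivization.mk ℝ (φ x) hφx, mk_mem_frontier_of h' hφx ?_ ?_,
      ψ₁ ∘ₗ (φ.symm : Vec d →ₗ[ℝ] E), ψ₂ ∘ₗ (φ.symm : Vec d →ₗ[ℝ] E),
      isSupportingAt h' hφx (by simpa using h1) ?_, isSupportingAt h' hφx (by simpa using h2) ?_, ?_⟩
    · rw [closure_image_equiv]; exact ⟨x, hx.1, rfl⟩
    · simpa using hx.2
    · rintro _ ⟨y, hy, rfl⟩; simpa using hp1 y hy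
    · rintro _ ⟨y, hy, rfl⟩; simpa using hp2 y hy
    · intro hk
      apply hne
      ext y
      have := congrArg (φ y ∈ ·) hk
      simpa using this
  · rintro ⟨v, hv⟩
    obtain ⟨w, hw⟩ := exists_isConeSimplex h' hv
    refine hno (fun i => φ.symm (w i)) ?_
    have := hw.map φ.symm
    rwa [← Set.image_comp, show (φ.symm : Vec d → E) ∘ φ = id from funext φ.symm_apply_apply,
      Set.image_id] at this

end DividedCones

namespace ReflectionData

section FiniteType

open Finset

variable {ι E : Type*} [NormedAddCommGroup E] [NormedSpace ℝ E] (R : ReflectionData ι E)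

/-- A certificate that the generators in `J` form a Cartan matrix of finite type: up to the
scaling `c` it is an integral symmetric matrix `M`, positive on the positive vector `u`. -/
structure FinCert (J : Finset ι) where
  c : ι → ℝ
  M : ι → ι → ℤ
  u : ι → ℝ
  c_pos : ∀ i ∈ J, 0 < c i
  u_pos : ∀ i ∈ J, 0 < u i
  scale : ∀ i ∈ J, ∀ j ∈ J, c i * R.α i (R.v j) = M i j * c j
  symm : ∀ i ∈ J, ∀ j ∈ J, M i j = M j i
  pos : ∀ i ∈ J, 0 < ∑ j ∈ J, (M i j : ℝ) * u j

namespace FinCert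

variable {R} {J : Finset ι} (F : R.FinCert J)
include F

lemma diag {i : ι} (hi : i ∈ J) : F.M i i = 2 := by
  have h := F.scale i hi i hi
  rw [R.two, mul_comm] at h
  exact_mod_cast (mul_right_cancel₀ (F.c_pos i hi).ne' h).symm

lemma offdiag {i j : ι} (hi : i ∈ J) (hj : j ∈ J) (hij : i ≠ j) : (F.M i j : ℝ) ≤ 0 := by
  have h := F.scale i hi j hj
  have h1 := F.c_pos i hi
  have h2 := F.c_pos j hj
  have h3 : R.α i (R.v j) ≤ 0 := by
    rcases R.cartan i j hij with h | h
    · exact h.1.le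
    · exact h.1.le
  by_contra! h4
  have := mul_pos h4 h2
  have := mul_nonneg h1.le (neg_nonneg.2 h3)
  linarith

lemma form_ge (N : ι → ℝ) : ∑ i ∈ J, (∑ j ∈ J, F.M i j * F.u j) / F.u i * N i ^ 2 ≤
    ∑ i ∈ J, ∑ j ∈ J, N i * F.M i j * N j := by
  have key : ∀ i ∈ J, ∀ j ∈ J, (F.M i j : ℝ) * ((N i ^ 2 * (F.u j / F.u i) +
      N j ^ 2 * (F.u i / F.u j)) / 2) ≤ N i * F.M i j * N j := by
    intro i hi j hj
    have hui := F.u_pos i hi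
    have huj := F.u_pos j hj
    by_cases h : i = j
    · subst h
      rw [div_self hui.ne']
      apply le_of_eq; ring
    · have h1 := F.offdiag hi hj h
      have h2 : N i * N j ≤ (N i ^ 2 * (F.u j / F.u i) + N j ^ 2 * (F.u i / F.u j)) / 2 := by
        rw [← sub_nonneg]
        have : (N i ^ 2 * (F.u j / F.u i) + N j ^ 2 * (F.u i / F.u j)) / 2 - N i * N j =
            (N i * F.u j - N j * F.u i) ^ 2 / (2 * F.u i * F.u j) := by
          field_simp; ring
        rw [this]; positivity
      calc _ ≤ (F.M i j : ℝ) * (N i * N j) := mul_le_mul_of_nonpos_left h2 h1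
        _ = _ := by ring
  refine le_trans (le_of_eq ?_) (sum_le_sum fun i hi => sum_le_sum fun j hj => key i hi j hj)
  have e1 : ∑ i ∈ J, ∑ j ∈ J, (F.M i j : ℝ) * ((N i ^ 2 * (F.u j / F.u i) +
      N j ^ 2 * (F.u i / F.u j)) / 2) =
      (∑ i ∈ J, ∑ j ∈ J, (F.M i j : ℝ) * (N i ^ 2 * (F.u j / F.u i))) / 2 +
      (∑ i ∈ J, ∑ j ∈ J, (F.M i j : ℝ) * (N j ^ 2 * (F.u i / F.u j))) / 2 := by
    simp only [← sum_add_distrib, sum_div]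
    exact sum_congr rfl fun i _ => sum_congr rfl fun j _ => by ring
  have e2 : ∑ i ∈ J, ∑ j ∈ J, (F.M i j : ℝ) * (N j ^ 2 * (F.u i / F.u j)) =
      ∑ i ∈ J, ∑ j ∈ J, (F.M i j : ℝ) * (N i ^ 2 * (F.u j / F.u i)) := by
    rw [sum_comm]
    exact sum_congr rfl fun i hi => sum_congr rfl fun j hj => by rw [F.symm i hi j hj]
  rw [e1, e2, add_halves]
  refine sum_congr rfl fun i hi => ?_
  rw [sum_div, sum_mul]
  exact sum_congr rfl fun j _ => by ring

lemma coef_pos {i : ι} (hi : i ∈ J) : 0 < (∑ j ∈ J, F.M i j * F.u j) / F.u i :=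
  div_pos (F.pos i hi) (F.u_pos i hi)

lemma eq_zero_of_form {N : ι → ℝ} (h : ∑ i ∈ J, ∑ j ∈ J, N i * F.M i j * N j = 0) :
    ∀ i ∈ J, N i = 0 := by
  intro i hi
  have h1 := F.form_ge N
  rw [h] at h1
  have h2 : ∀ k ∈ J, 0 ≤ (∑ j ∈ J, F.M k j * F.u j) / F.u k * N k ^ 2 := fun k hk =>
    mul_nonneg (F.coef_pos hk).le (sq_nonneg _)
  have h3 := (sum_eq_zero_iff_of_nonneg h2).1 (le_antisymm h1 (sum_nonneg h2)) i hi
  rcases mul_eq_zero.1 h3 with h4 | h4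
  · exact absurd h4 (F.coef_pos hi).ne'
  · exact pow_eq_zero_iff (two_ne_zero) |>.1 h4

/-- The finite set of integral vectors supported on `J` of norm `2`. -/
def roots : Set (ι → ℤ) :=
  {N | (∀ i ∉ J, N i = 0) ∧ ∑ i ∈ J, ∑ j ∈ J, N i * F.M i j * N j = 2}

lemma finite_roots : F.roots.Finite := by
  classical
  have hb : ∀ i : ι, ∃ B : ℤ, ∀ N ∈ F.roots, N i ∈ Set.Icc (-B) B := by
    intro i
    by_cases hi : i ∈ J
    · have hp := F.coef_pos hi
      obtain ⟨B, hB⟩ := exists_int_gt (2 / ((∑ j ∈ J, F.M i j * F.u j) / F.u i))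
      refine ⟨B, fun N hN => ?_⟩
      have h1 := F.form_ge fun k => (N k : ℝ)
      have h2 : ∑ k ∈ J, ∑ j ∈ J, (N k : ℝ) * F.M k j * N j = 2 := by exact_mod_cast hN.2
      rw [h2] at h1
      have h3 : (∑ j ∈ J, F.M i j * F.u j) / F.u i * (N i : ℝ) ^ 2 ≤ 2 :=
        le_trans (single_le_sum (f := fun k => (∑ j ∈ J, F.M k j * F.u j) / F.u k * (N k : ℝ) ^ 2)
          (fun k hk => mul_nonneg (F.coef_pos hk).le (sq_nonneg _)) hi) h1
      have h4 : (N i : ℝ) ^ 2 < B := by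
        refine lt_of_le_of_lt ?_ hB
        rw [le_div_iff₀ hp]; linarith
      have h5 : (N i) ^ 2 < B := by exact_mod_cast h4
      constructor <;> nlinarith
    · exact ⟨0, fun N hN => by simp [hN.1 i hi]⟩
  choose B hB using hb
  have hfin : Set.Finite (Set.pi Set.univ fun j : J => Set.Icc (-(B j)) (B j)) :=
    Set.Finite.pi fun j => Set.finite_Icc _ _
  refine Set.Finite.of_finite_image (f := fun (N : ι → ℤ) (j : J) => N j) (hfin.subset ?_) ?_
  · rintro _ ⟨N, hN, rfl⟩ j _
    exact hB j N hN
  · intro N hN N' hN' h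
    funext i
    by_cases hi : i ∈ J
    · exact congrFun h ⟨i, hi⟩
    · rw [hN.1 i hi, hN'.1 i hi]

/-- The functionals attached to the vectors of norm `2`. -/
def funcs : Set (Module.Dual ℝ E) := (fun N => ∑ l ∈ J, ((N l : ℝ) * F.c l) • R.α l) '' F.roots

lemma mem_funcs {i : ι} (hi : i ∈ J) : F.c i • R.α i ∈ F.funcs := by
  classical
  refine ⟨Pi.single i 1, ⟨fun j hj => ?_, ?_⟩, ?_⟩
  · rw [Pi.single_eq_of_ne]; rintro rfl; exact hj hi
  · rw [sum_eq_single_of_mem i hi, sum_eq_single_of_mem i hi]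
    · simp [F.diag hi]
    · intro j _ hj; simp [Pi.single_eq_of_ne hj]
    · intro j _ hj; simp [Pi.single_eq_of_ne hj]
  · simp only
    rw [sum_eq_single_of_mem i hi]
    · simp
    · intro j _ hj; simp [Pi.single_eq_of_ne hj]

lemma funcs_comp {β : Module.Dual ℝ E} (hβ : β ∈ F.funcs) {k : ι} (hk : k ∈ J) :
    β ∘ₗ (R.s k : E →ₗ[ℝ] E) ∈ F.funcs := by
  classical
  obtain ⟨N, hN, rfl⟩ := hβ
  set m : ℤ := ∑ i ∈ J, N i * F.M i k with hm
  refine ⟨fun i => N i - if i = k then m else 0, ⟨fun i hi => ?_, ?_⟩, ?_⟩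
  · have : i ≠ k := by rintro rfl; exact hi hk
    simp [this, hN.1 i hi]
  · have e : ∀ i ∈ J, ∀ j ∈ J, (N i - if i = k then m else 0) * F.M i j *
        (N j - if j = k then m else 0) = N i * F.M i j * N j -
        (if j = k then m * (N i * F.M i k) else 0) - (if i = k then m * (N j * F.M j k) else 0) +
        (if i = k then if j = k then m * m * 2 else 0 else 0) := by
      intro i hi j hj
      by_cases h1 : i = k <;> by_cases h2 : j = k
      · rw [h1, h2]; simp only [if_true, F.diag hk]; ring
      · rw [h1]; simp only [if_true, if_neg h2, F.symm k hk j hj]; ring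
      · rw [h2]; simp only [if_true, if_neg h1]; ring
      · simp only [if_neg h1, if_neg h2]; ring
    rw [sum_congr rfl fun i hi => sum_congr rfl fun j hj => e i hi j hj]
    simp only [sum_add_distrib, sum_sub_distrib, hN.2]
    have e1 : ∑ i ∈ J, ∑ j ∈ J, (if j = k then m * (N i * F.M i k) else 0) = m * m := by
      rw [hm, mul_sum]
      refine sum_congr rfl fun i _ => ?_
      rw [sum_ite_eq' J k, if_pos hk]
    have e2 : ∑ i ∈ J, ∑ j ∈ J, (if i = k then m * (N j * F.M j k) else 0) = m * m := by
      rw [sum_comm, e1]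
    have e3 : ∑ i ∈ J, ∑ j ∈ J, (if i = k then if j = k then m * m * 2 else 0 else 0) =
        m * m * 2 := by
      rw [sum_eq_single_of_mem k hk]
      · simp [hk]
      · intro i _ hi; simp [hi]
    rw [e1, e2, e3]; ring
  · have e4 : ∑ i ∈ J, (N i : ℝ) * F.c i * R.α i (R.v k) = m * F.c k := by
      rw [hm, Int.cast_sum, sum_mul]
      refine sum_congr rfl fun i hi => ?_
      rw [mul_assoc, F.scale i hi k hk]; push_cast; ring
    ext x
    simp only [LinearMap.sum_apply, LinearMap.smul_apply, LinearMap.comp_apply, smul_eq_mul,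
      LinearEquiv.coe_coe, R.s_apply, map_sub, map_smul, Int.cast_sub]
    simp only [sub_mul, sum_sub_distrib]
    rw [e4]
    congr 1
    rw [sum_eq_single_of_mem k hk]
    · simp; ring
    · intro i _ hi; simp [hi]

lemma funcs_comp_WJ {g : E ≃ₗ[ℝ] E} (hg : g ∈ R.WJ J) {β : Module.Dual ℝ E} (hβ : β ∈ F.funcs) :
    β ∘ₗ (g : E →ₗ[ℝ] E) ∈ F.funcs := by
  induction hg using Subgroup.closure_induction generalizing β with
  | mem x hx =>
    obtain ⟨k, hk, rfl⟩ := hx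
    exact F.funcs_comp hβ hk
  | one => exact hβ
  | mul x y _ _ hx hy => exact hy (hx hβ)
  | inv x hx ih =>
    have hfin : F.funcs.Finite := F.finite_roots.image _
    have hmaps : Set.MapsTo (fun β : Module.Dual ℝ E => β ∘ₗ (x : E →ₗ[ℝ] E)) F.funcs F.funcs :=
      fun β hβ => ih hβ
    have hinj : Set.InjOn (fun β : Module.Dual ℝ E => β ∘ₗ (x : E →ₗ[ℝ] E)) F.funcs := by
      intro β _ γ _ h
      ext y
      have := LinearMap.congr_fun h (x.symm y)
      simpa using this
    obtain ⟨γ, hγ, rfl⟩ := (hfin.injOn_iff_bijOn_of_mapsTo hmaps).1 hinj |>.surjOn hβ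
    have : (γ ∘ₗ (x : E →ₗ[ℝ] E)) ∘ₗ ((x⁻¹ : E ≃ₗ[ℝ] E) : E →ₗ[ℝ] E) = γ := by
      ext y
      exact congrArg γ (x.apply_symm_apply y)
    simp only
    rwa [this]

omit F in
lemma sub_mem_span {g : E ≃ₗ[ℝ] E} {J : Set ι} (hg : g ∈ R.WJ J) (x : E) :
    g x - x ∈ Submodule.span ℝ (R.v '' J) := by
  induction hg using Subgroup.closure_induction generalizing x with
  | mem y hy =>
    obtain ⟨k, hk, rfl⟩ := hy
    rw [R.s_apply, sub_sub_cancel_left]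
    exact neg_mem (Submodule.smul_mem _ _ (Submodule.subset_span ⟨k, hk, rfl⟩))
  | one => simp
  | mul a b _ _ ha hb =>
    have : (a * b) x - x = (a (b x) - b x) + (b x - x) := by
      rw [LinearEquiv.mul_apply]; abel
    rw [this]; exact add_mem (ha _) (hb _)
  | inv a ha ih =>
    have := neg_mem (ih (a⁻¹ x))
    rwa [apply_inv_self, neg_sub] at this

lemma eq_zero_of_span {y : E} (hy : y ∈ Submodule.span ℝ (R.v '' J))
    (h0 : ∀ i ∈ J, R.α i y = 0) : y = 0 := by
  classical
  obtain ⟨f, hf⟩ : ∃ f : ι → ℝ, ∑ j ∈ J, f j • R.v j = y := by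
    have := (Submodule.mem_span_image_finset_iff_exists_fun' ℝ).1 hy
    obtain ⟨c, hc⟩ := this
    exact ⟨c, hc⟩
  have h1 : ∀ i ∈ J, ∑ j ∈ J, F.M i j * (F.c j * f j) = 0 := by
    intro i hi
    have := h0 i hi
    rw [← hf, map_sum] at this
    have e : ∑ j ∈ J, F.M i j * (F.c j * f j) = F.c i * ∑ j ∈ J, R.α i (f j • R.v j) := by
      rw [mul_sum]
      refine sum_congr rfl fun j hj => ?_
      rw [map_smul, smul_eq_mul, ← mul_assoc, ← F.scale i hi j hj]; ring
    rw [e, this, mul_zero]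
  have h2 := F.eq_zero_of_form (N := fun j => F.c j * f j) (by
    refine sum_eq_zero fun i hi => ?_
    have := h1 i hi
    simp only [mul_assoc]
    rw [← mul_sum, ← mul_sum, this, mul_zero, mul_zero])
  rw [← hf]
  refine sum_eq_zero fun j hj => ?_
  have := (mul_eq_zero.1 (h2 j hj)).resolve_left (F.c_pos j hj).ne'
  rw [this, zero_smul]

lemma finite_WJ : (R.WJ J : Set (E ≃ₗ[ℝ] E)).Finite := by
  have hfin : F.funcs.Finite := F.finite_roots.image _
  have : Finite F.funcs := hfin
  let Φ : R.WJ J → (J → F.funcs) := fun g i =>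
    ⟨(F.c i • R.α i) ∘ₗ (g.1 : E →ₗ[ℝ] E), F.funcs_comp_WJ g.2 (F.mem_funcs i.2)⟩
  have hΦ : Function.Injective Φ := by
    intro g h hgh
    have key : ∀ x, g.1 x = h.1 x := by
      intro x
      have := F.eq_zero_of_span (y := g.1 x - h.1 x) ?_ ?_
      · exact sub_eq_zero.1 this
      · have := sub_mem (sub_mem_span g.2 x) (sub_mem_span h.2 x)
        simpa using this
      · intro i hi
        have := congrArg Subtype.val (congrFun hgh ⟨i, hi⟩)
        have := LinearMap.congr_fun this x
        simp only [LinearMap.comp_apply, LinearMap.smul_apply, smul_eq_mul, Φ,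
          LinearEquiv.coe_coe] at this
        rw [map_sub, mul_left_cancel₀ (F.c_pos i hi).ne' this, sub_self]
    exact Subtype.ext (LinearEquiv.ext key)
  exact Finite.of_injective Φ hΦ

lemma exists_pos : ∃ f : Module.Dual ℝ E, ∀ j ∈ J, 0 < f (R.v j) := by
  refine ⟨∑ i ∈ J, (F.u i * F.c i) • R.α i, fun j hj => ?_⟩
  have h := mul_pos (F.pos j hj) (F.c_pos j hj)
  have e : (∑ i ∈ J, (F.u i * F.c i) • R.α i) (R.v j) = (∑ i ∈ J, F.M j i * F.u i) * F.c j := by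
    simp only [LinearMap.sum_apply, LinearMap.smul_apply, smul_eq_mul, sum_mul]
    refine sum_congr rfl fun i hi => ?_
    rw [mul_assoc, F.scale i hi j hj, F.symm i hi j hj]; ring
  rwa [e]

end FinCert

lemma locFin_of_cert (h : ∀ x ∈ R.C, x ≠ 0 → ∃ J : Finset ι, Nonempty (R.FinCert J) ∧
    ∀ i, R.α i x = 0 → i ∈ J) : R.LocFin := by
  intro x hx h0
  obtain ⟨J, ⟨F⟩, hJ⟩ := h x hx h0
  obtain ⟨f, hf⟩ := F.exists_pos
  exact ⟨F.finite_WJ.subset (R.WJ_mono fun i hi => hJ i hi), f, fun j hj => hf j (hJ j hj)⟩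

end FiniteType

end ReflectionData

open Set Topology

section Facets

variable {E : Type*} [NormedAddCommGroup E] [NormedSpace ℝ E] [FiniteDimensional ℝ E]
  {K : Set E} {G : Subgroup (E ≃ₗ[ℝ] E)}

/-- The cone is a direct sum of the ray through `o` and a cone in the kernel of `ψ`. -/
def IsConePoint (K : Set E) (o : E) (ψ : Module.Dual ℝ E) : Prop :=
  o ∈ closure K ∧ ψ o = 1 ∧ (∀ y ∈ closure K, 0 ≤ ψ y) ∧ ∀ y ∈ closure K, y - ψ y • o ∈ closure K

namespace IsDividedCone

variable (h : IsDividedCone K G)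
include h

omit [FiniteDimensional ℝ E] in
lemma add_mem {x y : E} (hx : x ∈ K) (hy : y ∈ K) : x + y ∈ K := by
  have := h.smul_mem _ (h.convex hx hy (a := 1/2) (b := 1/2) (by norm_num) (by norm_num)
    (by norm_num)) 2 (by norm_num)
  simpa [smul_add, smul_smul] using this

omit [FiniteDimensional ℝ E] in
lemma add_mem_closure {x y : E} (hx : x ∈ closure K) (hy : y ∈ closure K) :
    x + y ∈ closure K :=
  map_mem_closure₂ continuous_add hx hy fun _ ha _ hb => h.add_mem ha hb

omit [FiniteDimensional ℝ E] in
lemma add_closure_mem {x y : E} (hx : x ∈ K) (hy : y ∈ closure K) : x + y ∈ K := by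
  have h1 : (2 : ℝ)⁻¹ • x + (2 : ℝ)⁻¹ • y ∈ interior K :=
    h.convex.combo_interior_closure_mem_interior (h.isOpen.interior_eq.symm ▸ hx) hy
      (by norm_num) (by norm_num) (by norm_num)
  have := h.smul_mem _ (interior_subset h1) 2 (by norm_num)
  simpa [smul_add, smul_smul] using this

omit [FiniteDimensional ℝ E] in
lemma zero_mem_closure : (0 : E) ∈ closure K := by
  obtain ⟨x, hx⟩ := h.nonempty
  have : Filter.Tendsto (fun ε : ℝ => ε • x) (𝓝[>] 0) (𝓝 0) := by
    have : Continuous fun ε : ℝ => ε • x := by fun_prop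
    simpa using (this.tendsto 0).mono_left nhdsWithin_le_nhds
  refine mem_closure_of_tendsto this ?_
  filter_upwards [self_mem_nhdsWithin] with ε hε
  exact h.smul_mem _ hx _ hε

omit [FiniteDimensional ℝ E] in
lemma smul_mem_closure' {x : E} (hx : x ∈ closure K) {t : ℝ} (ht : 0 ≤ t) :
    t • x ∈ closure K := by
  rcases ht.eq_or_lt with rfl | ht
  · rw [zero_smul]; exact h.zero_mem_closure
  · exact h.smul_mem_closure hx ht

omit [FiniteDimensional ℝ E] in
lemma sum_mem_closure {ι : Type*} (s : Finset ι) {f : ι → E} (hf : ∀ i ∈ s, f i ∈ closure K) :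
    ∑ i ∈ s, f i ∈ closure K :=
  Finset.sum_induction _ (· ∈ closure K) (fun _ _ => h.add_mem_closure) h.zero_mem_closure hf

omit [FiniteDimensional ℝ E] in
lemma eq_zero_of_sum {ι : Type*} (s : Finset ι) {f : ι → E} (hf : ∀ i ∈ s, f i ∈ closure K)
    (h0 : ∑ i ∈ s, f i = 0) : ∀ i ∈ s, f i = 0 := by
  classical
  intro i hi
  refine h.sharp _ (hf i hi) ?_
  rw [← Finset.add_sum_erase _ _ hi] at h0
  rw [neg_eq_of_add_eq_zero_right h0]
  exact h.sum_mem_closure _ fun j hj => hf j (Finset.mem_of_mem_erase hj)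

lemma map_mem_closure {g : E ≃ₗ[ℝ] E} (hg : g ∈ G) {x : E} (hx : x ∈ closure K) :
    g x ∈ closure K :=
  _root_.map_mem_closure (g : E →ₗ[ℝ] E).continuous_of_finiteDimensional hx (h.map_mem g hg)

omit h in
lemma nonneg_closure {ψ : Module.Dual ℝ E} (hψ : ∀ y ∈ K, 0 ≤ ψ y) {y : E} (hy : y ∈ closure K) :
    0 ≤ ψ y := by
  have : closure K ⊆ {y | 0 ≤ ψ y} := closure_minimal hψ
    (isClosed_le continuous_const ψ.continuous_of_finiteDimensional)
  exact this hy

omit [FiniteDimensional ℝ E] in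
/-- A linear map sending `K` to its closure and a point of `K` to zero vanishes. -/
lemma eq_zero_of_apply {A : E →L[ℝ] E} (hA : ∀ y ∈ K, A y ∈ closure K) {y : E} (hy : y ∈ K)
    (h0 : A y = 0) : A = 0 := by
  ext z
  have hc : Continuous fun ε : ℝ => y + ε • z := by fun_prop
  have hc' : Continuous fun ε : ℝ => y - ε • z := by fun_prop
  have e1 : ∀ᶠ ε in 𝓝 (0 : ℝ), y + ε • z ∈ K :=
    hc.continuousAt.eventually_mem (h.isOpen.mem_nhds (by simpa using hy))
  have e2 : ∀ᶠ ε in 𝓝 (0 : ℝ), y - ε • z ∈ K :=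
    hc'.continuousAt.eventually_mem (h.isOpen.mem_nhds (by simpa using hy))
  have e3 : ∀ᶠ ε in 𝓝[>] (0 : ℝ), (y + ε • z ∈ K ∧ y - ε • z ∈ K) ∧ 0 < ε :=
    ((e1.and e2).filter_mono nhdsWithin_le_nhds).and self_mem_nhdsWithin
  obtain ⟨ε, ⟨h1, h2⟩, h3⟩ := e3.exists
  have h4 := hA _ h1
  have h5 := hA _ h2
  rw [map_add, h0, zero_add, map_smul] at h4
  rw [map_sub, h0, zero_sub, map_smul] at h5
  exact (smul_eq_zero.1 (h.sharp _ h4 h5)).resolve_left h3.ne'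

omit [FiniteDimensional ℝ E] in
lemma pos_of_nonneg {ψ : Module.Dual ℝ E} (hψ0 : ψ ≠ 0) (hψ : ∀ y ∈ K, 0 ≤ ψ y) {y : E}
    (hy : y ∈ K) : 0 < ψ y := by
  refine lt_of_le_of_ne (hψ y hy) fun h0 => hψ0 ?_
  ext z
  have hc : Continuous fun ε : ℝ => y + ε • z := by fun_prop
  have hc' : Continuous fun ε : ℝ => y - ε • z := by fun_prop
  have e1 : ∀ᶠ ε in 𝓝 (0 : ℝ), y + ε • z ∈ K :=
    hc.continuousAt.eventually_mem (h.isOpen.mem_nhds (by simpa using hy))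
  have e2 : ∀ᶠ ε in 𝓝 (0 : ℝ), y - ε • z ∈ K :=
    hc'.continuousAt.eventually_mem (h.isOpen.mem_nhds (by simpa using hy))
  have e3 : ∀ᶠ ε in 𝓝[>] (0 : ℝ), (y + ε • z ∈ K ∧ y - ε • z ∈ K) ∧ 0 < ε :=
    ((e1.and e2).filter_mono nhdsWithin_le_nhds).and self_mem_nhdsWithin
  obtain ⟨ε, ⟨h1, h2⟩, h3⟩ := e3.exists
  have h4 := hψ _ h1
  have h5 := hψ _ h2
  rw [map_add, ← h0, zero_add, map_smul, smul_eq_mul] at h4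
  rw [map_sub, ← h0, zero_sub, map_smul, smul_eq_mul] at h5
  simp only [LinearMap.zero_apply]
  nlinarith

omit [FiniteDimensional ℝ E] in
lemma conePoint_eq_zero {o₁ o₂ : E} {ψ₁ ψ₂ : Module.Dual ℝ E} (h₁ : IsConePoint K o₁ ψ₁)
    (h₂ : IsConePoint K o₂ ψ₂) (hne : ∀ b : ℝ, o₁ ≠ b • o₂) : ψ₁ o₂ = 0 := by
  by_contra h0
  have ha := lt_of_le_of_ne (h₁.2.2.1 _ h₂.1) (Ne.symm h0)
  have h3 := h₂.2.2.2 _ (h₁.2.2.2 _ h₂.1)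
  have h4 := h₂.2.2.2 _ h₁.1
  have e : o₂ - ψ₁ o₂ • o₁ - ψ₂ (o₂ - ψ₁ o₂ • o₁) • o₂ = ψ₁ o₂ • -(o₁ - ψ₂ o₁ • o₂) := by
    rw [map_sub, map_smul, h₂.2.1, smul_eq_mul]; module
  rw [e] at h3
  have h5 := h.smul_mem_closure h3 (inv_pos.2 ha)
  rw [smul_smul, inv_mul_cancel₀ ha.ne', one_smul] at h5
  exact hne _ (sub_eq_zero.1 (h.sharp _ h4 h5))

lemma conePoint_map {o : E} {ψ : Module.Dual ℝ E} (ho : IsConePoint K o ψ) {g : E ≃ₗ[ℝ] E}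
    (hg : g ∈ G) : IsConePoint K (g o) (ψ ∘ₗ (g.symm : E →ₗ[ℝ] E)) := by
  have hg' : ∀ y ∈ closure K, g.symm y ∈ closure K := fun y hy =>
    h.map_mem_closure (inv_mem hg) hy
  refine ⟨h.map_mem_closure hg ho.1, by simp [ho.2.1], fun y hy => ho.2.2.1 _ (hg' y hy),
    fun y hy => ?_⟩
  have := h.map_mem_closure hg (ho.2.2.2 _ (hg' y hy))
  simpa using this

lemma not_isConePoint (hd : 2 ≤ Module.finrank ℝ E) {o : E} {ψ : Module.Dual ℝ E} :
    ¬ IsConePoint K o ψ := by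
  intro ho
  have ho0 : o ≠ 0 := by
    rintro rfl
    simpa using ho.2.1
  have key : ∀ g ∈ G, ∃ m : ℕ, 0 < m ∧ ∀ x ∈ Submodule.span ℝ {o}, (g ^ m) x ∈
      Submodule.span ℝ {o} := by
    intro g hg
    suffices ∃ m : ℕ, 0 < m ∧ ∃ b : ℝ, (g ^ m) o = b • o by
      obtain ⟨m, hm, b, hb⟩ := this
      refine ⟨m, hm, fun x hx => ?_⟩
      obtain ⟨a, rfl⟩ := Submodule.mem_span_singleton.1 hx
      rw [map_smul, hb, smul_smul]
      exact Submodule.smul_mem _ _ (Submodule.mem_span_singleton_self _)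
    by_contra! hcon
    have hpt : ∀ k : ℕ, IsConePoint K ((g ^ k) o) (ψ ∘ₗ ((g ^ k).symm : E →ₗ[ℝ] E)) := fun k =>
      h.conePoint_map ho (pow_mem hg k)
    have hlt : ∀ k l : ℕ, k < l → ∀ b : ℝ, (g ^ l) o ≠ b • (g ^ k) o := by
      intro k l hkl b hb
      refine hcon (l - k) (by omega) b ((g ^ k).injective ?_)
      rw [← LinearEquiv.mul_apply, ← pow_add, map_smul, ← hb]
      congr 2; omega
    have hlt' : ∀ k l : ℕ, k ≠ l → ∀ b : ℝ, (g ^ k) o ≠ b • (g ^ l) o := by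
      intro k l hkl b hb
      rcases lt_or_gt_of_ne hkl with hkl | hkl
      · have hb0 : b ≠ 0 := by
          rintro rfl
          rw [zero_smul] at hb
          exact ho0 ((LinearEquiv.map_eq_zero_iff _).1 hb)
        refine hlt k l hkl b⁻¹ ?_
        rw [hb, smul_smul, inv_mul_cancel₀ hb0, one_smul]
      · exact hlt l k hkl b hb
    have hli : LinearIndependent ℝ fun k : Fin (Module.finrank ℝ E + 1) => (g ^ (k : ℕ)) o := by
      rw [Fintype.linearIndependent_iff]
      intro c hc k
      have := congrArg (ψ ∘ₗ ((g ^ (k : ℕ)).symm : E →ₗ[ℝ] E)) hc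
      rw [map_sum, map_zero, Finset.sum_eq_single k] at this
      · rwa [map_smul, (hpt k).2.1, smul_eq_mul, mul_one] at this
      · intro l _ hl
        rw [map_smul, h.conePoint_eq_zero (hpt k) (hpt l)
          (hlt' k l fun e => hl (Fin.ext e.symm)), smul_zero]
      · simp
    have := hli.fintype_card_le_finrank
    simp at this
  rcases h.virtIrr _ key with h1 | h1
  · exact ho0 (by simpa using h1)
  · have := finrank_span_singleton (K := ℝ) ho0
    rw [h1, finrank_top] at this
    omega

end IsDividedCone

end Facets

namespace IsDividedCone

section NoFacet

variable {E : Type*} [NormedAddCommGroup E] [NormedSpace ℝ E] [FiniteDimensional ℝ E]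
  {K : Set E} {G : Subgroup (E ≃ₗ[ℝ] E)} (h : IsDividedCone K G)

/-- The homothety of ratio `t` along `o` fixing the kernel of `ψ`. -/
noncomputable def homothety (o : E) (ψ : Module.Dual ℝ E) (t : ℝ) : E →ₗ[ℝ] E :=
  LinearMap.id + (t - 1) • ψ.smulRight o

omit [FiniteDimensional ℝ E] in
lemma homothety_apply (o : E) (ψ : Module.Dual ℝ E) (t : ℝ) (y : E) :
    homothety o ψ t y = y + ((t - 1) * ψ y) • o := by
  simp [homothety, smul_smul]

omit [FiniteDimensional ℝ E] in
lemma homothety_homothety {o : E} {ψ : Module.Dual ℝ E} (ho : ψ o = 1) {s t : ℝ} (hst : s * t = 1)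
    (y : E) : homothety o ψ s (homothety o ψ t y) = y := by
  have e : ψ (y + ((t - 1) * ψ y) • o) = t * ψ y := by
    rw [map_add, map_smul, ho, smul_eq_mul]; ring
  rw [homothety_apply, homothety_apply, e, add_assoc, ← add_smul, add_eq_left]
  have : (t - 1) * ψ y + (s - 1) * (t * ψ y) = (s * t - 1) * ψ y := by ring
  rw [this, hst, sub_self, zero_mul, zero_smul]

include h

/-- A cone with a facet is the sum of a ray and a cone of smaller dimension. -/
lemma exists_isConePoint {ψ : Module.Dual ℝ E} {o x : E} (hψ : ∀ y ∈ K, 0 ≤ ψ y) (ho : o ∈ K)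
    (ho1 : ψ o = 1) {m : ℕ} {f : Fin m → E} (hf : ∀ i, f i ∈ closure K)
    (hspan : LinearMap.ker ψ ≤ Submodule.span ℝ (range f)) (hx : x = ∑ i, f i)
    (hf0 : ∀ i, ψ (f i) = 0) : ∃ o' ψ', IsConePoint K o' ψ' := by
  have : ProperSpace (E →L[ℝ] E) := FiniteDimensional.proper ℝ _
  obtain ⟨Q, hQ, hQK, hQG⟩ := h.cocompact
  have hcl : IsClosed (closure K) := isClosed_closure
  have hψ0 : ψ ≠ 0 := by rintro rfl; simp at ho1
  have hψc := ψ.continuous_of_finiteDimensional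
  have hxK : x ∈ closure K := hx ▸ h.sum_mem_closure _ fun i _ => hf i
  have hψx : ψ x = 0 := by rw [hx, map_sum]; exact Finset.sum_eq_zero fun i _ => hf0 i
  set p := x + o with hp
  have hψp : ψ p = 1 := by rw [hp, map_add, hψx, ho1, zero_add]
  have hp0 : p ≠ 0 := by intro h0; rw [h0, map_zero] at hψp; norm_num at hψp
  let t : ℕ → ℝ := fun n => 1 / ((n : ℝ) + 1)
  have ht : ∀ n, 0 < t n := fun n => by simp only [t]; positivity
  have ht1 : ∀ n, t n ≤ 1 := fun n => by
    simp only [t]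
    rw [div_le_one (by positivity)]
    linarith [(Nat.cast_nonneg n : (0 : ℝ) ≤ n)]
  have htt : Filter.Tendsto t Filter.atTop (𝓝 0) := tendsto_one_div_add_atTop_nhds_zero_nat
  have hxt : ∀ n, x + t n • o ∈ K := fun n => by
    rw [add_comm]; exact h.add_closure_mem (h.smul_mem _ ho _ (ht n)) hxK
  choose γ hγ c hc hcQ using fun n => hQG _ (hxt n)
  let A : ℕ → E →L[ℝ] E := fun n =>
    LinearMap.toContinuousLinearMap ((γ n : E →ₗ[ℝ] E) ∘ₗ homothety o ψ (t n))
  let B : ℕ → E →L[ℝ] E := fun n =>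
    LinearMap.toContinuousLinearMap (homothety o ψ (t n)⁻¹ ∘ₗ ((γ n).symm : E →ₗ[ℝ] E))
  have hA : ∀ n y, A n y = γ n (homothety o ψ (t n) y) := fun n y => rfl
  have hB : ∀ n y, B n y = homothety o ψ (t n)⁻¹ ((γ n).symm y) := fun n y => rfl
  have hAB : ∀ n y, A n (B n y) = y := fun n y => by
    rw [hA, hB, homothety_homothety ho1 (mul_inv_cancel₀ (ht n).ne'), LinearEquiv.apply_symm_apply]
  have hBA : ∀ n y, B n (A n y) = y := fun n y => by
    rw [hA, hB, LinearEquiv.symm_apply_apply, homothety_homothety ho1 (inv_mul_cancel₀ (ht n).ne')]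
  have hAn : ∀ n, 0 < ‖A n‖ := fun n => norm_pos_iff.2 fun h0 => hp0 (by
    rw [← hBA n p, h0]; simp)
  have hBn : ∀ n, 0 < ‖B n‖ := fun n => norm_pos_iff.2 fun h0 => hp0 (by
    rw [← hAB n p, h0]; simp)
  have hAp : ∀ n, A n p = γ n (x + t n • o) := fun n => by
    rw [hA, homothety_apply, hψp, hp]; congr 1; module
  have hsph : IsCompact (Metric.sphere (0 : E →L[ℝ] E) 1) := isCompact_sphere _ _
  obtain ⟨⟨⟨A', B'⟩, q⟩, ⟨⟨hA', hB'⟩, hq⟩, φ, hφ, hlim⟩ :=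
    ((hsph.prod hsph).prod hQ).tendsto_subseq (x := fun n =>
      ((‖A n‖⁻¹ • A n, ‖B n‖⁻¹ • B n), c n • γ n (x + t n • o))) fun n => by
        refine ⟨⟨?_, ?_⟩, hcQ n⟩
        · simp [norm_smul, inv_mul_cancel₀ (hAn n).ne']
        · simp [norm_smul, inv_mul_cancel₀ (hBn n).ne']
  have hlA : Filter.Tendsto (fun n => ‖A (φ n)‖⁻¹ • A (φ n)) Filter.atTop (𝓝 A') :=
    ((continuous_fst.comp continuous_fst).tendsto _).comp hlim
  have hlB : Filter.Tendsto (fun n => ‖B (φ n)‖⁻¹ • B (φ n)) Filter.atTop (𝓝 B') :=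
    ((continuous_snd.comp continuous_fst).tendsto _).comp hlim
  have hlq : Filter.Tendsto (fun n => c (φ n) • γ (φ n) (x + t (φ n) • o)) Filter.atTop (𝓝 q) :=
    (continuous_snd.tendsto _).comp hlim
  have hev : ∀ {a : ℕ → E →L[ℝ] E} {a' : E →L[ℝ] E} {b : ℕ → E} {b' : E},
      Filter.Tendsto a Filter.atTop (𝓝 a') → Filter.Tendsto b Filter.atTop (𝓝 b') →
      Filter.Tendsto (fun n => a n (b n)) Filter.atTop (𝓝 (a' b')) := fun {_ a' _ b'} ha hb =>
    (isBoundedBilinearMap_apply.continuous.tendsto (a', b')).comp (ha.prodMk_nhds hb)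
  have hlAy : ∀ y, Filter.Tendsto (fun n => ‖A (φ n)‖⁻¹ • A (φ n) y) Filter.atTop (𝓝 (A' y)) :=
    fun y => hev hlA tendsto_const_nhds
  have hlBy : ∀ y, Filter.Tendsto (fun n => ‖B (φ n)‖⁻¹ • B (φ n) y) Filter.atTop (𝓝 (B' y)) :=
    fun y => hev hlB tendsto_const_nhds
  -- the limit maps are proportional to inverses of each other
  set s : ℕ → ℝ := fun n => ‖A (φ n)‖⁻¹ * ‖B (φ n)‖⁻¹ with hs
  have hBA' : ∀ y, Filter.Tendsto (fun n => s n • y) Filter.atTop (𝓝 (B' (A' y))) := fun y => by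
    have := hev hlB (hlAy y)
    refine this.congr fun n => ?_
    rw [_root_.smul_apply, map_smul, hBA, smul_smul, hs, mul_comm]
  have hAB' : ∀ y, Filter.Tendsto (fun n => s n • y) Filter.atTop (𝓝 (A' (B' y))) := fun y => by
    have := hev hlA (hlBy y)
    refine this.congr fun n => ?_
    rw [_root_.smul_apply, map_smul, hAB, smul_smul, hs]
  set C := ψ (B' (A' p)) with hC
  have hsC : Filter.Tendsto s Filter.atTop (𝓝 C) := by
    have := (hψc.tendsto _).comp (hBA' p)
    refine this.congr fun n => ?_
    simp [hψp]
  have hBAe : ∀ y, B' (A' y) = C • y := fun y =>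
    tendsto_nhds_unique (hBA' y) (hsC.smul tendsto_const_nhds)
  have hABe : ∀ y, A' (B' y) = C • y := fun y =>
    tendsto_nhds_unique (hAB' y) (hsC.smul tendsto_const_nhds)
  have hC0 : 0 ≤ C := ge_of_tendsto' hsC fun n => by simp only [hs]; positivity
  -- the limit of the first sequence
  have hA'ker : ∀ y ∈ closure K, ψ y = 0 → A' y ∈ closure K := fun y hy hy0 =>
    hcl.mem_of_tendsto (hlAy y) (Filter.Eventually.of_forall fun n =>
      h.smul_mem_closure (by
        rw [hA, homothety_apply, hy0, mul_zero, zero_smul, add_zero]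
        exact h.map_mem_closure (hγ _) hy) (inv_pos.2 (hAn _)))
  have hA'o : A' o ∈ closure K :=
    hcl.mem_of_tendsto (hlAy o) (Filter.Eventually.of_forall fun n =>
      h.smul_mem_closure (by
        rw [hA, homothety_apply, ho1, mul_one]
        have : o + (t (φ n) - 1) • o = t (φ n) • o := by module
        rw [this]
        exact subset_closure (h.map_mem _ (hγ _) _ (h.smul_mem _ ho _ (ht _))))
        (inv_pos.2 (hAn _)))
  have hA'0 : A' ≠ 0 := by rintro rfl; simp at hA'
  have hB'0 : B' ≠ 0 := by rintro rfl; simp at hB'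
  have hA'p : A' p ≠ 0 := by
    intro h0
    rw [hp, map_add] at h0
    have h1 : A' x ∈ closure K := hA'ker x hxK hψx
    have h2 : A' o = 0 := h.sharp _ hA'o (by rwa [← eq_neg_of_add_eq_zero_left h0])
    have h3 : ∑ i, A' (f i) = 0 := by rw [h2, add_zero, hx, map_sum] at h0; exact h0
    have h4 := h.eq_zero_of_sum Finset.univ (fun i _ => hA'ker (f i) (hf i) (hf0 i)) h3
    apply hA'0
    have h5 : LinearMap.ker ψ ≤ LinearMap.ker (A' : E →ₗ[ℝ] E) :=
      hspan.trans (Submodule.span_le.2 (by rintro _ ⟨i, rfl⟩; exact h4 i (Finset.mem_univ _)))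
    ext y
    have h6 : y - ψ y • o ∈ LinearMap.ker ψ := by simp [ho1]
    have h7 := h5 h6
    rw [LinearMap.mem_ker, map_sub, map_smul] at h7
    simp only [ContinuousLinearMap.coe_coe, h2, smul_zero, sub_zero] at h7
    simpa using h7
  have hψq : 0 < ψ q := h.pos_of_nonneg hψ0 hψ (hQK hq)
  have hA'pK : A' p ∈ K := by
    set r : ℕ → ℝ := fun n => ‖A (φ n)‖⁻¹ * (c (φ n))⁻¹ with hr
    have h1 : ∀ n, ‖A (φ n)‖⁻¹ • A (φ n) p = r n • c (φ n) • γ (φ n) (x + t (φ n) • o) := by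
      intro n
      rw [hAp, smul_smul, hr, mul_assoc, inv_mul_cancel₀ (hc _).ne', mul_one]
    have h2 : Filter.Tendsto r Filter.atTop (𝓝 (ψ (A' p) / ψ q)) := by
      have h3 := ((hψc.tendsto _).comp (hlAy p)).div ((hψc.tendsto _).comp hlq) hψq.ne'
      refine h3.congr fun n => ?_
      simp only [Pi.div_apply, Function.comp_apply]
      rw [h1, map_smul, smul_eq_mul, mul_div_assoc, div_self, mul_one]
      exact (h.pos_of_nonneg hψ0 hψ (hQK (hcQ _))).ne'
    have h4 : A' p = (ψ (A' p) / ψ q) • q := by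
      refine tendsto_nhds_unique (hlAy p) ((h2.smul hlq).congr fun n => (h1 n).symm)
    have h5 : 0 ≤ ψ (A' p) / ψ q := ge_of_tendsto' h2 fun n => by
      have := hAn (φ n)
      have := hc (φ n)
      simp only [hr]; positivity
    have h6 : ψ (A' p) / ψ q ≠ 0 := fun h0 => hA'p (by rw [h4, h0, zero_smul])
    rw [h4]
    exact h.smul_mem _ (hQK hq) _ (lt_of_le_of_ne h5 h6.symm)
  -- the limit of the second sequence
  have hBK : ∀ n, ∀ y ∈ K, 0 ≤ ψ (B n y) ∧ B n y ∈ K ∧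
      B n y - ψ (B n y) • o + (t n * ψ (B n y)) • o ∈ closure K := by
    intro n y hy
    have hy' : (γ n).symm y ∈ K := h.map_mem _ (inv_mem (hγ n)) _ hy
    set y' := (γ n).symm y with hy''
    have e1 : B n y = y' + (((t n)⁻¹ - 1) * ψ y') • o := by rw [hB, homothety_apply]
    have e2 : ψ (B n y) = (t n)⁻¹ * ψ y' := by
      rw [e1, map_add, map_smul, ho1, smul_eq_mul]; ring
    have h1 := hψ y' hy'
    have h2 : 1 ≤ (t n)⁻¹ := (one_le_inv₀ (ht n)).2 (ht1 n)
    refine ⟨by rw [e2]; positivity, ?_, ?_⟩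
    · rw [e1]
      exact h.add_closure_mem hy' (h.smul_mem_closure' (subset_closure ho)
        (mul_nonneg (by linarith) h1))
    · have : B n y - ψ (B n y) • o + (t n * ψ (B n y)) • o = y' := by
        rw [e2, ← mul_assoc, mul_inv_cancel₀ (ht n).ne', e1]; module
      rw [this]; exact subset_closure hy'
  have hB'K : ∀ y ∈ K, B' y ∈ closure K := fun y hy =>
    hcl.mem_of_tendsto (hlBy y) (Filter.Eventually.of_forall fun n =>
      h.smul_mem_closure (subset_closure (hBK _ y hy).2.1) (inv_pos.2 (hBn _)))
  have hB'dec : ∀ y ∈ K, B' y - ψ (B' y) • o ∈ closure K := fun y hy => by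
    have h1 : Filter.Tendsto (fun n => ψ (‖B (φ n)‖⁻¹ • B (φ n) y)) Filter.atTop (𝓝 (ψ (B' y))) :=
      (hψc.tendsto _).comp (hlBy y)
    have h2 := ((hlBy y).sub (h1.smul (tendsto_const_nhds (x := o)))).add
      (((htt.comp hφ.tendsto_atTop).mul h1).smul (tendsto_const_nhds (x := o)))
    rw [zero_mul, zero_smul, add_zero] at h2
    refine hcl.mem_of_tendsto h2 (Filter.Eventually.of_forall fun n => ?_)
    have := h.smul_mem_closure (hBK (φ n) y hy).2.2 (inv_pos.2 (hBn (φ n)))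
    convert this using 1
    simp only [map_smul, smul_eq_mul, Function.comp_apply]
    module
  have hCpos : 0 < C := by
    refine lt_of_le_of_ne hC0 fun h0 => hB'0 (h.eq_zero_of_apply hB'K hA'pK ?_)
    rw [hBAe, ← h0, zero_smul]
  let ψ' : Module.Dual ℝ E := C⁻¹ • (ψ ∘ₗ (B' : E →ₗ[ℝ] E))
  have hψ' : ∀ y, ψ' y = C⁻¹ * ψ (B' y) := fun y => rfl
  have hψ'c := ψ'.continuous_of_finiteDimensional
  refine ⟨A' o, ψ', hA'o, ?_, fun y hy => ?_, fun y hy => ?_⟩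
  · rw [hψ', hBAe, map_smul, ho1, smul_eq_mul, mul_one, inv_mul_cancel₀ hCpos.ne']
  · refine nonneg_closure (K := K) (ψ := ψ') (fun z hz => ?_) hy
    have := nonneg_closure hψ (hB'K z hz)
    rw [hψ']; positivity
  · have hc1 : IsClosed {y | y - ψ' y • A' o ∈ closure K} :=
      hcl.preimage (by fun_prop)
    refine closure_minimal (fun z hz => ?_) hc1 hy
    have h1 := h.smul_mem_closure (hA'ker _ (hB'dec z hz) (by simp [ho1])) (inv_pos.2 hCpos)
    rw [map_sub, map_smul, hABe, smul_sub, smul_smul, inv_mul_cancel₀ hCpos.ne', one_smul,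
      smul_smul] at h1
    exact h1

/-- A divided cone has no facets. -/
theorem no_facet (hd : 2 ≤ Module.finrank ℝ E) {ψ : Module.Dual ℝ E} (hψ0 : ψ ≠ 0)
    (hψ : ∀ y ∈ K, 0 ≤ ψ y) {m : ℕ} {f : Fin m → E} (hf : ∀ i, f i ∈ closure K)
    (hli : LinearIndependent ℝ f) (hm : m + 1 = Module.finrank ℝ E) (hf0 : ∀ i, ψ (f i) = 0) :
    False := by
  obtain ⟨o, ho⟩ := h.nonempty
  have hpos := h.pos_of_nonneg hψ0 hψ ho
  have hspan : Submodule.span ℝ (range f) = LinearMap.ker ψ := by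
    refine Submodule.eq_of_le_of_finrank_eq
      (Submodule.span_le.2 (by rintro _ ⟨i, rfl⟩; exact hf0 i)) ?_
    have h1 := Module.Dual.finrank_ker_add_one_of_ne_zero hψ0
    rw [finrank_span_eq_card hli, Fintype.card_fin]
    omega
  obtain ⟨o', ψ', ho'⟩ := h.exists_isConePoint hψ (h.smul_mem _ ho _ (inv_pos.2 hpos))
    (by rw [map_smul, smul_eq_mul, inv_mul_cancel₀ hpos.ne']) hf hspan.ge rfl hf0
  exact h.not_isConePoint hd ho'

end NoFacet

end IsDividedCone

section Walls

variable {E : Type*} [NormedAddCommGroup E] [NormedSpace ℝ E]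
  {K : Set E} {G : Subgroup (E ≃ₗ[ℝ] E)}

lemma IsConeSimplex.pos_of_mem (hK : Convex ℝ K) {m : ℕ} {v : Fin m → E} (hv : IsConeSimplex K v)
    {t : Fin m → ℝ} (ht : ∑ i, t i • v i ∈ K) (i : Fin m) : 0 < t i := by
  obtain ⟨j, -, hj⟩ := Finset.exists_min_image Finset.univ t ⟨i, Finset.mem_univ i⟩
  by_contra! hi
  have hj0 : t j ≤ 0 := (hj i (Finset.mem_univ i)).trans hi
  have hs : 0 < 1 - t j := by linarith
  have h1 := hK (hv.2.1 (fun _ => 1) fun _ => one_pos) ht (a := -t j / (1 - t j))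
    (b := 1 / (1 - t j)) (div_nonneg (by linarith) hs.le) (by positivity)
    (by field_simp; ring)
  refine hv.2.2 (fun i => -t j / (1 - t j) + 1 / (1 - t j) * t i) (fun l => ?_) ⟨j, ?_⟩ ?_
  · have h2 := hj l (Finset.mem_univ l)
    have : -t j / (1 - t j) + 1 / (1 - t j) * t l = (t l - t j) / (1 - t j) := by ring
    rw [this]; exact div_nonneg (by linarith) hs.le
  · ring
  · convert h1 using 1
    rw [Finset.smul_sum, Finset.smul_sum, ← Finset.sum_add_distrib]
    exact Finset.sum_congr rfl fun l _ => by simp only [one_smul, add_smul, mul_smul]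

namespace IsDividedCone

variable (h : IsDividedCone K G)
include h

lemma exists_support {z : E} (hz : z ∈ closure K) (hzK : z ∉ K) :
    ∃ ψ : Module.Dual ℝ E, ψ z = 0 ∧ ∀ y ∈ K, 0 < ψ y := by
  obtain ⟨f, hf⟩ := geometric_hahn_banach_open_point h.convex h.isOpen hzK
  have hf' : ∀ t : ℝ, 0 < t → ∀ y ∈ K, t * f y < f z := fun t ht y hy => by
    have := hf _ (h.smul_mem y hy t ht)
    rwa [map_smul, smul_eq_mul] at this
  have h1 : ∀ y ∈ K, f y ≤ 0 := fun y hy => by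
    by_contra! hpos
    have := hf' (|f z| / f y + 1) (by positivity) y hy
    rw [add_mul, div_mul_cancel₀ _ hpos.ne', one_mul] at this
    have := le_abs_self (f z)
    linarith
  have h2 : 0 ≤ f z := by
    obtain ⟨y, hy⟩ := h.nonempty
    by_contra! hneg
    rcases (h1 y hy).eq_or_lt with h3 | h3
    · have := hf y hy
      linarith
    · have := hf' (f z / f y) (div_pos_of_neg_of_neg hneg h3) y hy
      rw [div_mul_cancel₀ _ h3.ne] at this
      exact lt_irrefl _ this
  have h3 : f z ≤ 0 := by
    have : closure K ⊆ {y | f y ≤ 0} := closure_minimal h1 (isClosed_le f.continuous continuous_const)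
    exact this hz
  have h4 : f z = 0 := le_antisymm h3 h2
  refine ⟨-(f : E →ₗ[ℝ] ℝ), by simp [h4], fun y hy => ?_⟩
  have := hf y hy
  simp only [LinearMap.neg_apply, ContinuousLinearMap.coe_coe]
  linarith

variable [FiniteDimensional ℝ E]

/-- A hyperplane spanned by a properly embedded codimension-one simplex is parallel to every
reflection whose mirror meets the simplex. -/
theorem simplex_wall {k : ℕ} (hk : k + 1 = Module.finrank ℝ E) (h3 : 3 ≤ k) {v : Fin k → E}
    (hv : IsConeSimplex K v) {φ : Module.Dual ℝ E} (hφ0 : φ ≠ 0) (hφ : ∀ i, φ (v i) = 0)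
    {r : E ≃ₗ[ℝ] E} (hr : r ∈ G) {α : Module.Dual ℝ E} {u : E} (hru : ∀ y, r y = y - α y • u)
    {z : E} (hz : z ∈ K) (hφz : φ z = 0) (hαz : α z = 0) :
    φ u = 0 ∨ ∀ i, α (v i) = 0 := by
  classical
  by_contra! hcon
  obtain ⟨hφu, i₀, hi₀⟩ := hcon
  have hspan : Submodule.span ℝ (range v) = LinearMap.ker φ := by
    refine Submodule.eq_of_le_of_finrank_eq
      (Submodule.span_le.2 (by rintro _ ⟨i, rfl⟩; exact hφ i)) ?_
    have h1 := Module.Dual.finrank_ker_add_one_of_ne_zero hφ0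
    rw [finrank_span_eq_card hv.1, Fintype.card_fin]
    omega
  obtain ⟨t, rfl⟩ : ∃ t : Fin k → ℝ, ∑ i, t i • v i = z := by
    have : z ∈ Submodule.span ℝ (range v) := by rw [hspan]; exact hφz
    exact (Submodule.mem_span_range_iff_exists_fun ℝ).1 this
  have ht := hv.pos_of_mem h.convex hz
  have hsum : ∑ i, t i * α (v i) = 0 := by simpa using hαz
  have hex : ∀ ε : ℝ, (ε = 1 ∨ ε = -1) → ∃ p, 0 < ε * α (v p) := by
    intro ε hε
    by_contra! hn
    have h1 : ∑ i, t i * (ε * α (v i)) = 0 := by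
      have : ∑ i, t i * (ε * α (v i)) = ε * ∑ i, t i * α (v i) := by
        rw [Finset.mul_sum]; exact Finset.sum_congr rfl fun i _ => by ring
      rw [this, hsum, mul_zero]
    have h2 := (Finset.sum_eq_zero_iff_of_nonpos fun i _ =>
      mul_nonpos_of_nonneg_of_nonpos (ht i).le (hn i)).1 h1 i₀ (Finset.mem_univ _)
    rcases mul_eq_zero.1 h2 with h2 | h2
    · exact (ht i₀).ne' h2
    · rcases hε with rfl | rfl <;> simp [hi₀] at h2
  obtain ⟨p, hp⟩ := hex 1 (Or.inl rfl)
  obtain ⟨q, hq⟩ := hex (-1) (Or.inr rfl)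
  rw [one_mul] at hp
  have hpq : p ≠ q := by rintro rfl; linarith
  obtain ⟨j, hj⟩ : ∃ j, j ∉ ({p, q} : Finset (Fin k)) := by
    by_contra! hc
    have h1 : Finset.univ ⊆ ({p, q} : Finset (Fin k)) := fun i _ => hc i
    have h2 := Finset.card_le_card h1
    rw [Finset.card_univ, Fintype.card_fin, Finset.card_pair hpq] at h2
    omega
  simp only [Finset.mem_insert, Finset.mem_singleton, not_or] at hj
  obtain ⟨hjp, hjq⟩ := hj
  set S : ℝ := ∑ i ∈ ((Finset.univ.erase p).erase q).erase j, α (v i) with hS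
  let a : ℝ := (|S| + 1) / α (v p)
  let b : ℝ := (S + |S| + 1) / (-1 * α (v q))
  have hSn : 0 ≤ S + |S| := by have := neg_abs_le S; linarith
  have ha : 0 < a := by simp only [a]; positivity
  have hb : 0 < b := div_pos (by linarith) hq
  let t' : Fin k → ℝ := fun i => if i = j then 0 else if i = p then a else if i = q then b else 1
  have ht'j : t' j = 0 := by simp [t']
  have ht'p : t' p = a := by simp [t', Ne.symm hjp]
  have ht'q : t' q = b := by simp [t', Ne.symm hjq, Ne.symm hpq]
  have ht' : ∀ i, i ≠ j → 0 < t' i := by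
    intro i hi
    simp only [t', if_neg hi]
    split_ifs <;> first | assumption | exact one_pos
  have ht'0 : ∀ i, 0 ≤ t' i := fun i => by
    by_cases hi : i = j
    · rw [hi, ht'j]
    · exact (ht' i hi).le
  have hsum' : ∑ i, t' i * α (v i) = 0 := by
    rw [← Finset.add_sum_erase _ _ (Finset.mem_univ p),
      ← Finset.add_sum_erase _ _ (show q ∈ Finset.univ.erase p by simp [Ne.symm hpq]),
      ← Finset.add_sum_erase _ _ (show j ∈ (Finset.univ.erase p).erase q by simp [hjp, hjq]),
      ht'p, ht'q, ht'j]
    have h1 : ∑ i ∈ ((Finset.univ.erase p).erase q).erase j, t' i * α (v i) = S := by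
      refine Finset.sum_congr rfl fun i hi => ?_
      simp only [Finset.mem_erase] at hi
      simp [t', hi.1, hi.2.1, hi.2.2.1]
    rw [h1]
    have e1 : a * α (v p) = |S| + 1 := div_mul_cancel₀ _ hp.ne'
    have e2 : b * α (v q) = -(S + |S| + 1) := by
      have : b * (-1 * α (v q)) = S + |S| + 1 := div_mul_cancel₀ _ hq.ne'
      linarith
    rw [e1, e2]; ring
  obtain ⟨ψ, hψz, hψ⟩ := h.exists_support (hv.mem_closure ht'0) (hv.2.2 t' ht'0 ⟨j, ht'j⟩)
  have hvc : ∀ i, v i ∈ closure K := fun i => by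
    have := hv.mem_closure (t := Pi.single i 1) fun l => by
      by_cases hl : l = i
      · subst hl; simp
      · simp [Pi.single_eq_of_ne hl]
    rw [Finset.sum_eq_single i] at this
    · simpa using this
    · intro l _ hl; simp [Pi.single_eq_of_ne hl]
    · simp
  have hψc : ∀ y ∈ closure K, 0 ≤ ψ y := fun y hy =>
    nonneg_closure (fun y hy => (hψ y hy).le) hy
  have hψv : ∀ i, i ≠ j → ψ (v i) = 0 := by
    intro i hi
    have h1 : ∑ i, t' i * ψ (v i) = 0 := by simpa using hψz
    have h2 := (Finset.sum_eq_zero_iff_of_nonneg fun i _ =>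
      mul_nonneg (ht'0 i) (hψc _ (hvc i))).1 h1 i (Finset.mem_univ _)
    exact (mul_eq_zero.1 h2).resolve_left (ht' i hi).ne'
  have hψr : ψ (r (v p)) = 0 := by
    have h1 : ∑ i, t' i * ψ (r (v i)) = 0 := by
      have h2 : ∑ i, t' i * ψ (r (v i)) = ∑ i, t' i * ψ (v i) - (∑ i, t' i * α (v i)) * ψ u := by
        rw [Finset.sum_mul, ← Finset.sum_sub_distrib]
        refine Finset.sum_congr rfl fun i _ => ?_
        rw [hru, map_sub, map_smul, smul_eq_mul]; ring
      rw [h2, hsum', zero_mul, sub_zero]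
      simpa using hψz
    have h2 := (Finset.sum_eq_zero_iff_of_nonneg fun i _ =>
      mul_nonneg (ht'0 i) (hψc _ (h.map_mem_closure hr (hvc i)))).1 h1 p (Finset.mem_univ _)
    exact (mul_eq_zero.1 h2).resolve_left (ht' p (Ne.symm hjp)).ne'
  have hψ0 : ψ ≠ 0 := by
    rintro rfl
    obtain ⟨y, hy⟩ := h.nonempty
    simpa using hψ y hy
  have hφr : φ (r (v p)) ≠ 0 := by
    rw [hru, map_sub, map_smul, hφ, zero_sub, smul_eq_mul]
    exact neg_ne_zero.2 (mul_ne_zero hp.ne' hφu)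
  refine h.no_facet (by omega) hψ0 (fun y hy => (hψ y hy).le)
    (f := Function.update v j (r (v p))) (fun i => ?_) ?_ hk fun i => ?_
  · by_cases hi : i = j
    · subst hi; rw [Function.update_self]; exact h.map_mem_closure hr (hvc p)
    · rw [Function.update_of_ne hi]; exact hvc i
  · rw [Fintype.linearIndependent_iff]
    intro g hg
    have hgj : g j = 0 := by
      have h1 := congrArg φ hg
      rw [map_sum, map_zero, Finset.sum_eq_single j] at h1
      · rw [Function.update_self, map_smul, smul_eq_mul] at h1
        exact (mul_eq_zero.1 h1).resolve_right hφr
      · intro i _ hi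
        rw [Function.update_of_ne hi, map_smul, hφ, smul_zero]
      · simp
    refine Fintype.linearIndependent_iff.1 hv.1 g ?_
    rw [← hg]
    refine Finset.sum_congr rfl fun i _ => ?_
    by_cases hi : i = j
    · rw [hi, hgj, zero_smul, zero_smul]
    · rw [Function.update_of_ne hi]
  · by_cases hi : i = j
    · subst hi; rw [Function.update_self]; exact hψr
    · rw [Function.update_of_ne hi]; exact hψv i hi

end IsDividedCone

end Walls

/-- The numerical data of the reflection groups. -/
structure VinbergParams where
  n : ℕ
  b : ℕ
  κ : ℝ
  κ_pos : 0 < κ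
  shape : (n = 3 ∧ b = 1) ∨ (n = 4 ∧ b = 2) ∨ (n = 5 ∧ b = 2) ∨ (n = 6 ∧ b = 3)
  eqn : κ * (1 + κ) * (n * κ + b) * (n * κ + n - b) = (1 + n * (κ * (1 + κ)) / 2) ^ 2
  gap : 2 < 3 * (n * (κ * (1 + κ)))

namespace VinbergParams

variable (p : VinbergParams)

lemma three_le : 3 ≤ p.n := by have := p.shape; omega

lemma one_le_b : 1 ≤ p.b := by have := p.shape; omega

lemma b_lt : p.b < p.n := by have := p.shape; omega

instance : NeZero p.n := ⟨by have := p.three_le; omega⟩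

/-- The multiplier of the `i`-th wall of the alcove: `(1 + κ) / κ` at the last index. -/
noncomputable def ω (i : Fin p.n) : ℝ := if i.val + 1 = p.n then (1 + p.κ) / p.κ else 1

/-- The step function equal to `κ` before `b` and to `1 + κ` from `b` on. -/
noncomputable def lo (i : Fin p.n) : ℝ := if i.val < p.b then p.κ else 1 + p.κ

/-- The step function equal to `1 + κ` before `b` and to `κ` from `b` on. -/
noncomputable def hi (i : Fin p.n) : ℝ := if i.val < p.b then 1 + p.κ else p.κ

/-- `κ (nκ + b)`. -/
noncomputable def h₄ : ℝ := p.κ * (p.n * p.κ + p.b)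

/-- `1 + nκ(1 + κ)/2`. -/
noncomputable def h₃ : ℝ := 1 + p.n * (p.κ * (1 + p.κ)) / 2

/-- The ratio `h₃ / h₄`. -/
noncomputable def k₄ : ℝ := p.h₃ / p.h₄

/-- The ambient space of dimension `n + 2`. -/
abbrev E : Type := (Fin p.n → ℝ) × ℝ × ℝ

/-- The index set of the reflections. -/
abbrev ι : Type := Fin p.n ⊕ Fin 4

lemma n_pos : (0 : ℝ) < p.n := by have := p.three_le; exact_mod_cast (by omega : 0 < p.n)

lemma b_pos : (0 : ℝ) < p.b := by have := p.one_le_b; exact_mod_cast (by omega : 0 < p.b)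

lemma b_lt' : (p.b : ℝ) < p.n := by exact_mod_cast p.b_lt

lemma h₄_pos : 0 < p.h₄ := by
  have := p.κ_pos; have := p.n_pos; have := p.b_pos; unfold h₄; positivity

lemma h₃_pos : 0 < p.h₃ := by
  have := p.κ_pos; have := p.n_pos; unfold h₃; positivity

lemma k₄_pos : 0 < p.k₄ := div_pos p.h₃_pos p.h₄_pos

lemma k₄_mul_h₄ : p.k₄ * p.h₄ = p.h₃ := div_mul_cancel₀ _ p.h₄_pos.ne'

lemma k₄_mul_h₃ : p.k₄ * p.h₃ = (1 + p.κ) * (p.n * p.κ + p.n - p.b) := by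
  have h := p.eqn
  have h4 := p.h₄_pos.ne'
  have : p.k₄ * p.h₃ = p.h₃ ^ 2 / p.h₄ := by unfold k₄; ring
  rw [this, div_eq_iff h4]
  unfold h₃ h₄
  rw [← h]; ring

lemma three_h₃ : 4 < 3 * p.h₃ := by have := p.gap; unfold h₃; linarith

lemma ω_pos (i : Fin p.n) : 0 < p.ω i := by
  have := p.κ_pos; unfold ω; split_ifs <;> positivity

lemma lo_pos (i : Fin p.n) : 0 < p.lo i := by
  have := p.κ_pos; unfold lo; split_ifs <;> positivity

lemma hi_pos (i : Fin p.n) : 0 < p.hi i := by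
  have := p.κ_pos; unfold hi; split_ifs <;> positivity

lemma val_add_one (i : Fin p.n) :
    (i + 1).val = if i.val + 1 = p.n then 0 else i.val + 1 := by
  have h3 := p.three_le
  have hi := i.isLt
  rw [Fin.val_add, Fin.val_one', Nat.mod_eq_of_lt (by omega : 1 < p.n)]
  split_ifs with h
  · rw [h, Nat.mod_self]
  · rw [Nat.mod_eq_of_lt (by omega)]

lemma add_one_ne (i : Fin p.n) : i + 1 ≠ i := by
  intro h
  have h1 := congrArg Fin.val h
  have h3 := p.three_le
  rw [val_add_one] at h1
  split_ifs at h1 <;> omega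

lemma add_two_ne (i : Fin p.n) : i + 1 + 1 ≠ i := by
  intro h
  have h1 := congrArg Fin.val h
  have h3 := p.three_le
  rw [val_add_one, val_add_one] at h1
  split_ifs at h1 <;> omega

/-- The linear form `x ↦ ∑ᵢ aᵢ xᵢ + c₁ z₁ + c₂ z₂`. -/
noncomputable def form (a : Fin p.n → ℝ) (c₁ c₂ : ℝ) : Module.Dual ℝ p.E :=
  (Fintype.linearCombination ℝ a).comp (LinearMap.fst ℝ _ _) +
    c₁ • (LinearMap.fst ℝ ℝ ℝ).comp (LinearMap.snd ℝ _ _) +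
    c₂ • (LinearMap.snd ℝ ℝ ℝ).comp (LinearMap.snd ℝ _ _)

@[simp] lemma form_apply (a : Fin p.n → ℝ) (c₁ c₂ : ℝ) (x : p.E) :
    p.form a c₁ c₂ x = ∑ i, a i * x.1 i + c₁ * x.2.1 + c₂ * x.2.2 := by
  simp [form, Fintype.linearCombination_apply, mul_comm]

/-- The linear forms of the walls. -/
noncomputable def wall : p.ι → Module.Dual ℝ p.E
  | .inl i => p.form (Pi.single i 1 - (p.ω i)⁻¹ • Pi.single (i + 1) 1) 0 0
  | .inr 0 => p.form 0 1 0
  | .inr 1 => p.form 0 0 1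
  | .inr 2 => p.form (fun _ => p.κ) (-2) (-1)
  | .inr 3 => p.form p.lo (-p.k₄) (-(2 * p.k₄))

/-- The polar vectors. -/
noncomputable def pol : p.ι → p.E
  | .inl i => (Pi.single i 1 - p.ω i • Pi.single (i + 1) 1, 0, 0)
  | .inr 0 => (0, 2, -1)
  | .inr 1 => (0, -1, 2)
  | .inr 2 => (fun _ => -(1 + p.κ), -p.h₃, 0)
  | .inr 3 => (-p.hi, 0, -p.h₄)

lemma wall_inl (i : Fin p.n) (x : p.E) :
    p.wall (.inl i) x = x.1 i - (p.ω i)⁻¹ * x.1 (i + 1) := by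
  simp [wall, sub_mul, Finset.sum_sub_distrib, Pi.single_apply]

lemma wall_0 (x : p.E) : p.wall (.inr 0) x = x.2.1 := by simp [wall]

lemma wall_1 (x : p.E) : p.wall (.inr 1) x = x.2.2 := by simp [wall]

lemma wall_2 (x : p.E) :
    p.wall (.inr 2) x = p.κ * ∑ i, x.1 i - (2 * x.2.1 + x.2.2) := by
  simp [wall, Finset.mul_sum]; ring

lemma wall_3 (x : p.E) :
    p.wall (.inr 3) x = ∑ i, p.lo i * x.1 i - p.k₄ * (x.2.1 + 2 * x.2.2) := by
  simp [wall]; ring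

lemma sum_step (f : Fin p.n → ℝ) (a c : ℝ) (hf : ∀ i, f i = if i.val < p.b then a else c) :
    ∑ i, f i = p.b * a + (p.n - p.b) * c := by
  have hb := p.b_lt.le
  simp only [hf]
  rw [Fin.sum_univ_eq_sum_range (fun i => if i < p.b then a else c), Finset.sum_ite]
  have h1 : (Finset.range p.n).filter (· < p.b) = Finset.range p.b := by ext; simp; omega
  have h2 : ((Finset.range p.n).filter (fun i => ¬ i < p.b)).card = p.n - p.b := by
    have := Finset.card_filter_add_card_filter_not (s := Finset.range p.n) (fun i => i < p.b)
    rw [h1] at this; simp only [Finset.card_range] at this; omega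
  rw [h1, Finset.sum_const, Finset.sum_const, h2]
  simp [Nat.cast_sub hb]

lemma wall_inl_pol_inl (i j : Fin p.n) : p.wall (.inl i) (p.pol (.inl j)) =
    if i = j then 2 else if j = i + 1 then -(p.ω i)⁻¹ else if i = j + 1 then -p.ω j else 0 := by
  have hω := (p.ω_pos i).ne'
  rw [wall_inl]
  simp only [pol, Pi.sub_apply, Pi.smul_apply, smul_eq_mul, Pi.single_apply]
  have h1 := p.add_one_ne i
  have h2 := p.add_one_ne j
  have h3 := p.add_two_ne j
  by_cases hij : i = j
  · subst hij
    simp [h1, h1.symm]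
    field_simp
    norm_num
  · by_cases h : j = i + 1
    · subst h
      simp [h1.symm, h2.symm, (p.add_two_ne i).symm]
    · by_cases h' : i = j + 1
      · subst h'
        simp [h2, h3, h3.symm, h1]
      · have : i + 1 ≠ j := fun e => h e.symm
        simp [hij, h, h', this]

lemma sum_mul_pol_inl (f : Fin p.n → ℝ) (j : Fin p.n) :
    ∑ i, f i * (p.pol (.inl j)).1 i = f j - p.ω j * f (j + 1) := by
  simp [pol, mul_sub, Finset.sum_sub_distrib, Pi.single_apply, mul_comm]

lemma lo_step (j : Fin p.n) :
    p.lo j - p.ω j * p.lo (j + 1) = if j.val + 1 = p.b then -1 else 0 := by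
  have hκ := p.κ_pos.ne'
  have hb := p.b_lt
  have hb1 := p.one_le_b
  unfold lo ω
  rw [val_add_one]
  have := j.isLt
  split_ifs <;> first | omega | (field_simp; try ring)

lemma hi_step (j : Fin p.n) :
    p.hi j - (p.ω j)⁻¹ * p.hi (j + 1) = if j.val + 1 = p.b then 1 else 0 := by
  have hκ := p.κ_pos
  have hb := p.b_lt
  have hb1 := p.one_le_b
  unfold hi ω
  rw [val_add_one]
  have := j.isLt
  split_ifs <;> first | omega | (field_simp; try ring)

lemma wall_2_pol_inl (j : Fin p.n) :
    p.wall (.inr 2) (p.pol (.inl j)) = if j.val + 1 = p.n then -1 else 0 := by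
  have hκ := p.κ_pos.ne'
  rw [wall_2, Finset.mul_sum, p.sum_mul_pol_inl (fun _ => p.κ)]
  simp only [pol, ω]
  split_ifs <;> field_simp <;> ring

lemma wall_3_pol_inl (j : Fin p.n) :
    p.wall (.inr 3) (p.pol (.inl j)) = if j.val + 1 = p.b then -1 else 0 := by
  rw [wall_3, sum_mul_pol_inl, lo_step]
  simp [pol]

lemma wall_inl_pol_2 (j : Fin p.n) :
    p.wall (.inl j) (p.pol (.inr 2)) = if j.val + 1 = p.n then -1 else 0 := by
  have hκ := p.κ_pos
  rw [wall_inl]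
  simp only [pol, ω]
  split_ifs <;> field_simp <;> ring

lemma wall_inl_pol_3 (j : Fin p.n) :
    p.wall (.inl j) (p.pol (.inr 3)) = if j.val + 1 = p.b then -1 else 0 := by
  rw [wall_inl]
  have := p.hi_step j
  simp only [pol, Pi.neg_apply]
  rw [show -p.hi j - (p.ω j)⁻¹ * -p.hi (j + 1) = -(p.hi j - (p.ω j)⁻¹ * p.hi (j + 1)) by ring,
    this]
  split_ifs <;> simp

lemma sum_lo : ∑ i, p.lo i = p.n * p.κ + p.n - p.b := by
  rw [p.sum_step p.lo p.κ (1 + p.κ) fun i => rfl]; ring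

lemma sum_hi : ∑ i, p.hi i = p.n * p.κ + p.b := by
  rw [p.sum_step p.hi (1 + p.κ) p.κ fun i => rfl]; ring

lemma lo_mul_hi (i : Fin p.n) : p.lo i * p.hi i = p.κ * (1 + p.κ) := by
  unfold lo hi; split_ifs <;> ring

/-- The integral Cartan matrix of the finite subdiagrams. -/
def cartanInt (n b : ℕ) : ℕ ⊕ Fin 4 → ℕ ⊕ Fin 4 → ℤ
  | .inl i, .inl j => if i = j then 2 else
      if j = i + 1 ∨ i = j + 1 ∨ (j = 0 ∧ i + 1 = n) ∨ (i = 0 ∧ j + 1 = n) then -1 else 0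
  | .inl i, .inr k => if (k = 2 ∧ i + 1 = n) ∨ (k = 3 ∧ i + 1 = b) then -1 else 0
  | .inr k, .inl i => if (k = 2 ∧ i + 1 = n) ∨ (k = 3 ∧ i + 1 = b) then -1 else 0
  | .inr k, .inr l => if k = l then 2 else
      if (k = 0 ∧ l = 1) ∨ (k = 1 ∧ l = 0) then -1 else 0

lemma wall_inr_pol_inr (k l : Fin 4) : p.wall (.inr k) (p.pol (.inr l)) =
    !![2, -1, -p.h₃, 0; -1, 2, 0, -p.h₄; -3, 0, 2, 0; 0, -(3 * p.k₄), 0, 2] k l := by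
  have e1 := p.k₄_mul_h₄
  have e2 := p.k₄_mul_h₃
  have e3 : 2 * p.h₃ = 2 + p.n * (p.κ * (1 + p.κ)) := by unfold h₃; ring
  fin_cases k <;> fin_cases l <;>
    simp [wall_0, wall_1, wall_2, wall_3, pol, sum_hi, sum_lo, lo_mul_hi, ← Finset.sum_mul]
  all_goals first | norm_num; done | skip
  · unfold h₃; ring
  · unfold h₄; ring
  · ring
  · linear_combination e2
  · linear_combination 2 * e1 + e3

/-- A point in the open chamber. -/
noncomputable def base : p.E :=
  (fun i => p.n * p.κ + (p.n - i.val),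
    min (p.κ / 4) (p.κ / (4 * p.k₄)), min (p.κ / 4) (p.κ / (4 * p.k₄)))

lemma base_pos (i : p.ι) : 0 < p.wall i p.base := by
  have hκ := p.κ_pos
  have hn := p.n_pos
  have hk := p.k₄_pos
  have hε : 0 < min (p.κ / 4) (p.κ / (4 * p.k₄)) := by positivity
  have hε1 := min_le_left (p.κ / 4) (p.κ / (4 * p.k₄))
  have hε2 := min_le_right (p.κ / 4) (p.κ / (4 * p.k₄))
  have h3 : (3 : ℝ) ≤ p.n := by exact_mod_cast p.three_le
  have hx : ∀ i : Fin p.n, 1 ≤ p.n * p.κ + ((p.n : ℝ) - i.val) := fun i => by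
    have : (i.val : ℝ) + 1 ≤ p.n := by exact_mod_cast i.isLt
    have : 0 < p.n * p.κ := by positivity
    linarith
  rcases i with i | k
  · rw [wall_inl]
    simp only [base, ω, val_add_one]
    have := i.isLt
    split_ifs with h
    · have hc : (i.val : ℝ) + 1 = p.n := by exact_mod_cast h
      field_simp
      push_cast
      nlinarith
    · push_cast; linarith
  · fin_cases k
    · simpa [wall_0, base] using hε
    · simpa [wall_1, base] using hε
    · have hs : (p.n : ℝ) ≤ ∑ i, p.base.1 i := by
        have := Finset.sum_le_sum fun i (_ : i ∈ Finset.univ) => hx i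
        simpa [base] using this
      show 0 < p.wall (.inr 2) p.base
      rw [wall_2]
      have : p.κ * 3 ≤ p.κ * ∑ i, p.base.1 i := by gcongr; linarith
      simp only [base] at this ⊢
      linarith
    · have hs : (p.n : ℝ) * p.κ ≤ ∑ i, p.lo i * p.base.1 i := by
        have := Finset.sum_le_sum fun i (_ : i ∈ Finset.univ) =>
          (show p.κ ≤ p.lo i * p.base.1 i by
            have h1 : p.κ ≤ p.lo i := by unfold lo; split_ifs <;> linarith
            have h2 := hx i
            calc p.κ = p.κ * 1 := by ring
              _ ≤ p.lo i * p.base.1 i := by gcongr; exact (p.lo_pos i).le; exact h2)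
        simpa using this
      show 0 < p.wall (.inr 3) p.base
      rw [wall_3]
      have : 3 * p.κ ≤ p.n * p.κ := by gcongr
      have h4 : p.k₄ * min (p.κ / 4) (p.κ / (4 * p.k₄)) ≤ p.κ / 4 :=
        (mul_le_mul_of_nonneg_left hε2 hk.le).trans (by field_simp; rfl)
      simp only [base] at hs ⊢
      nlinarith

lemma wall_inl_pol_inr (j : Fin p.n) (k : Fin 4) : p.wall (.inl j) (p.pol (.inr k)) =
    if (k = 2 ∧ j.val + 1 = p.n) ∨ (k = 3 ∧ j.val + 1 = p.b) then -1 else 0 := by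
  fin_cases k
  · simp [wall_inl, pol]
  · simp [wall_inl, pol]
  · simpa using p.wall_inl_pol_2 j
  · simpa using p.wall_inl_pol_3 j

lemma wall_inr_pol_inl (j : Fin p.n) (k : Fin 4) : p.wall (.inr k) (p.pol (.inl j)) =
    if (k = 2 ∧ j.val + 1 = p.n) ∨ (k = 3 ∧ j.val + 1 = p.b) then -1 else 0 := by
  fin_cases k
  · simp [wall_0, pol]
  · simp [wall_1, pol]
  · simpa using p.wall_2_pol_inl j
  · simpa using p.wall_3_pol_inl j

/-- The reflections of the example. -/
noncomputable def refl : ReflectionData p.ι p.E where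
  α := p.wall
  v := p.pol
  two := by
    rintro (i | k)
    · simp [wall_inl_pol_inl]
    · rw [wall_inr_pol_inr]; fin_cases k <;> rfl
  cartan := by
    have h3 := p.three_h₃
    have e1 := p.k₄_mul_h₄
    have hp3 := p.h₃_pos
    have hp4 := p.h₄_pos
    have hk4 := p.k₄_pos
    rintro (i | k) (j | l) hij
    · have hij' : i ≠ j := fun h => hij (h ▸ rfl)
      have a1 := p.ω_pos i
      have a2 := p.ω_pos j
      rw [wall_inl_pol_inl, wall_inl_pol_inl, if_neg hij', if_neg hij'.symm]
      by_cases h : j = i + 1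
      · have h' : i ≠ j + 1 := by rintro h'; rw [h] at h'; exact p.add_two_ne i h'.symm
        rw [if_pos h, if_neg h', if_pos h]
        right
        refine ⟨by simpa using a1, by simpa using a1, .inl ?_⟩
        field_simp
      · rw [if_neg h]
        by_cases h' : i = j + 1
        · rw [if_pos h', if_pos h']
          right
          refine ⟨by simpa using a2, by simpa using a2, .inl ?_⟩
          field_simp
        · simp [h, h']
    · rw [wall_inl_pol_inr, wall_inr_pol_inl]
      split_ifs <;> norm_num
    · rw [wall_inl_pol_inr, wall_inr_pol_inl]
      split_ifs <;> norm_num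
    · rw [wall_inr_pol_inr, wall_inr_pol_inr]
      fin_cases k <;> fin_cases l <;> simp at hij <;> simp [hp3, hp4, hk4]
      · right; linarith
      · right; right; linear_combination h3.le - 3 * e1
      · right; linarith
      · right; right; linear_combination h3.le - 3 * e1
  x₀ := p.base
  pos := p.base_pos

end VinbergParams

namespace VinbergParams

/-- Positive vectors with positive image under the finite Cartan matrices. -/
def certVec (n : ℕ) : List (List ℤ) :=
  if n = 3 then [[1, 3, 4, 1, 1, 3, 1], [3, 1, 3, 1, 1, 2, 2], [4, 3, 1, 1, 1, 1, 3]]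
  else if n = 4 then [[1, 8, 9, 8, 1, 1, 5, 5], [6, 1, 6, 10, 1, 1, 6, 1],
    [9, 8, 1, 8, 1, 1, 5, 5], [6, 10, 6, 1, 1, 1, 1, 6]]
  else if n = 5 then [[1, 5, 6, 6, 5, 1, 1, 3, 3], [10, 1, 8, 14, 18, 1, 1, 10, 1],
    [24, 18, 1, 15, 28, 1, 1, 15, 10], [24, 28, 15, 1, 18, 1, 1, 10, 15],
    [10, 18, 14, 8, 1, 1, 1, 1, 10]]
  else [[1, 21, 40, 36, 30, 22, 1, 1, 12, 21], [21, 1, 22, 30, 36, 40, 1, 1, 21, 12],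
    [30, 16, 1, 16, 30, 42, 1, 1, 22, 1], [36, 30, 22, 1, 21, 40, 1, 1, 21, 12],
    [30, 36, 40, 21, 1, 22, 1, 1, 12, 21], [16, 30, 42, 30, 16, 1, 1, 1, 1, 22]]

/-- The entries of `certVec`. -/
def certEntry {n : ℕ} (j : Fin n) (i : Fin n ⊕ Fin 4) : ℤ :=
  (((certVec n)[j.val]?.getD [])[Sum.elim (fun k : Fin n => k.val) (fun k : Fin 4 => n + k.val) i]?).getD 0

/-- Adjacent pairs of walls of the second factor together with all but one wall of the alcove. -/
def face {n : ℕ} (j : Fin n) (P : Fin 4) : Finset (Fin n ⊕ Fin 4) :=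
  (Finset.univ.erase j).disjSum {P, P + 1}

/-- Restriction of `cartanInt`. -/
def cartanFin (n b : ℕ) (i j : Fin n ⊕ Fin 4) : ℤ :=
  cartanInt n b (i.map Fin.val id) (j.map Fin.val id)

lemma certEntry_spec {n b : ℕ}
    (h : (n = 3 ∧ b = 1) ∨ (n = 4 ∧ b = 2) ∨ (n = 5 ∧ b = 2) ∨ (n = 6 ∧ b = 3))
    (j : Fin n) (P : Fin 4) : ∀ i ∈ face j P, 0 < certEntry j i ∧
      0 < ∑ l ∈ face j P, cartanFin n b i l * certEntry j l := by
  rcases h with ⟨rfl, rfl⟩ | ⟨rfl, rfl⟩ | ⟨rfl, rfl⟩ | ⟨rfl, rfl⟩ <;> revert j P <;>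
    decide +kernel

variable (p : VinbergParams)

lemma mem_face_inl {i j : Fin p.n} {P : Fin 4} : Sum.inl i ∈ face j P ↔ i ≠ j := by
  simp [face]

lemma mem_face_inr {j : Fin p.n} {P k : Fin 4} : Sum.inr k ∈ face j P ↔ k = P ∨ k = P + 1 := by
  simp [face]

/-- The scaling making the finite subdiagram symmetric. -/
noncomputable def scaling (j : Fin p.n) : p.ι → ℝ
  | .inl i => if i.val < j.val then p.κ / (1 + p.κ) else 1
  | .inr 3 => if p.b ≤ j.val then p.κ / (1 + p.κ) else 1
  | .inr _ => 1

lemma scaling_inl_inl {i l j : Fin p.n} (hi : i ≠ j) (hl : l ≠ j) :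
    p.scaling j (.inl i) * p.wall (.inl i) (p.pol (.inl l)) =
      cartanFin p.n p.b (.inl i) (.inl l) * p.scaling j (.inl l) := by
  have h3 := p.three_le
  have hκ := p.κ_pos
  have e1 := p.val_add_one i
  have e2 := p.val_add_one l
  have hi' : i.val ≠ j.val := fun h => hi (Fin.ext h)
  have hl' : l.val ≠ j.val := fun h => hl (Fin.ext h)
  have := i.isLt
  have := l.isLt
  have := j.isLt
  rw [wall_inl_pol_inl]
  simp only [Fin.ext_iff, e1, e2, cartanFin, cartanInt, Sum.map_inl, scaling, ω]
  split_ifs <;> first | omega | (field_simp; push_cast; try ring1)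

/-- The finite-type certificates. -/
noncomputable def cert (j : Fin p.n) (P : Fin 4) : p.refl.FinCert (face j P) where
  c := p.scaling j
  M := cartanFin p.n p.b
  u := fun i => certEntry j i
  c_pos := by
    have hκ := p.κ_pos
    rintro (i | k) -
    · simp only [scaling]; split_ifs <;> positivity
    · fin_cases k <;> simp [scaling]
      split_ifs <;> positivity
  u_pos := fun i hi => by exact_mod_cast (certEntry_spec p.shape j P i hi).1
  scale := by
    have hκ := p.κ_pos
    have hb1 := p.one_le_b
    have hb := p.b_lt
    have hj := j.isLt
    rintro (i | k) hi (l | m) hl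
    · exact p.scaling_inl_inl ((p.mem_face_inl).1 hi) ((p.mem_face_inl).1 hl)
    · have hi' : i.val ≠ j.val := fun h => (p.mem_face_inl).1 hi (Fin.ext h)
      change p.scaling j (.inl i) * p.wall (.inl i) (p.pol (.inr m)) = _
      rw [wall_inl_pol_inr]
      fin_cases m <;> simp [cartanFin, cartanInt, scaling] <;> split_ifs <;>
        first | omega | norm_num
    · have hl' : l.val ≠ j.val := fun h => (p.mem_face_inl).1 hl (Fin.ext h)
      change p.scaling j (.inr k) * p.wall (.inr k) (p.pol (.inl l)) = _
      rw [wall_inr_pol_inl]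
      fin_cases k <;> simp [cartanFin, cartanInt, scaling] <;> split_ifs <;>
        first | omega | norm_num
    · rw [mem_face_inr] at hi hl
      change p.scaling j (.inr k) * p.wall (.inr k) (p.pol (.inr m)) = _
      rw [wall_inr_pol_inr]
      fin_cases k <;> fin_cases m <;> fin_cases P <;> simp at hi hl <;>
        simp [cartanFin, cartanInt, scaling]
      all_goals split_ifs <;> ring
  symm := by
    rintro (i | k) hi (l | m) hl
    · simp only [cartanFin, cartanInt, Sum.map_inl]
      split_ifs <;> omega
    · rfl
    · rfl
    · fin_cases k <;> fin_cases m <;> rfl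
  pos := fun i hi => by exact_mod_cast (certEntry_spec p.shape j P i hi).2

/-- The first index. -/
def fst : Fin p.n := ⟨0, by have := p.three_le; omega⟩

/-- The last index. -/
def lst : Fin p.n := ⟨p.n - 1, by have := p.three_le; omega⟩

section Alcove

variable {p} {f : Fin p.n → ℝ} (hf : ∀ i, (p.ω i)⁻¹ * f (i + 1) ≤ f i)
include hf

lemma alcove_antitone {i j : Fin p.n} (hij : i ≤ j) : f j ≤ f i := by
  obtain ⟨j, hj⟩ := j
  obtain ⟨i, hi⟩ := i
  have hij : i ≤ j := hij
  induction j, hij using Nat.le_induction with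
  | base => rfl
  | succ j hij' ih =>
    refine le_trans ?_ (ih (by omega) hij')
    have := hf ⟨j, by omega⟩
    rw [show (⟨j, by omega⟩ : Fin p.n) + 1 = ⟨j + 1, hj⟩ from Fin.ext (by
      rw [val_add_one, if_neg (by simp; omega)])] at this
    simpa [ω, hj.ne] using this

lemma alcove_wrap : p.κ * f p.fst ≤ (1 + p.κ) * f p.lst := by
  have hκ := p.κ_pos
  have h3 := p.three_le
  have hl : p.lst.val + 1 = p.n := by simp [lst]; omega
  have := hf p.lst
  rw [show p.lst + 1 = p.fst from Fin.ext (by rw [val_add_one, if_pos hl]; rfl), ω, if_pos hl,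
    inv_div, div_mul_eq_mul_div, div_le_iff₀ (by positivity)] at this
  linarith

lemma alcove_fst_nonneg : 0 ≤ f p.fst := by
  have hκ := p.κ_pos
  have h1 := alcove_wrap hf
  have h2 := alcove_antitone hf (show p.fst ≤ p.lst from Nat.zero_le _)
  nlinarith

lemma alcove_nonneg (i : Fin p.n) : 0 ≤ f i := by
  have hκ := p.κ_pos
  have h1 := alcove_wrap hf
  have h0 := alcove_fst_nonneg hf
  have h2 := alcove_antitone hf (show i ≤ p.lst by
    have := i.isLt; exact Fin.le_def.2 (by simp [lst]; omega))
  refine le_trans ?_ h2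
  by_contra! hc
  nlinarith

lemma alcove_eq_zero_of_le (h : f p.fst ≤ 0) : f = 0 := by
  ext i
  exact le_antisymm ((alcove_antitone hf (show p.fst ≤ i from Nat.zero_le _)).trans h)
    (alcove_nonneg hf i)

/-- The two partial sums of a point of the alcove. -/
lemma alcove_sums : ∃ Q S : ℝ, 0 ≤ Q ∧ 0 ≤ S ∧ ∑ i, f i = Q + S ∧
    ∑ i, p.lo i * f i = p.κ * Q + (1 + p.κ) * S ∧ p.b * S ≤ (p.n - p.b) * Q ∧
    (p.n - p.b) * (p.κ * Q) ≤ p.b * ((1 + p.κ) * S) := by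
  have hκ := p.κ_pos
  have hb1 := p.one_le_b
  have hb := p.b_lt
  have hb' := p.b_lt'
  have hb0 := p.b_pos
  set B : Fin p.n := ⟨p.b, hb⟩
  refine ⟨∑ i : Fin p.n, if i.val < p.b then f i else 0, ∑ i : Fin p.n, if i.val < p.b then 0 else f i,
    Finset.sum_nonneg fun i _ => ?_, Finset.sum_nonneg fun i _ => ?_, ?_, ?_, ?_, ?_⟩
  · split_ifs; exacts [alcove_nonneg hf i, le_rfl]
  · split_ifs; exacts [le_rfl, alcove_nonneg hf i]
  · rw [← Finset.sum_add_distrib]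
    exact Finset.sum_congr rfl fun i _ => by split_ifs <;> simp
  · rw [Finset.mul_sum, Finset.mul_sum, ← Finset.sum_add_distrib]
    exact Finset.sum_congr rfl fun i _ => by unfold lo; split_ifs <;> simp
  · have h1 : ∑ i : Fin p.n, (if i.val < p.b then 0 else f i) ≤
        ∑ i : Fin p.n, (if i.val < p.b then 0 else f B) :=
      Finset.sum_le_sum fun i _ => by
        split_ifs with h
        exacts [le_rfl, alcove_antitone hf (Fin.le_def.2 (show p.b ≤ i.val by omega))]
    have h2 : ∑ i : Fin p.n, (if i.val < p.b then f B else 0) ≤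
        ∑ i : Fin p.n, (if i.val < p.b then f i else 0) :=
      Finset.sum_le_sum fun i _ => by
        split_ifs with h
        exacts [alcove_antitone hf (Fin.le_def.2 h.le), le_rfl]
    rw [p.sum_step _ _ _ fun i => rfl] at h1
    rw [p.sum_step _ _ _ fun i => rfl] at h2
    nlinarith
  · have h1 : ∑ i : Fin p.n, (if i.val < p.b then f i else 0) ≤
        ∑ i : Fin p.n, (if i.val < p.b then f p.fst else 0) :=
      Finset.sum_le_sum fun i _ => by
        split_ifs with h
        exacts [alcove_antitone hf (Nat.zero_le _), le_rfl]
    have h2 : ∑ i : Fin p.n, (if i.val < p.b then 0 else f p.lst) ≤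
        ∑ i : Fin p.n, (if i.val < p.b then 0 else f i) :=
      Finset.sum_le_sum fun i _ => by
        split_ifs with h
        exacts [le_rfl, alcove_antitone hf (Fin.le_def.2 (by
          have := i.isLt; simp [lst]; omega))]
    rw [p.sum_step _ _ _ fun i => rfl] at h1
    rw [p.sum_step _ _ _ fun i => rfl] at h2
    have h3 := alcove_wrap hf
    have hnb : (0 : ℝ) < p.n - p.b := by linarith
    have e1 : (p.n - p.b) * (p.κ * ∑ i : Fin p.n, (if i.val < p.b then f i else 0)) ≤
        (p.n - p.b) * (p.κ * (p.b * f p.fst)) := by gcongr; linarith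
    have e2 : p.b * ((1 + p.κ) * ((p.n - p.b) * f p.lst)) ≤
        p.b * ((1 + p.κ) * ∑ i : Fin p.n, if i.val < p.b then 0 else f i) := by gcongr; linarith
    have e3 : p.b * ((p.n - p.b) * (p.κ * f p.fst)) ≤
        p.b * ((p.n - p.b) * ((1 + p.κ) * f p.lst)) := by gcongr
    linarith

end Alcove

end VinbergParams

namespace VinbergParams

variable (p : VinbergParams)

lemma mem_C {x : p.E} : x ∈ p.refl.C ↔ ∀ i, 0 ≤ p.wall i x := Iff.rfl

variable {p} in
lemma alcove_of_mem_C {x : p.E} (hx : x ∈ p.refl.C) (i : Fin p.n) :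
    (p.ω i)⁻¹ * x.1 (i + 1) ≤ x.1 i := by
  have := p.mem_C.1 hx (.inl i); rw [wall_inl] at this; linarith

lemma h₃_lt : p.h₃ < 2 * (p.n * (p.κ * (1 + p.κ))) := by
  have := p.gap; unfold h₃; linarith

lemma eqn' : p.h₄ * ((1 + p.κ) * (p.n * p.κ + p.n - p.b)) = p.h₃ ^ 2 := by
  rw [← p.k₄_mul_h₃, ← p.k₄_mul_h₄]; ring

section Chamber

variable {p} {x : p.E} (hx : x ∈ p.refl.C)
include hx

lemma eq_zero_of_fst (h : x.1 p.fst ≤ 0) : x = 0 := by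
  have h1 := alcove_eq_zero_of_le (alcove_of_mem_C hx) h
  have hz1 := p.mem_C.1 hx (.inr 0)
  have hz2 := p.mem_C.1 hx (.inr 1)
  have hz3 := p.mem_C.1 hx (.inr 2)
  rw [wall_0] at hz1
  rw [wall_1] at hz2
  rw [wall_2, h1] at hz3
  simp at hz3
  exact Prod.ext h1 (Prod.ext (by simp; linarith) (by simp; linarith))

lemma eq_zero_of_inl (h : ∀ i, p.wall (.inl i) x = 0) : x = 0 := by
  refine eq_zero_of_fst hx ?_
  have := alcove_fst_nonneg (f := -x.1) (fun i => by
    have := h i; rw [wall_inl] at this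
    simp only [Pi.neg_apply]; linarith)
  simpa using this

lemma eq_zero_of_sum (h : ∑ i, x.1 i ≤ 0) : x = 0 := by
  refine eq_zero_of_fst hx ?_
  have h0 := alcove_nonneg (alcove_of_mem_C hx)
  exact (Finset.single_le_sum (fun i _ => h0 i) (Finset.mem_univ _)).trans h

lemma eq_zero_of_0_2 (h0 : p.wall (.inr 0) x = 0) (h2 : p.wall (.inr 2) x = 0) : x = 0 := by
  obtain ⟨Q, S, hQ, hS, e1, e2, i1, -⟩ := alcove_sums (alcove_of_mem_C hx)
  refine eq_zero_of_sum hx ?_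
  have hκ := p.κ_pos
  have hn := p.n_pos
  have hb := p.b_lt'
  have h3 := p.mem_C.1 hx (.inr 3)
  rw [wall_0] at h0
  rw [wall_2, e1, h0] at h2
  rw [wall_3, e2, h0] at h3
  have hh4 := p.h₄_pos
  have hh3 := p.h₃_pos
  rw [e1]
  by_contra! hc
  have hz : x.2.2 = p.κ * (Q + S) := by linarith
  rw [hz] at h3
  have a1 : 2 * p.h₃ * (p.κ * (Q + S)) ≤ p.h₄ * (p.κ * Q + (1 + p.κ) * S) := by
    have := mul_le_mul_of_nonneg_left h3 hh4.le
    have e := p.k₄_mul_h₄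
    rw [mul_zero] at this
    rw [← e]; linarith
  have a2 : p.n * (p.κ * Q + (1 + p.κ) * S) ≤ (p.n * p.κ + p.n - p.b) * (Q + S) := by linarith
  have a3 : p.n * (2 * p.h₃ * (p.κ * (Q + S))) ≤
      p.h₄ * ((p.n * p.κ + p.n - p.b) * (Q + S)) := by
    calc p.n * (2 * p.h₃ * (p.κ * (Q + S))) ≤ p.n * (p.h₄ * (p.κ * Q + (1 + p.κ) * S)) := by gcongr
      _ = p.h₄ * (p.n * (p.κ * Q + (1 + p.κ) * S)) := by ring
      _ ≤ _ := by gcongr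
  have a4 : (1 + p.κ) * (p.n * (2 * p.h₃ * (p.κ * (Q + S)))) ≤ p.h₃ ^ 2 * (Q + S) := by
    rw [← p.eqn']
    calc _ ≤ (1 + p.κ) * (p.h₄ * ((p.n * p.κ + p.n - p.b) * (Q + S))) := by gcongr
      _ = _ := by ring
  have a5 : p.h₃ * (2 * (p.n * (p.κ * (1 + p.κ)))) * (Q + S) ≤ p.h₃ * p.h₃ * (Q + S) := by
    linarith
  have a6 := le_of_mul_le_mul_left (le_of_mul_le_mul_right a5 hc) hh3
  linarith [p.h₃_lt]

lemma eq_zero_of_1_3 (h1 : p.wall (.inr 1) x = 0) (h3 : p.wall (.inr 3) x = 0) : x = 0 := by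
  obtain ⟨Q, S, hQ, hS, e1, e2, -, i2⟩ := alcove_sums (alcove_of_mem_C hx)
  refine eq_zero_of_sum hx ?_
  have hκ := p.κ_pos
  have hn := p.n_pos
  have hb := p.b_pos
  have h2 := p.mem_C.1 hx (.inr 2)
  rw [wall_1] at h1
  rw [wall_2, e1, h1] at h2
  rw [wall_3, e2, h1] at h3
  have hh4 := p.h₄_pos
  have hh3 := p.h₃_pos
  have hlt := p.h₃_lt
  rw [e1]
  by_contra! hc
  have hz : 2 * (p.κ * Q + (1 + p.κ) * S) ≤ p.k₄ * (p.κ * (Q + S)) := by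
    have := mul_le_mul_of_nonneg_left h2 p.k₄_pos.le
    rw [mul_zero] at this
    linarith
  have a1 : 2 * (p.κ * Q + (1 + p.κ) * S) * p.h₄ ≤ p.h₃ * (p.κ * (Q + S)) := by
    calc _ ≤ p.k₄ * (p.κ * (Q + S)) * p.h₄ := by gcongr
      _ = p.k₄ * p.h₄ * (p.κ * (Q + S)) := by ring
      _ = _ := by rw [p.k₄_mul_h₄]
  have a2 : p.h₃ * (p.κ * (Q + S)) ≤ 2 * (p.n * (p.κ * (1 + p.κ))) * (p.κ * (Q + S)) := by
    gcongr
  have a2' : p.h₃ * (p.κ * (Q + S)) < 2 * (p.n * (p.κ * (1 + p.κ))) * (p.κ * (Q + S)) := by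
    gcongr
  have a3 : 2 * p.κ * ((p.κ * Q + (1 + p.κ) * S) * (p.n * p.κ + p.b)) <
      2 * p.κ * (p.n * (p.κ * (1 + p.κ)) * (Q + S)) := by
    unfold h₄ at a1; linarith
  have a4 := lt_of_mul_lt_mul_left a3 (by positivity)
  nlinarith
end Chamber

lemma locFin : p.refl.LocFin := by
  refine p.refl.locFin_of_cert fun x hx hx0 => ?_
  obtain ⟨j, hj⟩ : ∃ j, p.wall (.inl j) x ≠ 0 := by
    by_contra! h; exact hx0 (eq_zero_of_inl hx h)
  obtain ⟨P, hP⟩ : ∃ P : Fin 4, ∀ k, p.wall (.inr k) x = 0 → k = P ∨ k = P + 1 := by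
    have h02 : ¬(p.wall (.inr 0) x = 0 ∧ p.wall (.inr 2) x = 0) := fun h =>
      hx0 (eq_zero_of_0_2 hx h.1 h.2)
    have h13 : ¬(p.wall (.inr 1) x = 0 ∧ p.wall (.inr 3) x = 0) := fun h =>
      hx0 (eq_zero_of_1_3 hx h.1 h.2)
    by_cases h0 : p.wall (.inr 0) x = 0 <;> by_cases h1 : p.wall (.inr 1) x = 0
    · exact ⟨0, fun k hk => by fin_cases k <;> simp_all⟩
    · exact ⟨3, fun k hk => by fin_cases k <;> simp_all⟩
    · exact ⟨1, fun k hk => by fin_cases k <;> simp_all⟩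
    · exact ⟨2, fun k hk => by fin_cases k <;> simp_all⟩
  refine ⟨face j P, ⟨p.cert j P⟩, ?_⟩
  rintro (i | k) hi
  · exact p.mem_face_inl.2 (by rintro rfl; exact hj hi)
  · exact p.mem_face_inr.2 (hP k hi)

end VinbergParams

namespace VinbergParams

variable (p : VinbergParams)

/-- The ratio `(1 + κ) / κ`. -/
noncomputable def μ : ℝ := (1 + p.κ) / p.κ

lemma one_lt_μ : 1 < p.μ := by
  have := p.κ_pos; unfold μ; rw [one_lt_div this]; linarith

lemma μ_pos : 0 < p.μ := one_pos.trans p.one_lt_μ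

lemma s_apply (i : p.ι) (x : p.E) : p.refl.s i x = x - p.wall i x • p.pol i :=
  p.refl.s_apply i x

lemma exists_adjacent (i : Fin p.n) (hi : i.val + 1 ≠ p.n) :
    ∃ g ∈ p.refl.W, ∀ x, g x = (x.1 ∘ Equiv.swap i (i + 1), x.2) := by
  have h1 := p.add_one_ne i
  refine ⟨_, p.refl.s_mem (.inl i), fun x => ?_⟩
  rw [s_apply, wall_inl]
  refine Prod.ext ?_ ?_
  · ext j
    simp only [pol, ω, if_neg hi, Prod.fst_sub, Prod.smul_fst, Pi.sub_apply, Pi.smul_apply,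
      smul_eq_mul, Function.comp_apply, Pi.single_apply, Equiv.swap_apply_def]
    split_ifs with h2 h3 h3
    · exact absurd (h3.symm.trans h2) h1
    · subst h2; ring
    · subst h3; ring
    · ring
  · simp [pol]

lemma exists_swap (i j : Fin p.n) :
    ∃ g ∈ p.refl.W, ∀ x, g x = (x.1 ∘ Equiv.swap i j, x.2) := by
  wlog hij : i.val ≤ j.val generalizing i j
  · obtain ⟨g, hg, h⟩ := this j i (by omega)
    exact ⟨g, hg, by simpa [Equiv.swap_comm] using h⟩
  obtain ⟨j, hj⟩ := j
  replace hij : i.val ≤ j := hij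
  induction j, hij using Nat.le_induction with
  | base => exact ⟨1, one_mem _, fun x => by simp⟩
  | succ j hij ih =>
    obtain ⟨g, hg, h⟩ := ih (by omega)
    obtain ⟨k, hk, h'⟩ := p.exists_adjacent ⟨j, by omega⟩ (by simp; omega)
    have e : (⟨j, by omega⟩ : Fin p.n) + 1 = ⟨j + 1, hj⟩ :=
      Fin.ext (by rw [val_add_one, if_neg (by simp; omega)])
    rw [e] at h'
    by_cases hij' : i = ⟨j, by omega⟩
    · exact ⟨k, hk, by rwa [hij']⟩
    refine ⟨k * g * k, mul_mem (mul_mem hk hg) hk, fun x => ?_⟩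
    rw [LinearEquiv.mul_apply, LinearEquiv.mul_apply, h', h, h']
    refine Prod.ext ?_ rfl
    have e2 : Equiv.swap (⟨j, by omega⟩ : Fin p.n) ⟨j + 1, hj⟩ * Equiv.swap i ⟨j, by omega⟩ *
        Equiv.swap (⟨j, by omega⟩ : Fin p.n) ⟨j + 1, hj⟩ = Equiv.swap i ⟨j + 1, hj⟩ := by
      rw [Equiv.swap_mul_swap_mul_swap hij' (fun h => by
        have := congrArg Fin.val h; simp at this; omega), Equiv.swap_comm]
    rw [← e2]
    rfl

lemma exists_perm (σ : Equiv.Perm (Fin p.n)) :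
    ∃ g ∈ p.refl.W, ∀ x, g x = (x.1 ∘ σ, x.2) := by
  induction σ using Equiv.Perm.swap_induction_on with
  | one => exact ⟨1, one_mem _, fun x => rfl⟩
  | swap_mul f a b _ ih =>
    obtain ⟨g, hg, h⟩ := ih
    obtain ⟨k, hk, h'⟩ := p.exists_swap a b
    refine ⟨g * k, mul_mem hg hk, fun x => ?_⟩
    rw [LinearEquiv.mul_apply, h, h']
    rfl

/-- The lattice of translations: exponents of the diagonal elements of the group. -/
noncomputable def translations : AddSubgroup (Fin p.n → ℤ) where
  carrier := {l | ∃ g ∈ p.refl.W, ∀ x : p.E, g x = (fun i => p.μ ^ l i * x.1 i, x.2)}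
  zero_mem' := ⟨1, one_mem _, fun x => by simp⟩
  add_mem' := by
    rintro l m ⟨g, hg, h⟩ ⟨k, hk, h'⟩
    refine ⟨g * k, mul_mem hg hk, fun x => ?_⟩
    rw [LinearEquiv.mul_apply, h, h']
    simp [zpow_add₀ p.μ_pos.ne', mul_assoc]
  neg_mem' := by
    rintro l ⟨g, hg, h⟩
    refine ⟨g⁻¹, inv_mem hg, fun x => ?_⟩
    have e : x = g (fun i => p.μ ^ (-l) i * x.1 i, x.2) := by
      rw [h]
      refine Prod.ext (funext fun i => ?_) rfl
      have := zpow_pos p.μ_pos (l i)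
      simp [this.ne']
    conv_lhs => rw [e]
    exact ReflectionData.inv_apply_self g _

lemma fst_ne_lst : p.fst ≠ p.lst := by
  have := p.three_le
  intro h; have := congrArg Fin.val h; simp [fst, lst] at this; omega

lemma lst_val : p.lst.val + 1 = p.n := by have := p.three_le; simp [lst]; omega

lemma lst_add_one : p.lst + 1 = p.fst :=
  Fin.ext (by rw [val_add_one, if_pos p.lst_val]; rfl)

lemma single_mem_translations :
    Pi.single p.fst 1 - Pi.single p.lst 1 ∈ p.translations := by
  obtain ⟨g, hg, h⟩ := p.exists_swap p.fst p.lst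
  refine ⟨p.refl.s (.inl p.lst) * g, mul_mem (p.refl.s_mem _) hg, fun x => ?_⟩
  have hμ := p.μ_pos.ne'
  rw [LinearEquiv.mul_apply, h, s_apply, wall_inl, lst_add_one]
  refine Prod.ext ?_ ?_
  · ext j
    have hω : p.ω p.lst = p.μ := by rw [ω, if_pos p.lst_val]; rfl
    simp only [pol, hω, lst_add_one, Prod.fst_sub, Prod.smul_fst, Pi.sub_apply, Pi.smul_apply,
      smul_eq_mul, Function.comp_apply, Pi.single_apply, Equiv.swap_apply_left,
      Equiv.swap_apply_right]
    by_cases h1 : j = p.fst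
    · subst h1
      simp only [if_neg p.fst_ne_lst, Equiv.swap_apply_left, if_true, sub_zero, zpow_one]
      field_simp
      ring
    · by_cases h2 : j = p.lst
      · subst h2
        simp [h1]
      · simp [h1, h2, Equiv.swap_apply_of_ne_of_ne]
  · simp [pol]

lemma perm_mem_translations {l : Fin p.n → ℤ} (hl : l ∈ p.translations)
    (σ : Equiv.Perm (Fin p.n)) : l ∘ σ ∈ p.translations := by
  obtain ⟨t, ht, h⟩ := hl
  obtain ⟨g, hg, h1⟩ := p.exists_perm σ
  obtain ⟨k, hk, h2⟩ := p.exists_perm σ⁻¹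
  refine ⟨g * t * k, mul_mem (mul_mem hg ht) hk, fun x => ?_⟩
  rw [LinearEquiv.mul_apply, LinearEquiv.mul_apply, h2, h, h1]
  refine Prod.ext (funext fun i => ?_) rfl
  simp

lemma root_mem_translations {i k : Fin p.n} (hik : i ≠ k) :
    Pi.single i 1 - Pi.single k 1 ∈ p.translations := by
  have h0 := p.fst_ne_lst
  set σ₁ := Equiv.swap p.fst i with hσ₁
  set σ := Equiv.swap (σ₁ p.lst) k * σ₁ with hσ
  have e0 : σ p.fst = i := by
    have : σ₁ p.fst = i := Equiv.swap_apply_left _ _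
    rw [hσ, Equiv.Perm.mul_apply, this, Equiv.swap_apply_of_ne_of_ne _ hik]
    rw [← this]; exact fun h => h0 (σ₁.injective h)
  have e1 : σ p.lst = k := by rw [hσ, Equiv.Perm.mul_apply, Equiv.swap_apply_left]
  have := p.perm_mem_translations p.single_mem_translations σ⁻¹
  convert this using 1
  ext j
  simp only [Pi.sub_apply, Function.comp_apply, Pi.single_apply]
  have a0 : σ⁻¹ j = p.fst ↔ j = i := by rw [Equiv.Perm.inv_eq_iff_eq, e0]
  have a1 : σ⁻¹ j = p.lst ↔ j = k := by rw [Equiv.Perm.inv_eq_iff_eq, e1]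
  simp only [a0, a1]

lemma weight_mem_translations (i : Fin p.n) :
    (fun j => if j = i then (p.n : ℤ) - 1 else -1) ∈ p.translations := by
  have h : ∑ k ∈ Finset.univ.erase i, (Pi.single i 1 - Pi.single k 1) ∈ p.translations :=
    sum_mem fun k hk => p.root_mem_translations (Finset.ne_of_mem_erase hk).symm
  have h3 := p.three_le
  convert h using 1
  ext j
  rw [Finset.sum_sub_distrib, Finset.sum_const, Finset.card_erase_of_mem (Finset.mem_univ _)]
  simp only [Pi.sub_apply, Pi.smul_apply, Finset.sum_apply, Pi.single_apply]
  split_ifs with hj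
  · subst hj
    rw [Finset.sum_eq_zero fun k hk => if_neg (Finset.ne_of_mem_erase hk).symm]
    simp
    omega
  · rw [Finset.sum_ite_eq]
    simp [hj]

/-- The coordinate vectors of the first factor. -/
noncomputable def e (i : Fin p.n) : p.E := (Pi.single i 1, 0, 0)

lemma infinite_W : (p.refl.W : Set (p.E ≃ₗ[ℝ] p.E)).Infinite := by
  have h (m : ℕ) : ∃ g ∈ p.refl.W, g (p.e p.fst) = p.μ ^ m • p.e p.fst := by
    obtain ⟨g, hg, h⟩ := p.translations.nsmul_mem p.single_mem_translations m
    refine ⟨g, hg, ?_⟩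
    rw [h]
    refine Prod.ext (funext fun j => ?_) (by simp [e])
    by_cases hj : j = p.fst
    · subst hj; simp [e, p.fst_ne_lst]
    · simp [e, hj]
  choose g hg h using h
  refine Set.infinite_of_injective_forall_mem (f := g) (fun a c hac => ?_) hg
  have h1 : p.μ ^ a • p.e p.fst = p.μ ^ c • p.e p.fst := by rw [← h, ← h, hac]
  have h2 : p.μ ^ a = p.μ ^ c := by simpa [e] using congrFun (congrArg Prod.fst h1) p.fst
  exact pow_right_injective₀ p.μ_pos p.one_lt_μ.ne' h2

section Irreducible

variable {p} {U : Submodule ℝ p.E} (hU : ∀ g ∈ p.refl.W, ∃ m > 0, ∀ x ∈ U, (g ^ m) x ∈ U)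
include hU

lemma component_mem {w : p.E ≃ₗ[ℝ] p.E} (hw : w ∈ p.refl.W) {x : p.E} (hx : w x ∈ U)
    (i : Fin p.n) (hi : x.1 i ≠ 0) : w (p.e i) ∈ U := by
  obtain ⟨g, hg, h⟩ := p.weight_mem_translations i
  obtain ⟨m, hm, hmU⟩ := hU (w * g * w⁻¹) (mul_mem (mul_mem hw hg) (inv_mem hw))
  have hμ := p.μ_pos
  have hn : (2 : ℤ) ≤ p.n - 1 := by have := p.three_le; omega
  have hgm : ∀ y : p.E, (g ^ m) y = (fun j => if j = i then (p.μ ^ ((p.n : ℤ) - 1)) ^ m * y.1 j else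
      (p.μ⁻¹) ^ m * y.1 j, y.2) := by
    intro y
    clear hm hmU
    induction m with
    | zero => simp
    | succ m ih =>
      rw [pow_succ', LinearEquiv.mul_apply, ih, h]
      refine Prod.ext (funext fun j => ?_) rfl
      by_cases hj : j = i <;> simp [hj, pow_succ'] <;> ring
  have hstep : ∀ y, w y ∈ U → w ((g ^ m) y) ∈ U := by
    intro y hy
    have := hmU _ hy
    rwa [conj_pow, LinearEquiv.mul_apply, LinearEquiv.mul_apply,
      ReflectionData.inv_apply_self] at this
  set a := (p.μ ^ ((p.n : ℤ) - 1)) ^ m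
  set c := (p.μ⁻¹) ^ m
  have ha : 1 < a := one_lt_pow₀ (one_lt_zpow₀ p.one_lt_μ (by omega)) hm.ne'
  have hc : c < 1 := pow_lt_one₀ (inv_pos.2 hμ).le (inv_lt_one_of_one_lt₀ p.one_lt_μ) hm.ne'
  have h2 := hstep _ (hstep _ hx)
  have h1 := hstep _ hx
  have key : w ((g ^ m) ((g ^ m) x)) - (c + 1) • w ((g ^ m) x) + c • w x =
      ((a - c) * (a - 1) * x.1 i) • w (p.e i) := by
    have : (g ^ m) ((g ^ m) x) - (c + 1) • (g ^ m) x + c • x =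
        ((a - c) * (a - 1) * x.1 i) • p.e i := by
      rw [hgm x, hgm]
      refine Prod.ext (funext fun j => ?_) ?_
      · by_cases hj : j = i
        · subst hj; simp [e]; ring
        · simp [e, hj]; ring
      · change x.2 - (c + 1) • x.2 + c • x.2 = ((a - c) * (a - 1) * x.1 i) • (0 : ℝ × ℝ)
        module
    simpa only [map_sub, map_add, map_smul] using congrArg w this
  have := U.add_mem (U.sub_mem h2 (U.smul_mem (c + 1) h1)) (U.smul_mem c hx)
  rw [key] at this
  have hne : (a - c) * (a - 1) * x.1 i ≠ 0 :=
    mul_ne_zero (mul_ne_zero (by linarith) (by linarith)) hi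
  exact (U.smul_mem_iff hne).1 this

lemma eq_top_of_e {i : Fin p.n} (hi : p.e i ∈ U) : U = ⊤ := by
  have hκ := p.κ_pos
  have wall_e2 : ∀ k, p.wall (.inr 2) (p.e k) = p.κ := fun k => by
    rw [wall_2]; simp [e]
  have wall_e3 : ∀ k, p.wall (.inr 3) (p.e k) = p.lo k := fun k => by
    rw [wall_3]; simp [e, Pi.single_apply]
  have hs : ∀ k l : Fin p.n, (p.refl.s (.inr 2) (p.e k)).1 l ≠ 0 := fun k l => by
    rw [s_apply, wall_e2]
    have : 0 ≤ (p.e k).1 l := by simp only [e, Pi.single_apply]; split_ifs <;> norm_num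
    simp only [pol, Prod.fst_sub, Prod.smul_fst, Pi.sub_apply, Pi.smul_apply, smul_eq_mul]
    nlinarith
  have hs' : ∀ k l : Fin p.n, (p.refl.s (.inr 3) (p.e k)).1 l ≠ 0 := fun k l => by
    rw [s_apply, wall_e3]
    have : 0 ≤ (p.e k).1 l := by simp only [e, Pi.single_apply]; split_ifs <;> norm_num
    have := mul_pos (p.lo_pos k) (p.hi_pos l)
    simp only [pol, Prod.fst_sub, Prod.smul_fst, Pi.sub_apply, Pi.smul_apply, smul_eq_mul,
      Pi.neg_apply]
    nlinarith
  have h2 : ∀ k, p.refl.s (.inr 2) (p.e k) ∈ U := fun k =>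
    component_mem hU (p.refl.s_mem _) (x := p.refl.s (.inr 2) (p.e i))
      (by rwa [p.refl.s_s]) k (hs i k)
  have he : ∀ k, p.e k ∈ U := fun k =>
    component_mem hU (one_mem _) (x := p.refl.s (.inr 2) (p.e i)) (h2 i) k (hs i k)
  have h3 : ∀ k, p.refl.s (.inr 3) (p.e k) ∈ U := fun k =>
    component_mem hU (p.refl.s_mem _) (x := p.refl.s (.inr 3) (p.e i))
      (by rw [p.refl.s_s]; exact hi) k (hs' i k)
  have hx : ∀ f : Fin p.n → ℝ, ((f, 0, 0) : p.E) ∈ U := fun f => by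
    have : ((f, 0, 0) : p.E) = ∑ k, f k • p.e k := by
      refine Prod.ext (funext fun j => ?_) ?_
      · simp [e, Prod.fst_sum, Finset.sum_apply, Pi.single_apply]
      · simp [e, Prod.snd_sum]
    rw [this]
    exact U.sum_mem fun k _ => U.smul_mem _ (he k)
  have hp2 : p.pol (.inr 2) ∈ U := by
    have := U.sub_mem (he i) (h2 i)
    rw [s_apply, wall_e2, sub_sub_cancel] at this
    exact (U.smul_mem_iff hκ.ne').1 this
  have hp3 : p.pol (.inr 3) ∈ U := by
    have := U.sub_mem (he i) (h3 i)
    rw [s_apply, wall_e3, sub_sub_cancel] at this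
    exact (U.smul_mem_iff (p.lo_pos i).ne').1 this
  have hz1 : ((0, 1, 0) : p.E) ∈ U := by
    have := U.sub_mem hp2 (hx (p.pol (.inr 2)).1)
    rw [← U.smul_mem_iff (neg_ne_zero.2 p.h₃_pos.ne')]
    convert this using 1
    simp [pol]
  have hz2 : ((0, 0, 1) : p.E) ∈ U := by
    have := U.sub_mem hp3 (hx (p.pol (.inr 3)).1)
    rw [← U.smul_mem_iff (neg_ne_zero.2 p.h₄_pos.ne')]
    convert this using 1
    simp [pol]
  rw [eq_top_iff]
  rintro ⟨f, a, c⟩ -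
  have := U.add_mem (hx f) (U.add_mem (U.smul_mem a hz1) (U.smul_mem c hz2))
  convert this using 1
  simp

lemma eq_bot_or_eq_top : U = ⊥ ∨ U = ⊤ := by
  by_cases h : ∃ w ∈ p.refl.W, ∃ i, w (p.e i) ∈ U
  · right
    obtain ⟨w, hw, i, hi⟩ := h
    have : U.comap (w : p.E →ₗ[ℝ] p.E) = ⊤ := by
      refine eq_top_of_e (i := i) (fun g hg => ?_) hi
      obtain ⟨m, hm, h⟩ := hU (w * g * w⁻¹) (mul_mem (mul_mem hw hg) (inv_mem hw))
      refine ⟨m, hm, fun x hx => ?_⟩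
      have := h _ hx
      rwa [conj_pow, LinearEquiv.coe_coe, LinearEquiv.mul_apply, LinearEquiv.mul_apply,
        ReflectionData.inv_apply_self] at this
    rw [eq_top_iff]
    intro x _
    have h1 : w⁻¹ x ∈ U.comap (w : p.E →ₗ[ℝ] p.E) := this ▸ Submodule.mem_top
    have h2 : w (w⁻¹ x) ∈ U := h1
    rwa [ReflectionData.apply_inv_self] at h2
  · left
    push Not at h
    rw [eq_bot_iff]
    intro x hx
    have key : ∀ w ∈ p.refl.W, (w⁻¹ x).1 = 0 := fun w hw => funext fun i => by
      by_contra hc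
      exact h w hw i (component_mem hU hw (x := w⁻¹ x)
        (by rwa [ReflectionData.apply_inv_self]) i hc)
    have h1 : x.1 = 0 := by simpa using key 1 (one_mem _)
    have h2 := key _ (p.refl.s_mem (.inr 2))
    have h3 := key _ (p.refl.s_mem (.inr 3))
    have hκ := p.κ_pos
    rw [p.refl.s_inv, s_apply, Prod.fst_sub, h1] at h2 h3
    have e2 := congrFun h2 p.fst
    have e3 := congrFun h3 p.fst
    simp only [pol, Prod.smul_fst, Pi.sub_apply, Pi.smul_apply, smul_eq_mul, Pi.neg_apply,
      Pi.zero_apply, zero_sub, neg_eq_zero, mul_eq_zero, (p.hi_pos p.fst).ne', or_false,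
      (by positivity : (1 + p.κ) ≠ 0)] at e2 e3
    rw [wall_2, h1] at e2
    rw [wall_3, h1] at e3
    have hk := p.k₄_pos.ne'
    simp [hk] at e2 e3
    refine Prod.ext h1 (Prod.ext ?_ ?_) <;> simp <;> linarith

end Irreducible

instance : Nonempty p.ι := ⟨.inr 0⟩

lemma isDividedCone : IsDividedCone p.refl.K p.refl.W :=
  p.refl.isDividedCone_K p.locFin p.infinite_W fun _ hU => eq_bot_or_eq_top hU

end VinbergParams

lemma IsConeSimplex.cast {E : Type*} [NormedAddCommGroup E] [NormedSpace ℝ E] {K : Set E} {m m' : ℕ}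
    (h : m = m') {v : Fin m → E} (hv : IsConeSimplex K v) :
    IsConeSimplex K (v ∘ Fin.cast h.symm) := by
  subst h
  exact hv

namespace VinbergParams

variable (p : VinbergParams)

variable {p} in
lemma coord_mem_closure {x : p.E} (hx : x ∈ p.refl.K) (i : Fin p.n) :
    x.1 i • p.e i ∈ closure p.refl.K := by
  have hμ := p.μ_pos
  have h3 := p.three_le
  obtain ⟨a, ha⟩ : ∃ a : ℕ, p.n = a + 1 := ⟨p.n - 1, by omega⟩
  have key (k : ℕ) : ((fun j => if j = i then x.1 j else ((p.μ⁻¹) ^ k) ^ p.n * x.1 j,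
      ((p.μ⁻¹) ^ k) ^ a • x.2) : p.E) ∈ p.refl.K := by
    obtain ⟨g, hg, h⟩ := p.translations.nsmul_mem (p.weight_mem_translations i) k
    have := p.refl.smul_mem_K (p.refl.map_mem_K hg hx) (t := ((p.μ⁻¹) ^ k) ^ a) (by positivity)
    convert this using 1
    rw [h]
    refine Prod.ext (funext fun j => ?_) rfl
    simp only [Prod.smul_fst, Pi.smul_apply, smul_eq_mul, nsmul_eq_mul]
    split_ifs with hj
    · subst hj
      rw [← mul_assoc]
      convert (one_mul _).symm using 2
      rw [inv_pow, inv_pow, ← pow_mul]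
      have e : (k : ℤ) * ((p.n : ℤ) - 1) = (k * a : ℕ) := by
        simp [ha]
      rw [e, zpow_natCast]
      exact inv_mul_cancel₀ (by positivity)
    · rw [← mul_assoc]
      congr 1
      simp [ha, pow_succ]
  refine mem_closure_of_tendsto (b := Filter.atTop) ?_ (Filter.Eventually.of_forall key)
  have h0 : Filter.Tendsto (fun k : ℕ => (p.μ⁻¹) ^ k) Filter.atTop (𝓝 0) :=
    tendsto_pow_atTop_nhds_zero_of_lt_one (by positivity) (inv_lt_one_of_one_lt₀ p.one_lt_μ)
  have h1 : ∀ c : ℕ, c ≠ 0 → Filter.Tendsto (fun k : ℕ => ((p.μ⁻¹) ^ k) ^ c) Filter.atTop (𝓝 0) :=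
    fun c hc => by simpa [hc] using h0.pow c
  refine Filter.Tendsto.prodMk_nhds (tendsto_pi_nhds.2 fun j => ?_) ?_
  · by_cases hj : j = i
    · subst hj; simp [e]
    · have := (h1 p.n (by omega)).mul_const (x.1 j)
      simpa [e, hj] using this
  · have := (h1 a (by omega)).smul_const x.2
    rw [zero_smul] at this
    have e0 : (x.1 i • p.e i).2 = 0 := by simp [e]
    rwa [← e0] at this

lemma ones_mem_C : ((fun _ => 1, 0, 0) : p.E) ∈ p.refl.C := by
  rw [mem_C]
  have hκ := p.κ_pos
  rintro (i | k)
  · rw [wall_inl]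
    have : (p.ω i)⁻¹ ≤ 1 := inv_le_one_of_one_le₀ (by
      unfold ω; split_ifs
      exacts [p.one_lt_μ.le, le_rfl])
    simpa using this
  · fin_cases k
    · simp [wall_0]
    · simp [wall_1]
    · simp [wall_2]; positivity
    · simpa [wall_3] using Finset.sum_nonneg fun i _ => (p.lo_pos i).le

lemma ones_mem_K : ((fun _ => 1, 0, 0) : p.E) ∈ p.refl.K :=
  p.refl.mem_K_of_mem_C p.ones_mem_C fun h => by
    simpa using congrFun (congrArg Prod.fst h) p.fst

lemma e_mem_closure (i : Fin p.n) : p.e i ∈ closure p.refl.K := by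
  simpa using coord_mem_closure p.ones_mem_K i

lemma sum_smul_e (t : Fin p.n → ℝ) : ∑ i, t i • p.e i = (t, 0, 0) := by
  refine Prod.ext (funext fun j => ?_) ?_
  · simp [e, Prod.fst_sum, Finset.sum_apply, Pi.single_apply]
  · simp [e, Prod.snd_sum]

lemma e_ne_zero (i : Fin p.n) : p.e i ≠ 0 := fun h => by
  simpa [e] using congrFun (congrArg Prod.fst h) i

variable {p} in
lemma pos_of_mem_K {t : Fin p.n → ℝ} {z : ℝ × ℝ} (ht : ((t, z) : p.E) ∈ p.refl.K) (i : Fin p.n) :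
    0 < t i := by
  have h := p.isDividedCone
  have hnn : ∀ {t : Fin p.n → ℝ}, ((t, z) : p.E) ∈ p.refl.K → 0 ≤ t i := by
    intro t ht
    by_contra! hc
    have h1 := coord_mem_closure ht i
    have h2 := h.smul_mem_closure' h1 (t := (-(t i))⁻¹) (by simpa using hc.le)
    rw [smul_smul, inv_neg, neg_mul, inv_mul_cancel₀ hc.ne, neg_one_smul] at h2
    exact p.e_ne_zero i (h.sharp _ (p.e_mem_closure i) h2)
  refine lt_of_le_of_ne (hnn ht) fun h0 => ?_
  have hc : Continuous fun ε : ℝ => ((t, z) : p.E) - ε • p.e i := by fun_prop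
  have : ∀ᶠ ε in 𝓝[>] (0 : ℝ), ((t, z) : p.E) - ε • p.e i ∈ p.refl.K :=
    nhdsWithin_le_nhds (hc.continuousAt.eventually_mem (h.isOpen.mem_nhds (by simpa using ht)))
  obtain ⟨ε, hε, hε0⟩ := (this.and self_mem_nhdsWithin).exists
  have e1 : ((t, z) : p.E) - ε • p.e i = (t - ε • Pi.single i 1, z) := by simp [e]
  rw [e1] at hε
  have := hnn hε
  replace hε0 : 0 < ε := hε0
  simp [← h0] at this
  linarith

lemma isConeSimplex : IsConeSimplex p.refl.K p.e := by
  have h := p.isDividedCone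
  refine ⟨?_, fun t ht => ?_, fun t ht ⟨i, hi⟩ hK => ?_⟩
  · rw [Fintype.linearIndependent_iff]
    intro g hg i
    rw [sum_smul_e] at hg
    exact congrFun (congrArg Prod.fst hg) i
  · have hne : (Finset.univ : Finset (Fin p.n)).Nonempty := ⟨p.fst, Finset.mem_univ _⟩
    obtain ⟨j, -, hj⟩ := Finset.exists_min_image Finset.univ t hne
    have h1 := h.smul_mem _ p.ones_mem_K _ (ht j)
    have h2 : ∑ i, (t i - t j) • p.e i ∈ closure p.refl.K :=
      h.sum_mem_closure _ fun i _ =>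
        h.smul_mem_closure' (p.e_mem_closure i) (sub_nonneg.2 (hj i (Finset.mem_univ _)))
    have := h.add_closure_mem h1 h2
    rw [sum_smul_e] at this ⊢
    convert this using 1
    refine Prod.ext (funext fun i => ?_) ?_ <;> simp
  · rw [sum_smul_e] at hK
    exact (pos_of_mem_K hK i).ne' hi

/-- A linear form positive on the cone and vanishing at all vertices of the simplex but one. -/
lemma exists_support_at (j : Fin p.n) : ∃ ψ : Module.Dual ℝ p.E,
    (∀ y ∈ p.refl.K, 0 < ψ y) ∧ (∀ i ≠ j, ψ (p.e i) = 0) ∧ 0 < ψ (p.e j) := by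
  have h := p.isDividedCone
  have hz : ∑ i, (if i = j then (0 : ℝ) else 1) • p.e i ∈ closure p.refl.K :=
    p.isConeSimplex.mem_closure fun i => by split_ifs <;> norm_num
  have hzK := p.isConeSimplex.2.2 (fun i => if i = j then (0 : ℝ) else 1)
    (fun i => by split_ifs <;> norm_num) ⟨j, by simp⟩
  obtain ⟨ψ, hψ, hpos⟩ := h.exists_support hz hzK
  have hnn : ∀ i, 0 ≤ ψ (p.e i) := fun i =>
    IsDividedCone.nonneg_closure (fun y hy => (hpos y hy).le) (p.e_mem_closure i)
  have h0 : ∀ i ≠ j, ψ (p.e i) = 0 := fun i hi => by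
    rw [map_sum, Finset.sum_eq_zero_iff_of_nonneg fun i _ => by
      rw [map_smul]; exact smul_nonneg (by split_ifs <;> norm_num) (hnn i)] at hψ
    simpa [hi] using hψ i (Finset.mem_univ _)
  refine ⟨ψ, hpos, h0, ?_⟩
  have h1 := hpos _ p.ones_mem_K
  rwa [← sum_smul_e, map_sum, Finset.sum_eq_single j (fun i _ hi => by simp [h0 i hi])
    (fun h => absurd (Finset.mem_univ _) h), one_smul] at h1

lemma finrank_E : Module.finrank ℝ p.E = p.n + 2 := by
  simp [Module.finrank_prod]

/-- The conclusion for the reflection groups, given that there is no simplex of dimension `n`. -/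
theorem exists_domain (d : ℕ) (hd : d + 1 = p.n + 2) {m : ℕ} (hm : p.n = m + 1)
    (hno : ∀ v : Fin (p.n + 1) → p.E, ¬ IsConeSimplex p.refl.K v) :
    ∃ (Ω : Set (RP d)) (Γ : Subgroup (GL (Fin (d + 1)) ℝ)),
      IsProperlyConvexDomain Ω ∧ Divides Γ Ω ∧ StronglyIrreducible Γ ∧
      ¬ IsStrictlyConvexDomain Ω ∧
      (∃ x ∈ frontier Ω, ∃ φ ψ : Module.Dual ℝ (Vec d),
        IsSupportingAt Ω φ x ∧ IsSupportingAt Ω ψ x ∧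
        LinearMap.ker φ ≠ LinearMap.ker ψ) ∧
      (∃ v : Fin (m + 1) → Vec d, ProperlyEmbeddedSimplex Ω v) ∧
      ¬ ∃ v : Fin (p.n + 1) → Vec d, ProperlyEmbeddedSimplex Ω v := by
  have h3 := p.three_le
  let φ : p.E ≃ₗ[ℝ] Vec d := LinearEquiv.ofFinrankEq _ _ (by
    rw [finrank_E, Module.finrank_fin_fun, hd])
  have hne1 : p.fst ≠ ⟨1, by omega⟩ := by simp [fst]
  have hne2 : p.fst ≠ ⟨2, by omega⟩ := by simp [fst]
  obtain ⟨ψ₁, hp1, h01, h11⟩ := p.exists_support_at ⟨1, by omega⟩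
  obtain ⟨ψ₂, hp2, h02, h12⟩ := p.exists_support_at ⟨2, by omega⟩
  refine exists_domain_of_cone φ p.isDividedCone (p.e ∘ Fin.cast hm.symm) ?_ (by omega)
    (x := p.e p.fst) ⟨p.e_mem_closure _, fun h => ?_⟩ (p.e_ne_zero _) (h01 _ hne1) (h02 _ hne2)
    hp1 hp2 (fun h => ?_) hno
  · exact IsConeSimplex.cast hm p.isConeSimplex
  · have := pos_of_mem_K h ⟨1, by omega⟩
    simp [fst] at this
  · have e1 : p.e ⟨1, by omega⟩ ∈ LinearMap.ker ψ₂ := h02 _ (by simp)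
    rw [← h] at e1
    exact h11.ne' e1

end VinbergParams

namespace VinbergParams

variable (p : VinbergParams)

/-- The vertex of the alcove opposite to the `j`-th wall. -/
noncomputable def vtx (j : Fin p.n) : Fin p.n → ℝ := fun i => if i ≤ j then 1 + p.κ else p.κ

lemma wall_inl_vtx (i j : Fin p.n) (z : ℝ × ℝ) :
    p.wall (.inl i) (p.vtx j, z) = if i = j then 1 else 0 := by
  have hκ := p.κ_pos
  have := i.isLt
  have := j.isLt
  rw [wall_inl]
  simp only [vtx, ω, Fin.le_def, val_add_one, Fin.ext_iff]
  split_ifs <;> first | omega | (field_simp; try ring)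

lemma alcove_vtx (j i : Fin p.n) : (p.ω i)⁻¹ * p.vtx j (i + 1) ≤ p.vtx j i := by
  have h := p.wall_inl_vtx i j 0
  rw [wall_inl] at h
  have : (0 : ℝ) ≤ if i = j then 1 else 0 := by split_ifs <;> norm_num
  simp only at h
  linarith

lemma vtx_ne_zero (j : Fin p.n) : p.vtx j ≠ 0 := fun h => by
  have := p.wall_inl_vtx j j 0
  simp [h, wall_inl] at this

lemma eq_sum_vtx (f : Fin p.n → ℝ) : f = ∑ j, p.wall (.inl j) (f, 0) • p.vtx j := by
  set g := f - ∑ j, p.wall (.inl j) (f, 0) • p.vtx j with hg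
  have h0 : ∀ i, p.wall (.inl i) (g, 0) = 0 := fun i => by
    have e : ((g, 0) : p.E) = (f, 0) - ∑ j, p.wall (.inl j) (f, 0) • (p.vtx j, (0 : ℝ × ℝ)) := by
      refine Prod.ext ?_ ?_
      · simp [hg, Prod.fst_sum]
      · simp [Prod.snd_sum]
    rw [e, map_sub, map_sum]
    simp only [map_smul, wall_inl_vtx, smul_eq_mul, mul_ite, mul_one, mul_zero]
    simp
  have h1 : ∀ i, (p.ω i)⁻¹ * g (i + 1) = g i := fun i => by
    have := h0 i; rw [wall_inl] at this; simp only at this; linarith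
  have h2 := alcove_fst_nonneg (f := -g) (fun i => by
    have := h1 i; simp only [Pi.neg_apply]; linarith)
  have h3 : g = 0 := alcove_eq_zero_of_le (fun i => (h1 i).le) (by simpa using h2)
  exact sub_eq_zero.1 h3

section Vert

/-- The linear form `κ ∑ xᵢ`. -/
noncomputable def S₂ : Module.Dual ℝ (Fin p.n → ℝ) := (p.wall (.inr 2)).comp (LinearMap.inl ℝ _ _)

/-- The linear form `(∑ loᵢ xᵢ) / k₄`. -/
noncomputable def S₃ : Module.Dual ℝ (Fin p.n → ℝ) :=
  (p.k₄⁻¹) • (p.wall (.inr 3)).comp (LinearMap.inl ℝ _ _)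

lemma wall_2_mk (f : Fin p.n → ℝ) (a c : ℝ) :
    p.wall (.inr 2) (f, a, c) = p.S₂ f - (2 * a + c) := by
  simp [S₂, wall_2]

lemma wall_3_mk (f : Fin p.n → ℝ) (a c : ℝ) :
    p.wall (.inr 3) (f, a, c) = p.k₄ * (p.S₃ f - (a + 2 * c)) := by
  have := p.k₄_pos.ne'
  simp [S₃, wall_3, mul_sub, this]

/-- The coefficients of the vertices of the quadrangle. -/
noncomputable def vertCoef (P : Fin 4) : (ℝ × ℝ) × ℝ × ℝ :=
  ![((0, 0), 0, 0), ((1 / 2, 0), 0, 0), ((2 / 3, -1 / 3), -1 / 3, 2 / 3), ((0, 0), 0, 1 / 2)] P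

/-- The vertex of the quadrangle over a point of the alcove where the walls `P` and `P + 1`
meet. -/
noncomputable def vert (P : Fin 4) : (Fin p.n → ℝ) →ₗ[ℝ] p.E :=
  LinearMap.prod LinearMap.id
    (LinearMap.prod ((vertCoef P).1.1 • p.S₂ + (vertCoef P).1.2 • p.S₃)
      ((vertCoef P).2.1 • p.S₂ + (vertCoef P).2.2 • p.S₃))

lemma vert_apply (P : Fin 4) (f : Fin p.n → ℝ) : p.vert P f =
    (f, (vertCoef P).1.1 * p.S₂ f + (vertCoef P).1.2 * p.S₃ f,
      (vertCoef P).2.1 * p.S₂ f + (vertCoef P).2.2 * p.S₃ f) := rfl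

lemma vert_zero (f : Fin p.n → ℝ) : p.vert 0 f = (f, 0) := by
  simp [vert_apply, vertCoef]

lemma wall_vert (P k : Fin 4) (hk : k = P ∨ k = P + 1) (f : Fin p.n → ℝ) :
    p.wall (.inr k) (p.vert P f) = 0 := by
  have h0 : p.k₄ ≠ 0 := p.k₄_pos.ne'
  have key : ∀ P : Fin 4, p.wall (.inr P) (p.vert P f) = 0 ∧
      p.wall (.inr (P + 1)) (p.vert P f) = 0 := by
    intro P
    fin_cases P
    · exact ⟨by simp [vert_zero, wall_0], by simp [vert_zero, wall_1]⟩
    · exact ⟨by simp [vert_apply, vertCoef, wall_1],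
        (p.wall_2_mk _ _ _).trans (by simp [vertCoef])⟩
    · exact ⟨(p.wall_2_mk _ _ _).trans (by simp [vertCoef]; ring),
        (p.wall_3_mk _ _ _).trans (by simp [vertCoef, h0]; ring)⟩
    · exact ⟨(p.wall_3_mk _ _ _).trans (by simp [vertCoef]),
        by simp [vert_apply, vertCoef, wall_0]⟩
  rcases hk with rfl | rfl
  exacts [(key k).1, (key P).2]

end Vert

section Alcove

variable {p} {f : Fin p.n → ℝ} (hf : ∀ i, (p.ω i)⁻¹ * f (i + 1) ≤ f i)
include hf

lemma mk_mem_C {a c : ℝ} (ha : 0 ≤ a) (hc : 0 ≤ c) (h2 : 2 * a + c ≤ p.S₂ f)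
    (h3 : a + 2 * c ≤ p.S₃ f) : ((f, a, c) : p.E) ∈ p.refl.C := by
  rw [mem_C]
  rintro (i | k)
  · rw [wall_inl]; have := hf i; simp only; linarith
  · fin_cases k
    · simpa [wall_0] using ha
    · simpa [wall_1] using hc
    · show 0 ≤ p.wall (.inr 2) _
      rw [wall_2_mk]; linarith
    · show 0 ≤ p.wall (.inr 3) _
      rw [wall_3_mk]; exact mul_nonneg p.k₄_pos.le (by linarith)

lemma S₂_nonneg : 0 ≤ p.S₂ f := by
  have e := p.wall_2_mk f 0 0
  rw [wall_2] at e
  simp only [mul_zero, add_zero, sub_zero] at e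
  rw [← e]
  exact mul_nonneg p.κ_pos.le (Finset.sum_nonneg fun i _ => alcove_nonneg hf i)

lemma S₃_nonneg : 0 ≤ p.S₃ f := by
  have e := p.wall_3_mk f 0 0
  rw [wall_3] at e
  simp only [mul_zero, add_zero, sub_zero] at e
  have : 0 ≤ p.k₄ * p.S₃ f := by
    rw [← e]
    exact Finset.sum_nonneg fun i _ => mul_nonneg (p.lo_pos i).le (alcove_nonneg hf i)
  exact nonneg_of_mul_nonneg_right this p.k₄_pos

lemma S₂_le : p.S₂ f ≤ 2 * p.S₃ f := by
  by_contra! hc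
  have h3 := S₃_nonneg hf
  have h := eq_zero_of_1_3 (mk_mem_C hf h3 le_rfl (by linarith) (by linarith))
    (by simp [wall_1]) (by simp [wall_3_mk])
  have h0 : f = 0 := congrArg Prod.fst h
  simp [h0] at hc

lemma S₃_le : p.S₃ f ≤ 2 * p.S₂ f := by
  by_contra! hc
  have h3 := S₂_nonneg hf
  have h := eq_zero_of_0_2 (mk_mem_C hf le_rfl h3 (by linarith) (by linarith))
    (by simp [wall_0]) (by simp [wall_2_mk])
  have h0 : f = 0 := congrArg Prod.fst h
  simp [h0] at hc

lemma vert_mem_C (P : Fin 4) : p.vert P f ∈ p.refl.C := by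
  have h2 := S₂_nonneg hf
  have h3 := S₃_nonneg hf
  have h23 := S₂_le hf
  have h32 := S₃_le hf
  fin_cases P <;> refine mk_mem_C hf ?_ ?_ ?_ ?_ <;> simp [vertCoef] <;> linarith

end Alcove

lemma vert_ne_zero {f : Fin p.n → ℝ} (hf : f ≠ 0) (P : Fin 4) : p.vert P f ≠ 0 := fun h =>
  hf (congrArg Prod.fst h)

/-- A linear form positive at the four vertices of the quadrangle is positive on it. -/
lemma pos_of_vert {f : Fin p.n → ℝ} {z : ℝ × ℝ} (hx : ((f, z) : p.E) ∈ p.refl.C)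
    {φ : Module.Dual ℝ p.E} (h : ∀ P, 0 < φ (p.vert P f)) : 0 < φ (f, z) := by
  obtain ⟨a, c⟩ := z
  have ha := hx (.inr 0)
  have hc := hx (.inr 1)
  have h2 := hx (.inr 2)
  have h3 := hx (.inr 3)
  change 0 ≤ p.wall _ _ at ha hc h2 h3
  rw [wall_0] at ha
  rw [wall_1] at hc
  rw [wall_2_mk] at h2
  rw [wall_3_mk] at h3
  replace h3 := nonneg_of_mul_nonneg_right h3 p.k₄_pos
  have e : ∀ a c : ℝ, φ (f, a, c) = φ (f, 0, 0) + a * φ (0, 1, 0) + c * φ (0, 0, 1) := by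
    intro a c
    rw [← smul_eq_mul, ← smul_eq_mul, ← map_smul, ← map_smul, ← map_add, ← map_add]
    simp
  have hP := fun P => h P
  simp only [vert_apply] at hP
  have g0 := hP 0
  have g1 := hP 1
  have g2 := hP 2
  have g3 := hP 3
  simp only [vertCoef, Matrix.cons_val] at g0 g1 g2 g3
  rw [e] at g0 g1 g2 g3 ⊢
  generalize φ (f, 0, 0) = t at *
  generalize φ (0, 1, 0) = u at *
  generalize φ (0, 0, 1) = v at *
  simp only at ha hc
  by_cases hu : 0 ≤ u <;> by_cases hv : 0 ≤ v
  · have := mul_nonneg ha hu; have := mul_nonneg hc hv; linarith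
  · nlinarith [mul_nonneg ha hu]
  · nlinarith [mul_nonneg hc hv]
  · by_cases h1 : v ≤ 2 * u
    · nlinarith
    · by_cases h4 : u ≤ 2 * v
      · nlinarith
      · nlinarith [mul_nonneg (by linarith : 0 ≤ v - 2 * u) h2, mul_nonneg (by linarith : 0 ≤ u - 2 * v) h3]

end VinbergParams

namespace VinbergParams

variable {p : VinbergParams}

section Wall

variable {φ : Module.Dual ℝ p.E} (hφ0 : φ ≠ 0)
  (hφ : ∀ i, ∀ x ∈ p.refl.C, x ≠ 0 → φ x = 0 → p.wall i x = 0 →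
    φ (p.pol i) = 0 ∨ ∃ c : ℝ, p.wall i = c • φ)

lemma exists_neighbour (p : VinbergParams) (i : p.ι) :
    ∃ k, ∃ x ∈ p.refl.C, x ≠ 0 ∧ p.wall i x = 0 ∧ p.wall k x = 0 ∧
      p.wall i (p.pol k) * p.wall k (p.pol i) = 1 := by
  have h3 := p.three_le
  have hκ := p.κ_pos
  have hb := p.b_lt
  have hb1 := p.one_le_b
  have mem : ∀ P j, p.vert P (p.vtx j) ∈ p.refl.C := fun P j => vert_mem_C (p.alcove_vtx j) P
  have ne : ∀ P j, p.vert P (p.vtx j) ≠ 0 := fun P j => p.vert_ne_zero (p.vtx_ne_zero j) P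
  have hw : ∀ P i j, i ≠ j → p.wall (.inl i) (p.vert P (p.vtx j)) = 0 := fun P i j hij => by
    rw [vert_apply, wall_inl_vtx, if_neg hij]
  rcases i with i | k
  · have h1 := p.add_one_ne i
    have h2 := p.add_two_ne i
    refine ⟨.inl (i + 1), p.vert 0 (p.vtx (i + 1 + 1)), mem _ _, ne _ _, hw _ _ _ h2.symm,
      hw _ _ _ (p.add_one_ne (i + 1)).symm, ?_⟩
    have hω := (p.ω_pos i).ne'
    rw [wall_inl_pol_inl, wall_inl_pol_inl, if_neg h1.symm, if_pos rfl, if_neg h1, if_neg h2.symm,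
      if_pos rfl]
    field_simp
  · fin_cases k
    · refine ⟨.inr 1, p.vert 0 (p.vtx p.fst), mem _ _, ne _ _, p.wall_vert 0 0 (by simp) _,
        p.wall_vert 0 1 (by simp) _, ?_⟩
      simp [wall_inr_pol_inr]
    · refine ⟨.inr 0, p.vert 0 (p.vtx p.fst), mem _ _, ne _ _, p.wall_vert 0 1 (by simp) _,
        p.wall_vert 0 0 (by simp) _, ?_⟩
      simp [wall_inr_pol_inr]
    · refine ⟨.inl p.lst, p.vert 1 (p.vtx p.fst), mem _ _, ne _ _, p.wall_vert 1 2 (by simp) _,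
        hw _ _ _ p.fst_ne_lst.symm, ?_⟩
      show p.wall (.inr 2) _ * p.wall _ (p.pol (.inr 2)) = 1
      rw [wall_inr_pol_inl, wall_inl_pol_inr, if_pos (by simp [p.lst_val])]
      norm_num
    · set i : Fin p.n := ⟨p.b - 1, by omega⟩
      refine ⟨.inl i, p.vert 3 (p.vtx p.lst), mem _ _, ne _ _, p.wall_vert 3 3 (by simp) _,
        hw _ _ _ (fun h => ?_), ?_⟩
      · have := congrArg Fin.val h
        have hl := p.lst_val
        simp only [i] at this
        omega
      show p.wall (.inr 3) _ * p.wall _ (p.pol (.inr 3)) = 1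
      rw [wall_inr_pol_inl, wall_inl_pol_inr, if_pos (by simp [i]; omega)]
      norm_num

include hφ in
lemma pol_eq_zero {i : p.ι} {x : p.E} (hx : x ∈ p.refl.C) (hx0 : x ≠ 0) (h0 : φ x = 0)
    (hw : p.wall i x = 0) : φ (p.pol i) = 0 := by
  refine (hφ i x hx hx0 h0 hw).resolve_right fun ⟨c, hc⟩ => ?_
  obtain ⟨k, y, hy, hy0, hi, hk, hik⟩ := p.exists_neighbour i
  have e1 : p.wall i (p.pol i) = 2 := p.refl.two i
  have e2 : p.wall k (p.pol k) = 2 := p.refl.two k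
  have hc0 : c ≠ 0 := by
    rintro rfl
    rw [hc] at e1
    simp at e1
  have hφy : φ y = 0 := by
    rw [hc] at hi
    simpa [hc0] using hi
  rcases hφ k y hy hy0 hφy hk with h | ⟨c', hc'⟩
  · rw [hc] at hik
    simp [h] at hik
  · rw [hc] at e1 hik
    rw [hc'] at e2 hik
    simp only [LinearMap.smul_apply, smul_eq_mul] at e1 e2 hik
    have : (c * φ (p.pol i)) * (c' * φ (p.pol k)) = 4 := by rw [e1, e2]; norm_num
    linarith

lemma avg_span {J : Finset p.ι} (F : p.refl.FinCert J) (hJ : ∀ l ∈ J, φ (p.pol l) = 0) (x : p.E) :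
    φ (∑ w ∈ F.finite_WJ.toFinset, w x) = F.finite_WJ.toFinset.card * φ x := by
  rw [map_sum, ← nsmul_eq_mul, ← Finset.sum_const]
  refine Finset.sum_congr rfl fun w hw => ?_
  have h1 := ReflectionData.FinCert.sub_mem_span (F.finite_WJ.mem_toFinset.1 hw) x
  have h2 : Submodule.span ℝ (p.refl.v '' J) ≤ LinearMap.ker φ := by
    rw [Submodule.span_le]
    rintro _ ⟨l, hl, rfl⟩
    exact hJ l hl
  have := h2 h1
  rwa [LinearMap.mem_ker, map_sub, sub_eq_zero] at this

lemma wall_avg {J : Finset p.ι} (F : p.refl.FinCert J) {l : p.ι} (hl : l ∈ J) (x : p.E) :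
    p.wall l (∑ w ∈ F.finite_WJ.toFinset, w x) = 0 := by
  set T := F.finite_WJ.toFinset
  have hs : p.refl.s l ∈ p.refl.WJ J := p.refl.s_mem_WJ hl
  have h1 : p.refl.s l (∑ w ∈ T, w x) = ∑ w ∈ T, w x := by
    rw [map_sum]
    refine Finset.sum_bij' (fun w _ => p.refl.s l * w) (fun w _ => (p.refl.s l)⁻¹ * w) ?_ ?_ ?_ ?_ ?_
    · exact fun w hw => F.finite_WJ.mem_toFinset.2 (mul_mem hs (F.finite_WJ.mem_toFinset.1 hw))
    · exact fun w hw =>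
        F.finite_WJ.mem_toFinset.2 (mul_mem (inv_mem hs) (F.finite_WJ.mem_toFinset.1 hw))
    · exact fun w _ => inv_mul_cancel_left _ _
    · exact fun w _ => mul_inv_cancel_left _ _
    · exact fun w _ => rfl
  rw [s_apply, sub_eq_self] at h1
  have h2 := congrArg (p.wall l) h1
  rw [map_smul, map_zero, show p.wall l (p.pol l) = 2 from p.refl.two l, smul_eq_mul] at h2
  simpa using h2

lemma eq_smul_vert {j : Fin p.n} {P : Fin 4} {y : p.E} (hy : ∀ l ∈ face j P, p.wall l y = 0) :
    ∃ c : ℝ, y = c • p.vert P (p.vtx j) := by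
  obtain ⟨f, a, c⟩ := y
  have e : f = p.wall (.inl j) (f, 0) • p.vtx j := by
    conv_lhs => rw [p.eq_sum_vtx f]
    refine Finset.sum_eq_single j (fun i _ hij => ?_) (fun h => absurd (Finset.mem_univ _) h)
    have := hy (.inl i) (p.mem_face_inl.2 hij)
    rw [wall_inl] at this ⊢
    rw [this, zero_smul]
  refine ⟨p.wall (.inl j) (f, 0), ?_⟩
  rw [← map_smul, ← e, vert_apply]
  have h1 := hy (.inr P) (p.mem_face_inr.2 (.inl rfl))
  have h2 := hy (.inr (P + 1)) (p.mem_face_inr.2 (.inr rfl))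
  have hk := p.k₄_pos.ne'
  fin_cases P
  · replace h1 : p.wall (.inr 0) (f, a, c) = 0 := h1
    replace h2 : p.wall (.inr 1) (f, a, c) = 0 := h2
    rw [wall_0] at h1
    rw [wall_1] at h2
    simp only at h1 h2
    simp [vertCoef, h1, h2]
  · replace h1 : p.wall (.inr 1) (f, a, c) = 0 := h1
    replace h2 : p.wall (.inr 2) (f, a, c) = 0 := h2
    rw [wall_1] at h1
    rw [wall_2_mk] at h2
    simp only at h1
    simp [vertCoef, h1]; linarith
  · replace h1 : p.wall (.inr 2) (f, a, c) = 0 := h1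
    replace h2 : p.wall (.inr 3) (f, a, c) = 0 := h2
    rw [wall_2_mk] at h1
    rw [wall_3_mk, mul_eq_zero, or_iff_right hk] at h2
    simp [vertCoef]; constructor <;> linarith
  · replace h1 : p.wall (.inr 3) (f, a, c) = 0 := h1
    replace h2 : p.wall (.inr 0) (f, a, c) = 0 := h2
    rw [wall_3_mk, mul_eq_zero, or_iff_right hk] at h1
    rw [wall_0] at h2
    simp only at h2
    simp [vertCoef, h2]; linarith

include hφ0 in
lemma not_face {x : p.E} (hx : x ∈ p.refl.K) (hx0 : φ x = 0) (j : Fin p.n) (P : Fin 4)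
    (hJ : ∀ l ∈ face j P, φ (p.pol l) = 0) : False := by
  set F := p.cert j P
  set T := F.finite_WJ.toFinset with hT
  have h1T : (1 : p.E ≃ₗ[ℝ] p.E) ∈ T := F.finite_WJ.mem_toFinset.2 (one_mem _)
  have hcard : (T.card : ℝ) ≠ 0 := by exact_mod_cast (Finset.card_pos.2 ⟨1, h1T⟩).ne'
  have key := fun y => eq_smul_vert fun l hl => wall_avg F hl y
  have hK : ∑ w ∈ T, w x ∈ p.refl.K :=
    Finset.sum_induction_nonempty (fun w : p.E ≃ₗ[ℝ] p.E => w x) (· ∈ p.refl.K)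
      (fun _ _ ha hb => p.isDividedCone.add_mem ha hb) ⟨1, h1T⟩ fun w hw =>
        p.refl.map_mem_K (p.refl.WJ_le _ (F.finite_WJ.mem_toFinset.1 hw)) hx
  obtain ⟨c, hc⟩ := key x
  have hc0 : c ≠ 0 := by
    rintro rfl
    rw [hc, zero_smul] at hK
    exact p.refl.zero_notMem_K hK
  have hq : φ (p.vert P (p.vtx j)) = 0 := by
    have h := avg_span F hJ x
    rw [hc, map_smul, hx0, mul_zero, smul_eq_mul] at h
    exact (mul_eq_zero.1 h).resolve_left hc0
  refine hφ0 (LinearMap.ext fun y => ?_)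
  obtain ⟨c, hc⟩ := key y
  have h := avg_span F hJ y
  rw [hc, map_smul, hq, smul_zero] at h
  simpa using (mul_eq_zero.1 h.symm).resolve_left hcard

lemma eq_zero_of_pol_inl (h : ∀ i, φ (p.pol (.inl i)) = 0) (f : Fin p.n → ℝ) : φ (f, 0) = 0 := by
  have hstep : ∀ i, φ (p.e i) = p.ω i * φ (p.e (i + 1)) := fun i => by
    have e : p.pol (.inl i) = p.e i - p.ω i • p.e (i + 1) := by simp [pol, e]
    have := h i
    rwa [e, map_sub, map_smul, sub_eq_zero] at this
  have hconst : ∀ k (hk : k < p.n), φ (p.e ⟨k, hk⟩) = φ (p.e p.fst) := by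
    intro k
    induction k with
    | zero => exact fun _ => rfl
    | succ k ih =>
      intro hk
      rw [← ih (by omega), hstep ⟨k, by omega⟩, ω, if_neg (by simp; omega), one_mul]
      congr 2
      exact (Fin.ext (by rw [val_add_one, if_neg (by simp; omega)])).symm
  have h0 : φ (p.e p.fst) = 0 := by
    have h1 := hstep p.lst
    rw [p.lst_add_one, ω, if_pos p.lst_val] at h1
    have h2 := hconst p.lst.val p.lst.isLt
    have h3 := p.one_lt_μ
    change φ (p.e p.lst) = p.μ * _ at h1
    rw [h1] at h2
    have : (p.μ - 1) * φ (p.e p.fst) = 0 := by linarith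
    exact (mul_eq_zero.1 this).resolve_left (by linarith)
  have : (f, (0 : ℝ × ℝ)) = ∑ i, f i • p.e i := by rw [sum_smul_e]; rfl
  rw [this, map_sum]
  refine Finset.sum_eq_zero fun i _ => ?_
  rw [map_smul, hconst i.val i.isLt, h0, smul_zero]

end Wall

end VinbergParams

namespace VinbergParams

variable {p : VinbergParams}

section Hyperplane

variable {φ : Module.Dual ℝ p.E} (hφ0 : φ ≠ 0)
  (hφ : ∀ i, ∀ x ∈ p.refl.C, x ≠ 0 → φ x = 0 → p.wall i x = 0 →
    φ (p.pol i) = 0 ∨ ∃ c : ℝ, p.wall i = c • φ)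

include hφ in
lemma pol_inl_eq_zero {j : Fin p.n} {z : ℝ × ℝ} (hC : ((p.vtx j, z) : p.E) ∈ p.refl.C)
    (h : φ (p.vtx j, z) = 0) {i : Fin p.n} (hi : i ≠ j) : φ (p.pol (.inl i)) = 0 :=
  pol_eq_zero hφ hC (fun h0 => p.vtx_ne_zero j (congrArg Prod.fst h0)) h
    (by rw [wall_inl_vtx, if_neg hi])

include hφ0 hφ in
lemma ne_zero_on_alcove {f : Fin p.n → ℝ} (hf : ∀ i, (p.ω i)⁻¹ * f (i + 1) ≤ f i) (hf0 : f ≠ 0) :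
    φ (f, 0) ≠ 0 := by
  intro h
  have h3 := p.three_le
  have hκ := p.κ_pos
  have hb := p.b_lt
  have hb1 := p.one_le_b
  have J : ∀ (P k : Fin 4), (k = P ∨ k = P + 1) → φ (p.vert P f) = 0 → φ (p.pol (.inr k)) = 0 :=
    fun P k hk h => pol_eq_zero hφ (vert_mem_C hf P) (p.vert_ne_zero hf0 P) h (p.wall_vert P k hk f)
  have h0 : φ (p.vert 0 f) = 0 := by rwa [vert_zero]
  have p0 := J 0 0 (by simp) h0
  have p1 := J 0 1 (by simp) h0
  have e : ∀ a c : ℝ, φ (0, a, c) = a * φ (0, 1, 0) + c * φ (0, 0, 1) := by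
    intro a c
    rw [← smul_eq_mul, ← smul_eq_mul, ← map_smul, ← map_smul, ← map_add]
    simp
  simp only [pol] at p0 p1
  rw [e] at p0 p1
  have hz : ∀ (g : Fin p.n → ℝ) (z : ℝ × ℝ), φ (g, z) = φ (g, 0) := by
    intro g z
    have e1 : ((g, z) : p.E) = (g, 0) + (0, z.1, z.2) := by simp
    rw [e1, map_add, e, show φ (0, 1, 0) = 0 by linarith, show φ (0, 0, 1) = 0 by linarith]
    simp
  have p2 := J 1 2 (by simp) (by rw [vert_apply, hz, h])
  have p3 := J 3 3 (by simp) (by rw [vert_apply, hz, h])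
  simp only [pol] at p2 p3
  rw [hz] at p2 p3
  set B : Fin p.n := ⟨p.b - 1, by omega⟩
  have e2 : p.vtx p.lst = -(fun _ => -(1 + p.κ)) := by
    ext i
    have : i ≤ p.lst := by rw [Fin.le_def]; have := p.lst_val; have := i.isLt; omega
    simp [vtx, this]
  have e3 : p.vtx B = -(-p.hi) := by
    ext i
    simp only [vtx, hi, Fin.le_def, B, neg_neg]
    split_ifs <;> first | rfl | omega
  have hl : φ (p.vtx p.lst, 0) = 0 := by
    rw [e2, show ((-(fun _ => -(1 + p.κ)), 0) : p.E) = -((fun _ => -(1 + p.κ)), 0) by simp,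
      map_neg, p2, neg_zero]
  have hB : φ (p.vtx B, 0) = 0 := by
    rw [e3, show ((-(-p.hi), 0) : p.E) = -(-p.hi, 0) by simp, map_neg, p3, neg_zero]
  have hBl : B ≠ p.lst := fun h => by
    have h1 := congrArg Fin.val h
    have := p.lst_val
    simp only [B] at h1
    omega
  have hC : ∀ j, ((p.vtx j, 0) : p.E) ∈ p.refl.C := fun j => by
    rw [← vert_zero]; exact vert_mem_C (p.alcove_vtx j) 0
  refine hφ0 (LinearMap.ext fun y => ?_)
  obtain ⟨g, z⟩ := y
  rw [hz]
  refine eq_zero_of_pol_inl (fun i => ?_) g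
  by_cases hi : i = B
  · exact pol_inl_eq_zero hφ (hC _) hl (hi ▸ hBl)
  · exact pol_inl_eq_zero hφ (hC _) hB hi

include hφ0 hφ in
lemma not_pos_on_alcove {x : p.E} (hx : x ∈ p.refl.C) (hx0 : x ≠ 0) (h0 : φ x = 0)
    (hpos : ∀ f : Fin p.n → ℝ, (∀ i, (p.ω i)⁻¹ * f (i + 1) ≤ f i) → f ≠ 0 → 0 < φ (f, 0)) :
    False := by
  have h3 := p.three_le
  obtain ⟨f, z⟩ := x
  have hf := alcove_of_mem_C hx
  simp only at hf
  have hf0 : f ≠ 0 := fun h => hx0 (eq_zero_of_fst hx (by simp [h]))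
  obtain ⟨P, hP⟩ : ∃ P, φ (p.vert P f) ≤ 0 := by
    by_contra! h
    exact (p.pos_of_vert hx h).ne' h0
  have hc : ∀ j, 0 ≤ p.wall (.inl j) (f, 0) := fun j => by
    rw [wall_inl]; have := hf j; simp only; linarith
  obtain ⟨j, hj⟩ : ∃ j, φ (p.vert P (p.vtx j)) ≤ 0 := by
    by_contra! h
    have e := p.eq_sum_vtx f
    have h1 : φ (p.vert P f) = ∑ j, p.wall (.inl j) (f, 0) * φ (p.vert P (p.vtx j)) := by
      conv_lhs => rw [e]
      simp only [map_sum, map_smul, smul_eq_mul]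
    have h2 : ∀ j ∈ Finset.univ, 0 ≤ p.wall (.inl j) (f, 0) * φ (p.vert P (p.vtx j)) :=
      fun j _ => mul_nonneg (hc j) (h j).le
    have h4 := (Finset.sum_eq_zero_iff_of_nonneg h2).1
      (le_antisymm (h1 ▸ hP) (Finset.sum_nonneg h2))
    refine hf0 (e.trans (Finset.sum_eq_zero fun j hj => ?_))
    rw [(mul_eq_zero.1 (h4 j hj)).resolve_right (h j).ne', zero_smul]
  have hconv : ∀ {x y : p.E}, x ∈ p.refl.C → y ∈ p.refl.C → ∀ {s t : ℝ}, 0 ≤ s → 0 ≤ t →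
      s • x + t • y ∈ p.refl.C := fun hx hy s t hs ht i => by
    rw [map_add, map_smul, map_smul]
    exact add_nonneg (mul_nonneg hs (hx i)) (mul_nonneg ht (hy i))
  have key : ∀ j, φ (p.vert P (p.vtx j)) ≤ 0 → ∀ i ≠ j, φ (p.pol (.inl i)) = 0 := by
    intro j hj i hi
    have ha := hpos _ (p.alcove_vtx j) (p.vtx_ne_zero j)
    set a := φ (p.vtx j, 0) with hadef
    set g := φ (p.vert P (p.vtx j)) with hg
    have hag : 0 < a - g := by linarith
    have hmem := hconv (vert_mem_C (p.alcove_vtx j) 0) (vert_mem_C (p.alcove_vtx j) P)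
      (s := -g / (a - g)) (t := a / (a - g)) (div_nonneg (by linarith) hag.le)
      (div_nonneg ha.le hag.le)
    have hval : φ ((-g / (a - g)) • p.vert 0 (p.vtx j) + (a / (a - g)) • p.vert P (p.vtx j)) = 0 := by
      rw [map_add, map_smul, map_smul, vert_zero, ← hadef, ← hg, smul_eq_mul, smul_eq_mul]
      ring
    obtain ⟨z', hz'⟩ : ∃ z', (-g / (a - g)) • p.vert 0 (p.vtx j) +
        (a / (a - g)) • p.vert P (p.vtx j) = (p.vtx j, z') := by
      refine ⟨_, Prod.ext ?_ rfl⟩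
      simp only [vert_apply, Prod.fst_add, Prod.smul_fst, ← add_smul]
      rw [← add_div, neg_add_eq_sub, div_self hag.ne', one_smul]
    rw [hz'] at hmem hval
    exact pol_inl_eq_zero hφ hmem hval hi
  obtain ⟨k, hk⟩ : ∃ k, k ≠ j := ⟨j + 1, p.add_one_ne j⟩
  by_cases hgk : φ (p.vert P (p.vtx k)) ≤ 0
  · refine (hpos f hf hf0).ne' (eq_zero_of_pol_inl (fun i => ?_) f)
    by_cases hi : i = j
    · exact key k hgk i (hi ▸ hk.symm)
    · exact key j hj i hi
  · push Not at hgk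
    set a := φ (p.vert P (p.vtx k)) with ha
    set g := φ (p.vert P (p.vtx j)) with hg
    have hw : p.vert P (a • p.vtx j + (-g) • p.vtx k) ∈ p.refl.C := by
      rw [map_add, map_smul, map_smul]
      exact hconv (vert_mem_C (p.alcove_vtx j) P) (vert_mem_C (p.alcove_vtx k) P) hgk.le
        (by linarith)
    have hne : a • p.vtx j + (-g) • p.vtx k ≠ 0 := fun h => by
      have h1 := congrFun h p.fst
      have e : ∀ j, p.vtx j p.fst = 1 + p.κ := fun j => if_pos (Nat.zero_le _)
      simp only [Pi.add_apply, Pi.smul_apply, e, Pi.zero_apply, smul_eq_mul, ← add_mul] at h1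
      have := p.κ_pos
      have : 0 < (a + -g) * (1 + p.κ) := mul_pos (by linarith) (by linarith)
      linarith
    have hz : φ (p.vert P (a • p.vtx j + (-g) • p.vtx k)) = 0 := by
      rw [map_add, map_smul, map_smul, map_add, map_smul, map_smul, ← ha, ← hg, smul_eq_mul,
        smul_eq_mul]
      ring
    refine not_face hφ0 (p.refl.mem_K_of_mem_C hx hx0) h0 j P ?_
    rintro (i | l) hl
    · exact key j hj i (p.mem_face_inl.1 hl)
    · exact pol_eq_zero hφ hw (p.vert_ne_zero hne P) hz (p.wall_vert P l (p.mem_face_inr.1 hl) _)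

include hφ0 hφ in
lemma ne_zero_on_chamber {x : p.E} (hx : x ∈ p.refl.C) (hx0 : x ≠ 0) : φ x ≠ 0 := by
  intro h0
  have hne := fun f hf hf0 => ne_zero_on_alcove hφ0 hφ (f := f) hf hf0
  set v := p.vtx p.fst with hv
  have hv1 := p.alcove_vtx p.fst
  rw [← hv] at hv1
  have hv0 : v ≠ 0 := p.vtx_ne_zero p.fst
  have hmain : ∀ f : Fin p.n → ℝ, (∀ i, (p.ω i)⁻¹ * f (i + 1) ≤ f i) → f ≠ 0 →
      0 < φ (v, 0) * φ (f, 0) := by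
    intro f hf hf0
    by_contra! hle
    wlog hs : φ (f, 0) ≤ 0 ∧ 0 ≤ φ (v, 0) generalizing φ
    · refine this (φ := -φ) (neg_ne_zero.2 hφ0) (fun i x hx hx0 h hw => ?_) (by simpa using h0)
        (fun f hf hf0 => by simpa using hne f hf hf0) (by simpa using hle) ?_
      · rw [LinearMap.neg_apply, neg_eq_zero] at h ⊢
        exact (hφ i x hx hx0 h hw).imp id fun ⟨c, hc⟩ => ⟨-c, by simpa using hc⟩
      · rw [LinearMap.neg_apply, LinearMap.neg_apply]
        have h1 := hne f hf hf0
        have h2 := hne v hv1 hv0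
        rcases mul_nonpos_iff.1 hle with h | h
        · exact absurd ⟨h.2, h.1⟩ hs
        · exact ⟨by linarith [h.2], by linarith [h.1]⟩
    obtain ⟨h1, h2⟩ := hs
    refine hne (φ (v, 0) • f + (-φ (f, 0)) • v) (fun i => ?_) (fun h => ?_) ?_
    · simp only [Pi.add_apply, Pi.smul_apply, smul_eq_mul]
      have a1 := mul_le_mul_of_nonneg_left (hf i) h2
      have a2 := mul_le_mul_of_nonneg_left (hv1 i) (neg_nonneg.2 h1)
      linarith
    · have b1 := congrFun h p.fst
      have b2 : 0 < f p.fst := lt_of_not_ge fun hc => hf0 (alcove_eq_zero_of_le hf hc)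
      have b3 : 0 < v p.fst := lt_of_not_ge fun hc => hv0 (alcove_eq_zero_of_le hv1 hc)
      have b4 := lt_of_le_of_ne h2 (hne v hv1 hv0).symm
      simp only [Pi.add_apply, Pi.smul_apply, smul_eq_mul, Pi.zero_apply] at b1
      have := mul_pos b4 b2
      have := mul_nonneg (neg_nonneg.2 h1) b3.le
      linarith
    · have e : ((φ (v, 0) • f + (-φ (f, 0)) • v, 0) : p.E) =
          φ (v, 0) • ((f, 0) : p.E) + (-φ (f, 0)) • ((v, 0) : p.E) := by simp
      rw [e, map_add, map_smul, map_smul, smul_eq_mul, smul_eq_mul]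
      ring
  refine not_pos_on_alcove (φ := φ (v, 0) • φ) (smul_ne_zero (hne v hv1 hv0) hφ0)
    (fun i x hx hx0 h hw => ?_) hx hx0 (by simp [h0]) fun f hf hf0 => hmain f hf hf0
  have hc := hne v hv1 hv0
  rw [LinearMap.smul_apply, smul_eq_mul, mul_eq_zero, or_iff_right hc] at h
  refine (hφ i x hx hx0 h hw).imp (fun h => by simp [h]) fun ⟨c, hc'⟩ => ⟨c / φ (v, 0), ?_⟩
  rw [smul_smul, div_mul_cancel₀ _ hc, hc']

end Hyperplane

theorem not_isConeSimplex (v : Fin (p.n + 1) → p.E) : ¬ IsConeSimplex p.refl.K v := by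
  intro hv
  obtain ⟨w, hw, x, hx, hx0, hwx⟩ : ∑ i, v i ∈ p.refl.K := by
    simpa using hv.2.1 (fun _ => 1) fun _ => one_pos
  have hK : (w⁻¹ : p.E ≃ₗ[ℝ] p.E) '' p.refl.K = p.refl.K := by
    ext y
    constructor
    · rintro ⟨z, hz, rfl⟩
      exact p.refl.map_mem_K (inv_mem hw) hz
    · exact fun hy => ⟨w y, p.refl.map_mem_K hw hy, ReflectionData.inv_apply_self w y⟩
  have hu := hv.map (w⁻¹ : p.E ≃ₗ[ℝ] p.E)
  rw [hK] at hu
  have hsum : ∑ i, (w⁻¹ : p.E ≃ₗ[ℝ] p.E) (v i) = x := by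
    rw [← map_sum, ← hwx, ReflectionData.inv_apply_self]
  set u : Fin (p.n + 1) → p.E := fun i => (w⁻¹ : p.E ≃ₗ[ℝ] p.E) (v i)
  have hrank : Module.finrank ℝ (Submodule.span ℝ (range u)) = p.n + 1 := by
    rw [finrank_span_eq_card hu.1, Fintype.card_fin]
  have hlt : Submodule.span ℝ (range u) < ⊤ := by
    refine lt_top_iff_ne_top.2 fun h => ?_
    rw [h, finrank_top, finrank_E] at hrank
    omega
  obtain ⟨φ, hφ0, hle⟩ := Submodule.exists_le_ker_of_lt_top _ hlt
  have hφu : ∀ i, φ (u i) = 0 := fun i => hle (Submodule.subset_span ⟨i, rfl⟩)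
  have hker : Submodule.span ℝ (range u) = LinearMap.ker φ :=
    Submodule.eq_of_le_of_finrank_eq hle (by
      have := Module.Dual.finrank_ker_add_one_of_ne_zero hφ0
      rw [finrank_E] at this
      omega)
  have h3 := p.three_le
  refine ne_zero_on_chamber hφ0 (fun i y hy hy0 h0 hw0 => ?_) hx hx0 ?_
  · refine (p.isDividedCone.simplex_wall (by rw [finrank_E]) (by omega) hu hφ0 hφu (p.refl.s_mem i)
      (p.s_apply i) (p.refl.mem_K_of_mem_C hy hy0) h0 hw0).imp id fun h => ?_
    have hle' : ⨅ _ : Unit, LinearMap.ker φ ≤ LinearMap.ker (p.wall i) := by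
      rw [iInf_const, ← hker, Submodule.span_le]
      rintro _ ⟨k, rfl⟩
      exact h k
    have := mem_span_of_iInf_ker_le_ker (L := fun _ : Unit => φ) hle'
    rw [range_const, Submodule.mem_span_singleton] at this
    obtain ⟨c, hc⟩ := this
    exact ⟨c, hc.symm⟩
  · rw [← hsum, map_sum]
    exact Finset.sum_eq_zero fun i _ => hφu i

end VinbergParams

lemma VinbergParams.exists_params {n b : ℕ}
    (h : (n = 3 ∧ b = 1) ∨ (n = 4 ∧ b = 2) ∨ (n = 5 ∧ b = 2) ∨ (n = 6 ∧ b = 3)) :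
    ∃ p : VinbergParams, p.n = n := by
  have hn : (3 : ℝ) ≤ n := by
    have : 3 ≤ n := by omega
    exact_mod_cast this
  obtain ⟨y, hy, hyeq⟩ : ∃ y ∈ Ioc (2 / (3 * n) : ℝ) 2,
      3 / 4 * (n : ℝ) ^ 2 * y ^ 2 + (b * (n - b) - n) * y - 1 = 0 := by
    have hle : (2 / (3 * n) : ℝ) ≤ 2 := by
      rw [div_le_iff₀ (by linarith)]; linarith
    refine intermediate_value_Ioc hle
      (f := fun y : ℝ => 3 / 4 * (n : ℝ) ^ 2 * y ^ 2 + (b * (n - b) - n) * y - 1) (by fun_prop) ?_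
    rcases h with ⟨rfl, rfl⟩ | ⟨rfl, rfl⟩ | ⟨rfl, rfl⟩ | ⟨rfl, rfl⟩ <;> norm_num
  have hy0 : 0 < y := lt_trans (by positivity) hy.1
  obtain ⟨κ, hκ, hκy⟩ : ∃ κ ∈ Ioc (0 : ℝ) 1, κ * (1 + κ) = y :=
    intermediate_value_Ioc zero_le_one (f := fun κ : ℝ => κ * (1 + κ)) (by fun_prop)
      (by norm_num; exact ⟨hy0, hy.2⟩)
  refine ⟨⟨n, b, κ, hκ.1, h, ?_, ?_⟩, rfl⟩
  · have e : (n * κ + b) * (n * κ + n - b) = (n : ℝ) ^ 2 * y + b * (n - b) := by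
      rw [← hκy]; ring
    rw [mul_assoc, e, hκy]
    linear_combination hyeq
  · rw [hκy]
    have := (div_lt_iff₀ (by positivity)).1 hy.1
    linarith

/-- Choi–Lee–Marquis: for `d = 4, …, 7` there is an indecomposable divisible properly
convex domain `Ω ⊆ ℝP^d`, not strictly convex, with non-`C¹` boundary, containing a
properly embedded `(d-2)`-simplex but no properly embedded `(d-1)`-simplex. -/
theorem exists_divisible_with_codim2_simplex (d : ℕ) (hd : 4 ≤ d) (hd' : d ≤ 7) :
    ∃ (Ω : Set (RP d)) (Γ : Subgroup (GL (Fin (d + 1)) ℝ)),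
      IsProperlyConvexDomain Ω ∧ Divides Γ Ω ∧ StronglyIrreducible Γ ∧
      ¬ IsStrictlyConvexDomain Ω ∧
      (∃ x ∈ frontier Ω, ∃ φ ψ : Module.Dual ℝ (Vec d),
        IsSupportingAt Ω φ x ∧ IsSupportingAt Ω ψ x ∧
        LinearMap.ker φ ≠ LinearMap.ker ψ) ∧
      (∃ v : Fin (d - 2 + 1) → Vec d, ProperlyEmbeddedSimplex Ω v) ∧
      ¬ ∃ v : Fin (d - 1 + 1) → Vec d, ProperlyEmbeddedSimplex Ω v := by
  obtain ⟨b, hb⟩ : ∃ b, (d - 1 = 3 ∧ b = 1) ∨ (d - 1 = 4 ∧ b = 2) ∨ (d - 1 = 5 ∧ b = 2) ∨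
      (d - 1 = 6 ∧ b = 3) := by
    have : d = 4 ∨ d = 5 ∨ d = 6 ∨ d = 7 := by omega
    rcases this with rfl | rfl | rfl | rfl
    exacts [⟨1, by simp⟩, ⟨2, by simp⟩, ⟨2, by simp⟩, ⟨3, by simp⟩]
  obtain ⟨p, hp⟩ := VinbergParams.exists_params hb
  have h := p.exists_domain d (by omega) (m := d - 2) (by omega) p.not_isConeSimplex
  rwa [hp] at h
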